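/- Fix a real constant C > 0 and an integer n ≥ 3. There are only finitely many subfields K of ℝ that are totally real number fields satisfying U_K(n) < C. -/

import Mathlib

open scoped TensorProduct

noncomputable section

open NumberField

structure OKLattice (K : Type) [Field K] : Type 1 where
  carrier : Type
  [addCommGroup : AddCommGroup carrier]
  [module : Module (𝓞 K) carrier]
  [finite : Module.Finite (𝓞 K) carrier]
  [torsionFree : NoZeroSMulDivisors (𝓞 K) carrier]
  form : carrier →ₗ[𝓞 K] carrier →ₗ[𝓞 K] 𝓞 K
  symm : ∀ x y, form x y = form y x
  posDef : ∀ v : carrier, v ≠ 0 → ∀ σ : K →+* ℝ, 0 < σ (algebraMap (𝓞 K) K (form v v))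

attribute [instance] OKLattice.addCommGroup OKLattice.module OKLattice.finite
  OKLattice.torsionFree

namespace OKLattice

variable {K : Type} [Field K]

/-- The rank of an `O_K`-lattice: the `K`-dimension of `L ⊗ K`. -/
def rank (L : OKLattice K) : ℕ :=
  Module.finrank K (K ⊗[𝓞 K] L.carrier)

/-- `L.Represents L'` : `L'` is represented by `L`. -/
def Represents (L L' : OKLattice K) : Prop :=
  ∃ σ : L'.carrier →ₗ[𝓞 K] L.carrier, ∀ x, L.form (σ x) (σ x) = L'.form x x

/-- `L` is `n`-universal. -/
def IsUniversal (L : OKLattice K) (n : ℕ) : Prop :=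
  ∀ L' : OKLattice K, L'.rank = n → L.Represents L'

end OKLattice

/-- `U_K(n)`: the minimal rank of an `n`-universal `O_K`-lattice. -/
def minUnivRank (K : Type) [Field K] (n : ℕ) : ℕ :=
  sInf {m | ∃ L : OKLattice K, L.IsUniversal n ∧ L.rank = m}

/-- `K` is totally real: every embedding into `ℂ` has image contained in `ℝ`. -/
def TotallyReal (K : Type) [Field K] : Prop :=
  ∀ φ : K →+* ℂ, ∀ x : K, (φ x).im = 0

section RealEmbeddings

variable {K : Type} [Field K]

theorem TotallyReal.exists_real (hK : TotallyReal K) (φ : K →+* ℂ) :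
    ∃ σ : K →+* ℝ, ∀ x, φ x = (σ x : ℂ) := by
  have h : ComplexEmbedding.IsReal φ := by
    rw [ComplexEmbedding.isReal_iff]
    ext x
    exact Complex.conj_eq_iff_im.2 (hK φ x)
  exact ⟨h.embedding, fun x => (ComplexEmbedding.IsReal.coe_embedding_apply h x).symm⟩

theorem TotallyReal.norm_le (hK : TotallyReal K) {x : K} {B : ℝ}
    (h : ∀ σ : K →+* ℝ, |σ x| ≤ B) (φ : K →+* ℂ) : ‖φ x‖ ≤ B := by
  obtain ⟨σ, hσ⟩ := hK.exists_real φ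
  rw [hσ, Complex.norm_real]
  exact h σ

variable [NumberField K]

theorem TotallyReal.nonempty_embedding (hK : TotallyReal K) : Nonempty (K →+* ℝ) := by
  obtain ⟨φ⟩ : Nonempty (K →+* ℂ) := inferInstance
  exact ⟨(hK.exists_real φ).choose⟩

theorem TotallyReal.finite_bounded (hK : TotallyReal K) (B : ℝ) :
    {x : K | IsIntegral ℤ x ∧ ∀ σ : K →+* ℝ, |σ x| ≤ B}.Finite :=
  (Embeddings.finite_of_norm_le K ℂ B).subset fun _ hx => ⟨hx.1, hK.norm_le hx.2⟩

theorem TotallyReal.eq_of_bounded_one (hK : TotallyReal K) {x : K} (hx : IsIntegral ℤ x)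
    (h : ∀ σ : K →+* ℝ, |σ x| ≤ 1) : x = 0 ∨ x = 1 ∨ x = -1 := by
  by_cases hx0 : x = 0
  · exact Or.inl hx0
  obtain ⟨n, hn, h1⟩ := Embeddings.pow_eq_one_of_norm_le_one K ℂ hx0 hx (hK.norm_le h)
  obtain ⟨σ⟩ := hK.nonempty_embedding
  have h2 : (σ x) ^ n = 1 := by rw [← map_pow, h1, map_one]
  have h3 : |σ x| = 1 := by
    refine (pow_eq_one_iff_of_nonneg (abs_nonneg _) hn.ne').1 ?_
    rw [← abs_pow, h2, abs_one]
  right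
  rcases (abs_eq zero_le_one).1 h3 with h | h
  · left; exact σ.injective (by simpa using h)
  · right; exact σ.injective (by simpa using h)

theorem TotallyReal.trace_eq (hK : TotallyReal K) (x : K) :
    ((Algebra.trace ℚ K x : ℚ) : ℝ) = ∑ σ : K →+* ℝ, σ x := by
  have h := trace_eq_sum_embeddings (K := ℚ) (L := K) ℂ (x := x)
  have h2 : ∑ σ : K →ₐ[ℚ] ℂ, σ x = ∑ σ : K →+* ℂ, σ x :=
    (Fintype.sum_equiv (RingHom.equivRatAlgHom K ℂ) (fun σ : K →+* ℂ => σ x) (fun σ => σ x)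
      (fun _ => rfl)).symm
  have h3 : ∑ σ : K →+* ℂ, σ x = ∑ σ : K →+* ℝ, ((σ x : ℝ) : ℂ) := by
    symm
    refine Fintype.sum_bijective (fun σ : K →+* ℝ => Complex.ofRealHom.comp σ) ⟨?_, ?_⟩ _ _ ?_
    · intro σ τ h
      ext y
      exact Complex.ofReal_injective (RingHom.congr_fun h y)
    · intro φ
      obtain ⟨σ, hσ⟩ := hK.exists_real φ
      exact ⟨σ, by ext y; exact (hσ y).symm⟩
    · intro σ; rfl
  rw [h2, h3] at h
  apply Complex.ofReal_injective
  push_cast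
  rw [← h]
  simp

theorem TotallyReal.exists_int_trace (hK : TotallyReal K) {x : K} (hx : IsIntegral ℤ x) :
    ∃ z : ℤ, ∑ σ : K →+* ℝ, σ x = z := by
  refine ⟨Algebra.trace ℤ (𝓞 K) ⟨x, hx⟩, ?_⟩
  rw [← hK.trace_eq]
  have := Algebra.coe_trace_int (K := K) ⟨x, hx⟩
  rw [show Algebra.trace ℚ K x = _ from this.symm]
  simp

theorem TotallyReal.one_le_trace (hK : TotallyReal K) {x : K} (hx : IsIntegral ℤ x)
    (h : ∀ σ : K →+* ℝ, 0 < σ x) : 1 ≤ ∑ σ : K →+* ℝ, σ x := by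
  obtain ⟨z, hz⟩ := hK.exists_int_trace hx
  have : Nonempty (K →+* ℝ) := hK.nonempty_embedding
  have h0 : 0 < ∑ σ : K →+* ℝ, σ x := Finset.sum_pos (fun σ _ => h σ) Finset.univ_nonempty
  rw [hz] at h0 ⊢
  exact_mod_cast h0

theorem exists_isIntegral_mul_eq_natCast_le {x : K} (hx : IsIntegral ℤ x)
    (h0 : x ≠ 0) {B : ℝ} (hB : ∀ φ : K →+* ℂ, ‖φ x‖ ≤ B) :
    ∃ (n : ℕ) (y : K), n ≠ 0 ∧ IsIntegral ℤ y ∧ x * y = n ∧ (n : ℝ) ≤ B ^ Module.finrank ℚ K := by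
  obtain ⟨X, rfl⟩ : ∃ X : 𝓞 K, (X : K) = x := ⟨⟨x, hx⟩, rfl⟩
  have hne : X ≠ 0 := fun h => h0 (by simp [h])
  have hmem := Ideal.absNorm_mem (Ideal.span {X})
  obtain ⟨y, hy⟩ := Ideal.mem_span_singleton'.1 hmem
  refine ⟨Ideal.absNorm (Ideal.span {X}), y, ?_, RingOfIntegers.isIntegral_coe y, ?_, ?_⟩
  · rw [Ne, Ideal.absNorm_eq_zero_iff, Ideal.span_singleton_eq_bot]
    exact hne
  · have := congrArg (algebraMap (𝓞 K) K) hy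
    rw [map_mul, map_natCast, mul_comm] at this
    exact this
  · have h1 := Algebra.norm_eq_prod_embeddings ℚ ℂ (X : K)
    rw [← Algebra.coe_norm_int, eq_ratCast, Rat.cast_intCast] at h1
    have h2 : ((Ideal.absNorm (Ideal.span {X}) : ℕ) : ℝ) = ‖((Algebra.norm ℤ X : ℤ) : ℂ)‖ := by
      rw [Ideal.absNorm_span_singleton, Complex.norm_intCast, ← Int.cast_abs, Int.abs_eq_natAbs,
        Int.cast_natCast]
    rw [h2, h1, norm_prod, ← AlgHom.card ℚ K ℂ, ← Finset.card_univ]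
    exact (Finset.prod_le_prod (fun _ _ => norm_nonneg _) fun φ _ => hB φ.toRingHom).trans_eq
      (Finset.prod_const B)

theorem exists_isIntegral_mul_eq_natCast {x : K} (hx : IsIntegral ℤ x) (h0 : x ≠ 0) :
    ∃ (n : ℕ) (y : K), n ≠ 0 ∧ IsIntegral ℤ y ∧ x * y = n := by
  obtain ⟨n, y, hn, hy, h, -⟩ := exists_isIntegral_mul_eq_natCast_le hx h0 fun φ =>
    Finset.single_le_sum (f := fun φ : K →+* ℂ => ‖φ x‖) (fun _ _ => norm_nonneg _)
      (Finset.mem_univ φ)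
  exact ⟨n, y, hn, hy, h⟩

theorem exists_natCast_mul_isIntegral (x : K) : ∃ n : ℕ, n ≠ 0 ∧ IsIntegral ℤ ((n : K) * x) := by
  obtain ⟨y, hy, h⟩ := exists_integral_multiples ℤ ℚ ({x} : Finset K)
  refine ⟨y.natAbs, by simpa using hy, ?_⟩
  have h1 : IsIntegral ℤ (y • x) := h x (by simp)
  rcases Int.natAbs_eq y with h2 | h2
  · rw [h2] at h1; simpa using h1
  · rw [h2] at h1; simpa using h1.neg

/-- A `ℚ`-basis of `K` spanning the integers, with coordinates controlled by the embeddings. -/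
theorem TotallyReal.exists_integral_coordinates (hK : TotallyReal K) :
    ∃ (d : ℕ) (ω : Fin d → K) (t : Fin d → K → ℚ) (c : ℝ), 0 < c ∧
      (∀ k, IsIntegral ℤ (ω k)) ∧ (∀ x, x = ∑ k, (t k x : K) * ω k) ∧
      (∀ x, IsIntegral ℤ x → ∀ k, ∃ z : ℤ, t k x = z) ∧
      (∀ x S, (∀ σ : K →+* ℝ, |σ x| ≤ S) → ∀ k, |(t k x : ℝ)| ≤ c * S) := by
  classical
  let e := Fintype.equivFin (Module.Free.ChooseBasisIndex ℤ (𝓞 K))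
  let b := (integralBasis K).reindex e
  have hb : ∀ x k, b.repr x k = Algebra.trace ℚ K (x * b.traceDual k) := by
    intro x k
    conv_lhs => rw [← b.traceDual_traceDual]
    rw [Module.Basis.traceDual_repr_apply, Algebra.traceForm_apply]
  refine ⟨_, b, fun k x => b.repr x k,
    1 + ∑ k, ∑ σ : K →+* ℝ, |σ (b.traceDual k)|, ?_, ?_, ?_, ?_, ?_⟩
  · have : 0 ≤ ∑ k, ∑ σ : K →+* ℝ, |σ (b.traceDual k)| :=
      Finset.sum_nonneg fun k _ => Finset.sum_nonneg fun σ _ => abs_nonneg _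
    linarith
  · intro k
    simp only [b, Module.Basis.coe_reindex, Function.comp, integralBasis_apply]
    exact RingOfIntegers.isIntegral_coe _
  · intro x
    conv_lhs => rw [← b.sum_repr x]
    exact Finset.sum_congr rfl fun k _ => by rw [Rat.smul_def]
  · intro x hx k
    have := integralBasis_repr_apply K ⟨x, hx⟩ (e.symm k)
    refine ⟨(RingOfIntegers.basis K).repr ⟨x, hx⟩ (e.symm k), ?_⟩
    simp only [b, Module.Basis.repr_reindex_apply]
    exact this
  · intro x S hS k
    obtain ⟨σ₀⟩ := hK.nonempty_embedding
    have hS0 : 0 ≤ S := (abs_nonneg _).trans (hS σ₀)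
    simp only
    rw [hb, hK.trace_eq]
    refine (Finset.abs_sum_le_sum_abs _ _).trans ?_
    have h1 : ∑ σ : K →+* ℝ, |σ (x * b.traceDual k)| ≤
        (∑ σ : K →+* ℝ, |σ (b.traceDual k)|) * S := by
      rw [Finset.sum_mul]
      refine Finset.sum_le_sum fun σ _ => ?_
      rw [map_mul, abs_mul, mul_comm]
      exact mul_le_mul_of_nonneg_left (hS σ) (abs_nonneg _)
    refine h1.trans (mul_le_mul_of_nonneg_right ?_ hS0)
    have h2 := Finset.single_le_sum (f := fun k => ∑ σ : K →+* ℝ, |σ (b.traceDual k)|)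
      (fun k _ => Finset.sum_nonneg fun σ _ => abs_nonneg _) (Finset.mem_univ k)
    linarith

theorem exists_unit_abs_lt (σ₀ : K →+* ℝ) :
    ∃ u v : K, IsIntegral ℤ u ∧ IsIntegral ℤ v ∧ u * v = 1 ∧
      ∀ σ : K →+* ℝ, σ ≠ σ₀ → |σ u| < 1 := by
  let w : (K →+* ℝ) → InfinitePlace K := fun σ => InfinitePlace.mk (Complex.ofRealHom.comp σ)
  have hw : ∀ σ x, w σ x = |σ x| := fun σ x => by
    simp [w, InfinitePlace.apply]
  obtain ⟨u, hu⟩ := Units.dirichletUnitTheorem.exists_unit K (w σ₀)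
  refine ⟨(u : 𝓞 K), ((u⁻¹ : (𝓞 K)ˣ) : 𝓞 K), RingOfIntegers.isIntegral_coe _,
    RingOfIntegers.isIntegral_coe _, ?_, ?_⟩
  · rw [← map_mul, ← Units.val_mul, mul_inv_cancel, Units.val_one, map_one]
  · intro σ hσ
    have hne : w σ ≠ w σ₀ := by
      intro h
      apply hσ
      rcases InfinitePlace.mk_eq_iff.1 h with h | h
      · ext x; exact Complex.ofReal_injective (RingHom.congr_fun h x)
      · ext x
        have := RingHom.congr_fun h x
        simp only [ComplexEmbedding.conjugate_coe_eq, RingHom.comp_apply,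
          Complex.ofRealHom_eq_coe, Complex.conj_ofReal] at this
        exact Complex.ofReal_injective this
    have h1 := hu (w σ) hne
    rw [hw] at h1
    have hpos : (0:ℝ) < |σ (u : 𝓞 K)| := by
      rw [abs_pos, Ne, map_eq_zero]
      exact NumberField.Units.coe_ne_zero u
    exact (Real.log_neg_iff hpos).1 h1

/-- A totally positive element that cannot be shortened by squares of units is balanced. -/
theorem exists_balanced_const :
    ∃ C : ℝ, 1 ≤ C ∧ ∀ x : K, (∀ σ : K →+* ℝ, 0 < σ x) →
      (∀ u v : K, IsIntegral ℤ u → IsIntegral ℤ v → u * v = 1 →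
        ∑ σ : K →+* ℝ, σ x ≤ ∑ σ : K →+* ℝ, σ (u ^ 2 * x)) →
      ∀ σ τ : K →+* ℝ, σ x ≤ C * τ x := by
  have hu : ∀ σ₀ : K →+* ℝ, ∃ u v : K, IsIntegral ℤ u ∧ IsIntegral ℤ v ∧ u * v = 1 ∧
      ∀ σ : K →+* ℝ, σ ≠ σ₀ → |σ u| ≤ 1 / 2 := by
    intro σ₀
    obtain ⟨u, v, hu, hv, huv, h⟩ := exists_unit_abs_lt σ₀
    have hN : ∃ N : ℕ, ∀ σ : K →+* ℝ, σ ≠ σ₀ → |σ u| ^ N ≤ 1 / 2 := by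
      have h1 : ∀ σ : K →+* ℝ, ∃ N : ℕ, σ ≠ σ₀ → |σ u| ^ N ≤ 1 / 2 := by
        intro σ
        by_cases hσ : σ = σ₀
        · exact ⟨0, fun h => absurd hσ h⟩
        · obtain ⟨N, hN⟩ := exists_pow_lt_of_lt_one (by norm_num : (0:ℝ) < 1 / 2) (h σ hσ)
          exact ⟨N, fun _ => hN.le⟩
      choose N hN using h1
      refine ⟨Finset.univ.sup N, fun σ hσ => le_trans ?_ (hN σ hσ)⟩
      exact pow_le_pow_of_le_one (abs_nonneg _) (h σ hσ).le (Finset.le_sup (Finset.mem_univ σ))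
    obtain ⟨N, hN⟩ := hN
    refine ⟨u ^ N, v ^ N, hu.pow N, hv.pow N, by rw [← mul_pow, huv, one_pow], fun σ hσ => ?_⟩
    rw [map_pow, abs_pow]
    exact hN σ hσ
  choose u v hu hv huv hlt using hu
  refine ⟨1 + ∑ σ₀ : K →+* ℝ, 2 * (σ₀ (u σ₀)) ^ 2, ?_, ?_⟩
  · have : 0 ≤ ∑ σ₀ : K →+* ℝ, 2 * (σ₀ (u σ₀)) ^ 2 :=
      Finset.sum_nonneg fun σ _ => by positivity
    linarith
  · intro x hx hmin σ τ
    classical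
    have h1 := hmin (u τ) (v τ) (hu τ) (hv τ) (huv τ)
    rw [← Finset.add_sum_erase _ _ (Finset.mem_univ τ),
      ← Finset.add_sum_erase _ (fun σ : K →+* ℝ => σ (u τ ^ 2 * x)) (Finset.mem_univ τ)] at h1
    have h2 : ∑ σ ∈ Finset.univ.erase τ, σ (u τ ^ 2 * x) ≤
        ∑ σ ∈ Finset.univ.erase τ, (1 / 4) * σ x := by
      refine Finset.sum_le_sum fun σ hσ => ?_
      rw [map_mul, map_pow]
      refine mul_le_mul_of_nonneg_right ?_ (hx σ).le
      have := hlt τ σ (Finset.ne_of_mem_erase hσ)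
      rw [← sq_abs]
      nlinarith [abs_nonneg (σ (u τ))]
    rw [← Finset.mul_sum] at h2
    rw [map_mul, map_pow] at h1
    have h3 : 2 * (τ (u τ)) ^ 2 ≤ ∑ σ₀ : K →+* ℝ, 2 * (σ₀ (u σ₀)) ^ 2 :=
      Finset.single_le_sum (f := fun σ₀ : K →+* ℝ => 2 * (σ₀ (u σ₀)) ^ 2)
        (fun σ _ => by positivity) (Finset.mem_univ τ)
    have hτ := hx τ
    have hnn : 0 ≤ ∑ σ₀ : K →+* ℝ, 2 * (σ₀ (u σ₀)) ^ 2 :=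
      Finset.sum_nonneg fun σ _ => by positivity
    by_cases hστ : σ = τ
    · subst hστ
      nlinarith
    · have h4 : σ x ≤ ∑ σ ∈ Finset.univ.erase τ, σ x :=
        Finset.single_le_sum (f := fun σ : K →+* ℝ => σ x) (fun σ _ => (hx σ).le)
          (Finset.mem_erase.2 ⟨hστ, Finset.mem_univ _⟩)
      nlinarith
end RealEmbeddings

section Reduction

variable {K : Type} [Field K] [NumberField K]

/-- Simultaneous approximation by integers of `K` with a bounded natural denominator. -/
theorem TotallyReal.exists_approx (hK : TotallyReal K) (r : ℕ) {ε : ℝ} (hε : 0 < ε) :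
    ∃ M : ℕ, ∀ x : Fin r → K, ∃ (a : ℕ) (α : Fin r → K), 1 ≤ a ∧ a ≤ M ∧
      (∀ j, IsIntegral ℤ (α j)) ∧ ∀ j (σ : K →+* ℝ), |σ (a * x j - α j)| ≤ ε := by
  classical
  obtain ⟨d, ω, t, c, hc, hω, hx, -, -⟩ := hK.exists_integral_coordinates
  obtain ⟨S, hS0, hS⟩ : ∃ S : ℝ, 0 < S ∧ ∀ σ : K →+* ℝ, ∑ k, |σ (ω k)| ≤ S := by
    refine ⟨1 + ∑ σ : K →+* ℝ, ∑ k, |σ (ω k)|, ?_, fun σ => ?_⟩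
    · have : 0 ≤ ∑ σ : K →+* ℝ, ∑ k, |σ (ω k)| :=
        Finset.sum_nonneg fun _ _ => Finset.sum_nonneg fun _ _ => abs_nonneg _
      linarith
    · have := Finset.single_le_sum (f := fun σ : K →+* ℝ => ∑ k, |σ (ω k)|)
        (fun _ _ => Finset.sum_nonneg fun _ _ => abs_nonneg _) (Finset.mem_univ σ)
      linarith
  obtain ⟨m, hm⟩ := exists_nat_gt (S / ε)
  have hm0 : (0 : ℝ) < m := (div_pos hS0 hε).trans hm
  have hmS : S / m ≤ ε := by
    rw [div_le_iff₀ hm0]; rw [div_lt_iff₀ hε] at hm; linarith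
  have hm' : 0 < m := by exact_mod_cast hm0
  refine ⟨Fintype.card (Fin r × Fin d → Fin m), fun x => ?_⟩
  let T : Fin r × Fin d → ℝ := fun p => (t p.2 (x p.1) : ℝ)
  let f : ℕ → (Fin r × Fin d → Fin m) := fun a p =>
    ⟨⌊(m : ℝ) * Int.fract (a * T p)⌋₊, by
      rw [Nat.floor_lt (by have := Int.fract_nonneg (a * T p); positivity)]
      exact (mul_lt_mul_of_pos_left (Int.fract_lt_one _) hm0).trans_eq (mul_one _)⟩
  have hpig : ∃ a₁ ∈ Finset.range (Fintype.card (Fin r × Fin d → Fin m) + 1),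
      ∃ a₂ ∈ Finset.range (Fintype.card (Fin r × Fin d → Fin m) + 1), a₁ ≠ a₂ ∧ f a₁ = f a₂ :=
    Finset.exists_ne_map_eq_of_card_lt_of_maps_to (t := Finset.univ)
      (by rw [Finset.card_range, Finset.card_univ]; exact Nat.lt_succ_self _)
      (fun _ _ => Finset.mem_coe.2 (Finset.mem_univ _))
  obtain ⟨a₁, h₁, a₂, h₂, hne, hf⟩ := hpig
  wlog hlt : a₁ < a₂ generalizing a₁ a₂
  · exact this a₂ h₂ a₁ h₁ hne.symm hf.symm (lt_of_le_of_ne (not_lt.1 hlt) hne.symm)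
  rw [Finset.mem_range] at h₂
  let z : Fin r × Fin d → ℤ := fun p => ⌊a₂ * T p⌋ - ⌊a₁ * T p⌋
  refine ⟨a₂ - a₁, fun j => ∑ k, (z (j, k) : K) * ω k, by omega, by omega, fun j => ?_,
    fun j σ => ?_⟩
  · exact IsIntegral.sum _ fun k _ => (isIntegral_intCast _).mul (hω k)
  · have h3 : ∀ p, |((a₂ - a₁ : ℕ) : ℝ) * T p - z p| ≤ 1 / m := by
      intro p
      have h4 : ⌊(m : ℝ) * Int.fract (a₁ * T p)⌋₊ = ⌊(m : ℝ) * Int.fract (a₂ * T p)⌋₊ :=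
        congrArg Fin.val (congrFun hf p)
      have h5 : ((a₂ - a₁ : ℕ) : ℝ) * T p - z p =
          Int.fract (a₂ * T p) - Int.fract (a₁ * T p) := by
        simp only [z, Int.fract]
        push_cast [Nat.cast_sub hlt.le]
        ring
      rw [h5, le_div_iff₀ hm0, ← abs_of_pos hm0, ← abs_mul]
      have e1 := Nat.floor_le (a := (m : ℝ) * Int.fract (a₁ * T p))
        (by have := Int.fract_nonneg (a₁ * T p); positivity)
      have e2 := Nat.floor_le (a := (m : ℝ) * Int.fract (a₂ * T p))
        (by have := Int.fract_nonneg (a₂ * T p); positivity)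
      have e3 := Nat.lt_floor_add_one ((m : ℝ) * Int.fract (a₁ * T p))
      have e4 := Nat.lt_floor_add_one ((m : ℝ) * Int.fract (a₂ * T p))
      rw [h4] at e1 e3
      rw [abs_le]
      constructor <;> linarith
    have h6 : σ (((a₂ - a₁ : ℕ) : K) * x j - ∑ k, (z (j, k) : K) * ω k) =
        ∑ k, (((a₂ - a₁ : ℕ) : ℝ) * T (j, k) - z (j, k)) * σ (ω k) := by
      conv_lhs => rw [hx (x j), Finset.mul_sum, ← Finset.sum_sub_distrib, map_sum]
      refine Finset.sum_congr rfl fun k _ => ?_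
      simp only [map_sub, map_mul, map_natCast, map_intCast, map_ratCast, T]
      ring
    rw [h6]
    refine (Finset.abs_sum_le_sum_abs _ _).trans ?_
    refine le_trans (Finset.sum_le_sum (g := fun k => 1 / m * |σ (ω k)|) fun k _ => ?_) ?_
    · rw [abs_mul]
      exact mul_le_mul_of_nonneg_right (h3 _) (abs_nonneg _)
    · rw [← Finset.mul_sum]
      refine le_trans (mul_le_mul_of_nonneg_left (hS σ) (by positivity)) ?_
      rw [one_div, inv_mul_eq_div]
      exact hmS

end Reduction

section Reduction

variable {K : Type} [Field K]

section Projection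

variable {V : Type} [AddCommGroup V] [Module K V] (B : V →ₗ[K] V →ₗ[K] K) (v : V)

/-- The projection along `v` onto the orthogonal complement of `v`. -/
def orthProj : V →ₗ[K] V :=
  LinearMap.id - (B v v)⁻¹ • (B.flip v).smulRight v

theorem orthProj_apply (x : V) : orthProj B v x = x - ((B v v)⁻¹ * B x v) • v := by
  simp [orthProj, smul_smul]

variable {B v}

theorem orthProj_self (hd : B v v ≠ 0) : orthProj B v v = 0 := by
  rw [orthProj_apply, inv_mul_cancel₀ hd, one_smul, sub_self]

theorem form_orthProj_left (hd : B v v ≠ 0) (x : V) : B (orthProj B v x) v = 0 := by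
  rw [orthProj_apply, map_sub, LinearMap.sub_apply, map_smul, LinearMap.smul_apply, smul_eq_mul,
    mul_right_comm, inv_mul_cancel₀ hd, one_mul, sub_self]

theorem form_orthProj_right (hB : ∀ x y, B x y = B y x) (hd : B v v ≠ 0) (x : V) :
    B v (orthProj B v x) = 0 := by
  rw [hB, form_orthProj_left hd]

theorem form_orthProj_orthProj (hd : B v v ≠ 0) (hB : ∀ x y, B x y = B y x) (x y : V) :
    B (orthProj B v x) (orthProj B v y) = B x y - (B v v)⁻¹ * (B x v * B y v) := by
  rw [orthProj_apply B v y, map_sub, map_smul, form_orthProj_left hd, smul_zero, sub_zero,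
    orthProj_apply, map_sub, LinearMap.sub_apply, map_smul, LinearMap.smul_apply, smul_eq_mul,
    hB v y]
  ring

theorem exists_smul_of_orthProj_eq_zero {x : V} (h : orthProj B v x = 0) :
    ∃ ξ : K, x = ξ • v := by
  rw [orthProj_apply, sub_eq_zero] at h
  exact ⟨_, h⟩

theorem finrank_map_orthProj [FiniteDimensional K V] (hd : B v v ≠ 0) {W : Submodule K V}
    (hv : v ∈ W) :
    Module.finrank K (W.map (orthProj B v)) + 1 = Module.finrank K W := by
  have h := LinearMap.finrank_range_add_finrank_ker ((orthProj B v).domRestrict W)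
  rw [LinearMap.range_domRestrict] at h
  rw [← h]
  congr 1
  have hk : LinearMap.ker ((orthProj B v).domRestrict W) = K ∙ (⟨v, hv⟩ : W) := by
    ext x
    rw [LinearMap.mem_ker, LinearMap.domRestrict_apply, Submodule.mem_span_singleton]
    constructor
    · intro h
      obtain ⟨ξ, hξ⟩ := exists_smul_of_orthProj_eq_zero h
      exact ⟨ξ, Subtype.ext hξ.symm⟩
    · rintro ⟨ξ, rfl⟩
      simp [orthProj_self hd]
  rw [hk, finrank_span_singleton]
  intro h
  apply hd
  have h2 : v = 0 := congrArg Subtype.val h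
  simp [h2]

end Projection

theorem sum_le_of_abs_le_half {d ν : K} {σs : K →+* ℝ} (hd : 0 < σs d) (h : |σs ν| ≤ 1 / 2) :
    σs (ν * ν * d) ≤ 1 / 4 * σs d := by
  rw [map_mul, map_mul]
  refine mul_le_mul_of_nonneg_right ?_ hd.le
  rw [← sq, ← sq_abs]
  nlinarith [abs_nonneg (σs ν)]

variable [NumberField K]

/-- A nonzero vector of minimal trace. -/
theorem TotallyReal.exists_minimal (hK : TotallyReal K) {V : Type} [AddCommGroup V] [Module K V]
    (B : V →ₗ[K] V →ₗ[K] K) (hpos : ∀ v, v ≠ 0 → ∀ σ : K →+* ℝ, 0 < σ (B v v))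
    (L : AddSubgroup V) {m : ℕ} (hm : m ≠ 0)
    (hInt : ∀ x ∈ L, ∀ y ∈ L, IsIntegral ℤ (m * B x y)) (hne : ∃ x ∈ L, x ≠ 0) :
    ∃ v ∈ L, v ≠ 0 ∧ ∀ x ∈ L, x ≠ 0 →
      ∑ σ : K →+* ℝ, σ (B v v) ≤ ∑ σ : K →+* ℝ, σ (B x x) := by
  classical
  have hm' : (0:ℝ) < m := by positivity
  have hz : ∀ x ∈ L, x ≠ 0 → ∃ k : ℕ, (m:ℝ) * ∑ σ : K →+* ℝ, σ (B x x) = k := by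
    intro x hx h0
    obtain ⟨z, hz⟩ := hK.exists_int_trace (hInt x hx x hx)
    simp only [map_mul, map_natCast, ← Finset.mul_sum] at hz
    have h1 : (0:ℝ) ≤ z := by
      rw [← hz]
      exact mul_nonneg hm'.le (Finset.sum_nonneg fun σ _ => (hpos x h0 σ).le)
    obtain ⟨k, rfl⟩ := Int.eq_ofNat_of_zero_le (by exact_mod_cast h1 : (0:ℤ) ≤ z)
    exact ⟨k, by rw [hz]; simp⟩
  let P : ℕ → Prop := fun k => ∃ x ∈ L, x ≠ 0 ∧ (m:ℝ) * ∑ σ : K →+* ℝ, σ (B x x) = k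
  have hP : ∃ k, P k := by
    obtain ⟨x, hx, h0⟩ := hne
    obtain ⟨k, hk⟩ := hz x hx h0
    exact ⟨k, x, hx, h0, hk⟩
  obtain ⟨v, hv, hv0, hvk⟩ := Nat.find_spec hP
  refine ⟨v, hv, hv0, fun x hx h0 => ?_⟩
  obtain ⟨k, hk⟩ := hz x hx h0
  have h2 : Nat.find hP ≤ k := Nat.find_min' hP ⟨x, hx, h0, hk⟩
  refine le_of_mul_le_mul_left ?_ hm'
  rw [hvk, hk]
  exact_mod_cast h2

section Step

variable {V : Type} [AddCommGroup V] [Module K V]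
    {B : V →ₗ[K] V →ₗ[K] K} {L : AddSubgroup V} {v : V}

/-- Multiples of a minimal vector in the lattice have coefficients of bounded denominator. -/
theorem isIntegral_coeff_of_minimal (hpos : ∀ v, v ≠ 0 → ∀ σ : K →+* ℝ, 0 < σ (B v v))
    (hK : TotallyReal K)
    (hL : ∀ a : K, IsIntegral ℤ a → ∀ x ∈ L, a • x ∈ L) {M : ℕ}
    (hM : ∀ x : Fin 1 → K, ∃ (a : ℕ) (α : Fin 1 → K), 1 ≤ a ∧ a ≤ M ∧
      (∀ j, IsIntegral ℤ (α j)) ∧ ∀ j (σ : K →+* ℝ), |σ (a * x j - α j)| ≤ 1 / 2)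
    (hv : v ∈ L) (hv0 : v ≠ 0) (hmin : ∀ x ∈ L, x ≠ 0 →
      ∑ σ : K →+* ℝ, σ (B v v) ≤ ∑ σ : K →+* ℝ, σ (B x x))
    {ξ : K} (hξ : ξ • v ∈ L) : IsIntegral ℤ ((M.factorial : K) * ξ) := by
  obtain ⟨a, α, h1, h2, h3, h4⟩ := hM fun _ => ξ
  have hmem : (a * ξ - α 0) • v ∈ L := by
    rw [sub_smul, mul_smul]
    exact L.sub_mem (hL _ (isIntegral_natCast _) _ hξ) (hL _ (h3 0) _ hv)
  have h0 : (a * ξ - α 0) • v = 0 := by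
    by_contra hne
    have h5 := hmin _ hmem hne
    have h6 : ∑ σ : K →+* ℝ, σ (B ((a * ξ - α 0) • v) ((a * ξ - α 0) • v)) ≤
        ∑ σ : K →+* ℝ, 1 / 4 * σ (B v v) := by
      refine Finset.sum_le_sum fun σ _ => ?_
      simp only [LinearMap.map_smul, LinearMap.smul_apply, smul_eq_mul, ← mul_assoc]
      exact sum_le_of_abs_le_half (hpos v hv0 σ) (h4 0 σ)
    rw [← Finset.mul_sum] at h6
    have : Nonempty (K →+* ℝ) := hK.nonempty_embedding
    have h7 : 0 < ∑ σ : K →+* ℝ, σ (B v v) :=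
      Finset.sum_pos (fun σ _ => hpos v hv0 σ) Finset.univ_nonempty
    linarith
  have h5 : (a : K) * ξ = α 0 := by
    rcases smul_eq_zero.1 h0 with h | h
    · exact sub_eq_zero.1 h
    · exact absurd h hv0
  obtain ⟨k, hk⟩ := Nat.dvd_factorial h1 h2
  rw [hk, Nat.cast_mul, mul_right_comm, h5]
  exact (h3 0).mul (isIntegral_natCast _)

/-- Vectors of the projected lattice are not much shorter than the minimal vector. -/
theorem trace_minimal_le (hB : ∀ x y, B x y = B y x)
    (hpos : ∀ v, v ≠ 0 → ∀ σ : K →+* ℝ, 0 < σ (B v v)) (hd : B v v ≠ 0)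
    (hL : ∀ a : K, IsIntegral ℤ a → ∀ x ∈ L, a • x ∈ L) {M : ℕ}
    (hM : ∀ x : Fin 1 → K, ∃ (a : ℕ) (α : Fin 1 → K), 1 ≤ a ∧ a ≤ M ∧
      (∀ j, IsIntegral ℤ (α j)) ∧ ∀ j (σ : K →+* ℝ), |σ (a * x j - α j)| ≤ 1 / 2)
    (hv : v ∈ L) (hv0 : v ≠ 0) (hmin : ∀ x ∈ L, x ≠ 0 →
      ∑ σ : K →+* ℝ, σ (B v v) ≤ ∑ σ : K →+* ℝ, σ (B x x))
    {y : V} (hy : y ∈ L) (hw : orthProj B v y ≠ 0) :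
    3 / 4 * ∑ σ : K →+* ℝ, σ (B v v) ≤
      (M : ℝ) ^ 2 * ∑ σ : K →+* ℝ, σ (B (orthProj B v y) (orthProj B v y)) := by
  obtain ⟨a, α, h1, h2, h3, h4⟩ := hM fun _ => (B v v)⁻¹ * B y v
  set w := orthProj B v y with hwdef
  set ν := a * ((B v v)⁻¹ * B y v) - α 0 with hν
  have hz : (a : K) • y - α 0 • v = (a : K) • w + ν • v := by
    rw [hwdef, orthProj_apply, hν, smul_sub, smul_smul, sub_smul]
    abel
  have hmem : (a : K) • w + ν • v ∈ L := by
    rw [← hz]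
    exact L.sub_mem (hL _ (isIntegral_natCast _) _ hy) (hL _ (h3 0) _ hv)
  have hform : B ((a : K) • w + ν • v) ((a : K) • w + ν • v) =
      (a : K) ^ 2 * B w w + ν * ν * B v v := by
    simp only [map_add, map_smul, LinearMap.add_apply, LinearMap.smul_apply, smul_eq_mul]
    rw [hwdef, form_orthProj_left hd, form_orthProj_right hB hd]
    ring
  have hpos' : ∀ σ : K →+* ℝ, 0 < σ (B w w) := hpos w hw
  have ha : (1:ℝ) ≤ a := by exact_mod_cast h1
  have haM : (a:ℝ) ≤ M := by exact_mod_cast h2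
  have hne : (a : K) • w + ν • v ≠ 0 := by
    intro h
    have h5 : orthProj B v ((a : K) • w + ν • v) = 0 := by rw [h, map_zero]
    have h8 : orthProj B v w = w := by
      rw [orthProj_apply B v w, hwdef, form_orthProj_left hd, mul_zero, zero_smul, sub_zero]
    rw [map_add, map_smul, map_smul, orthProj_self hd, h8, smul_zero, add_zero] at h5
    rcases smul_eq_zero.1 h5 with h7 | h7
    · rw [Nat.cast_eq_zero] at h7; omega
    · exact hw h7
  have h5 := hmin _ hmem hne
  have h6 : ∑ σ : K →+* ℝ, σ (B ((a : K) • w + ν • v) ((a : K) • w + ν • v)) ≤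
      ∑ σ : K →+* ℝ, ((M:ℝ) ^ 2 * σ (B w w) + 1 / 4 * σ (B v v)) := by
    refine Finset.sum_le_sum fun σ _ => ?_
    rw [hform, map_add]
    refine add_le_add ?_ (sum_le_of_abs_le_half (hpos v hv0 σ) (h4 0 σ))
    rw [map_mul, map_pow, map_natCast]
    exact mul_le_mul_of_nonneg_right (pow_le_pow_left₀ (by linarith) haM 2) (hpos' σ).le
  rw [Finset.sum_add_distrib, ← Finset.mul_sum, ← Finset.mul_sum] at h6
  linarith

end Step
end Reduction

section Reduction

variable {K : Type} [Field K]

/-- A nearly orthogonal balanced family in `L` which spans `L` up to the index `N`. -/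
structure IsReducedFamily {V : Type} [AddCommGroup V] [Module K V] (B : V →ₗ[K] V →ₗ[K] K)
    (L : AddSubgroup V) (C ε : ℝ) (N : ℕ) {n : ℕ} (v : Fin n → V) : Prop where
  mem : ∀ i, v i ∈ L
  span : ∀ x ∈ L, ∃ c : Fin n → K, (∀ i, IsIntegral ℤ (c i)) ∧ (N : K) • x = ∑ i, c i • v i
  balanced : ∀ i (σ τ : K →+* ℝ), σ (B (v i) (v i)) ≤ C * τ (B (v i) (v i))
  offDiag : ∀ i j, i ≠ j → ∀ σ τ : K →+* ℝ, |σ (B (v i) (v j))| ≤ ε * τ (B (v i) (v i))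

theorem IsReducedFamily.linearIndependent [CharZero K] {V : Type} [AddCommGroup V] [Module K V]
    {B : V →ₗ[K] V →ₗ[K] K} {L : AddSubgroup V} {C ε : ℝ} {N : ℕ} (hN : N ≠ 0) {n : ℕ}
    {v : Fin n → V} (h : IsReducedFamily B L C ε N v)
    (hn : Module.finrank K (Submodule.span K (L : Set V)) = n) : LinearIndependent K v := by
  rw [linearIndependent_iff_card_eq_finrank_span, Fintype.card_fin, Set.finrank]
  refine hn.symm.trans (congrArg (fun W : Submodule K V => Module.finrank K W) ?_)
  apply le_antisymm
  · rw [Submodule.span_le]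
    intro x hx
    obtain ⟨c, -, hc⟩ := h.span x hx
    have hN' : (N : K) ≠ 0 := Nat.cast_ne_zero.2 hN
    have : x = (N : K)⁻¹ • ∑ i, c i • v i := by rw [← hc, smul_smul, inv_mul_cancel₀ hN', one_smul]
    rw [this]
    exact Submodule.smul_mem _ _ (Submodule.sum_mem _ fun i _ => Submodule.smul_mem _ _
      (Submodule.subset_span ⟨i, rfl⟩))
  · rw [Submodule.span_le]
    rintro _ ⟨i, rfl⟩
    exact Submodule.subset_span (h.mem i)

variable [NumberField K]

theorem isIntegral_projected_form {V : Type} [AddCommGroup V] [Module K V]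
    {B : V →ₗ[K] V →ₗ[K] K} (hB : ∀ x y, B x y = B y x)
    {L : AddSubgroup V} {m : ℕ} (hm : m ≠ 0)
    (hInt : ∀ x ∈ L, ∀ y ∈ L, IsIntegral ℤ (m * B x y)) {v : V} (hv : v ∈ L) (hd : B v v ≠ 0) :
    ∃ m' : ℕ, m' ≠ 0 ∧ ∀ x ∈ L.map (orthProj B v).toAddMonoidHom,
      ∀ y ∈ L.map (orthProj B v).toAddMonoidHom, IsIntegral ℤ (m' * B x y) := by
  have hm' : (m : K) ≠ 0 := Nat.cast_ne_zero.2 hm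
  obtain ⟨n, z, hn, hz, hnz⟩ := exists_isIntegral_mul_eq_natCast (hInt v hv v hv)
    (mul_ne_zero hm' hd)
  refine ⟨m * n, mul_ne_zero hm hn, ?_⟩
  rintro _ ⟨x, hx, rfl⟩ _ ⟨y, hy, rfl⟩
  have h : ((m * n : ℕ) : K) * B (orthProj B v x) (orthProj B v y) =
      n * (m * B x y) - z * ((m * B x v) * (m * B y v)) := by
    rw [form_orthProj_orthProj hd hB]
    push_cast
    rw [← hnz]
    field_simp
  exact h ▸ ((isIntegral_natCast n).mul (hInt x hx y hy)).sub
    (hz.mul ((hInt x hx v hv).mul (hInt y hy v hv)))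

theorem isReducedFamily_step {V : Type} [AddCommGroup V] [Module K V]
    {B : V →ₗ[K] V →ₗ[K] K} (hB : ∀ x y, B x y = B y x) {v : V} {n a : ℕ} (ha : 1 ≤ a)
    {w : Fin n → V} (hw : ∀ j, B (w j) v = 0) {ν : Fin n → K} {C₁ C' ε δ κ : ℝ}
    (hC' : 1 ≤ C')
    (hε : 0 < ε) (hδ : 0 < δ) (hδ1 : δ ≤ 1) (hκ : 0 < κ) (hδκ : δ ≤ κ) (hδε : δ ≤ κ * (ε / 2))
    (hδC : C₁ * δ ≤ ε)
    (hd : ∀ σ : K →+* ℝ, 0 < σ (B v v))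
    (hdbal : ∀ σ τ : K →+* ℝ, σ (B v v) ≤ C₁ * τ (B v v))
    (hwbal : ∀ j, ∀ σ τ : K →+* ℝ, σ (B (w j) (w j)) ≤ C' * τ (B (w j) (w j)))
    (hwoff : ∀ i j, i ≠ j → ∀ σ τ : K →+* ℝ, |σ (B (w i) (w j))| ≤ ε / 2 * τ (B (w i) (w i)))
    (hκw : ∀ j, ∀ σ τ : K →+* ℝ, κ * σ (B v v) ≤ τ (B (w j) (w j)))
    (hν : ∀ j, ∀ σ : K →+* ℝ, |σ (ν j)| ≤ δ) (u : Fin (n + 1) → V)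
    (hu : u = Fin.cons v fun j => (a : K) • w j + ν j • v) :
    (∀ i (σ τ : K →+* ℝ), σ (B (u i) (u i)) ≤ max C₁ (C' + 1) * τ (B (u i) (u i))) ∧
    ∀ i j, i ≠ j → ∀ σ τ : K →+* ℝ, |σ (B (u i) (u j))| ≤ ε * τ (B (u i) (u i)) := by
  have ha' : (1:ℝ) ≤ a := by exact_mod_cast ha
  have ha2 : (1:ℝ) ≤ a ^ 2 := one_le_pow₀ ha'
  have hw' : ∀ j, B v (w j) = 0 := fun j => by rw [hB, hw]
  have e0 : u 0 = v := by rw [hu, Fin.cons_zero]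
  have es : ∀ j : Fin n, u j.succ = (a : K) • w j + ν j • v := fun j => by rw [hu, Fin.cons_succ]
  have f1 : ∀ i j : Fin n, B (u i.succ) (u j.succ) =
      (a : K) ^ 2 * B (w i) (w j) + ν i * ν j * B v v := by
    intro i j
    simp only [es, map_add, LinearMap.map_smul, LinearMap.add_apply, LinearMap.smul_apply,
      smul_eq_mul, hw, hw']
    ring
  have f2 : ∀ j : Fin n, B (u 0) (u j.succ) = ν j * B v v := by
    intro j
    simp only [es, e0, map_add, LinearMap.map_smul, smul_eq_mul, hw', mul_zero, zero_add]
  have f3 : ∀ j : Fin n, B (u j.succ) (u 0) = ν j * B v v := fun j => by rw [hB, f2]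
  have hww : ∀ j, ∀ τ : K →+* ℝ, 0 < τ (B (w j) (w j)) := fun j τ =>
    (mul_pos hκ (hd τ)).trans_le (hκw j τ τ)
  have hνν : ∀ i j, ∀ σ : K →+* ℝ, |σ (ν i * ν j * B v v)| ≤ δ * δ * σ (B v v) := by
    intro i j σ
    rw [map_mul, map_mul, abs_mul, abs_mul, abs_of_pos (hd σ)]
    exact mul_le_mul_of_nonneg_right
      (mul_le_mul (hν i σ) (hν j σ) (abs_nonneg _) hδ.le) (hd σ).le
  have hdd : δ * δ ≤ δ := mul_le_of_le_one_right hδ.le hδ1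
  have hs1 : ∀ i j k, ∀ σ τ : K →+* ℝ, |σ (ν i * ν j * B v v)| ≤ τ (B (w k) (w k)) := by
    intro i j k σ τ
    refine (hνν i j σ).trans (le_trans ?_ (hκw k σ τ))
    exact mul_le_mul_of_nonneg_right (hdd.trans hδκ) (hd σ).le
  have hs2 : ∀ i j k, ∀ σ τ : K →+* ℝ,
      |σ (ν i * ν j * B v v)| ≤ ε / 2 * τ (B (w k) (w k)) := by
    intro i j k σ τ
    refine (hνν i j σ).trans (le_trans ?_
      (mul_le_mul_of_nonneg_left (hκw k σ τ) (by positivity)))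
    rw [← mul_assoc]
    refine mul_le_mul_of_nonneg_right (hdd.trans (hδε.trans_eq (mul_comm _ _))) (hd σ).le
  have hlow : ∀ j, ∀ τ : K →+* ℝ, (a:ℝ) ^ 2 * τ (B (w j) (w j)) ≤ τ (B (u j.succ) (u j.succ)) := by
    intro j τ
    rw [f1, map_add, map_mul, map_pow, map_natCast, map_mul, map_mul]
    have := mul_nonneg (mul_self_nonneg (τ (ν j))) (hd τ).le
    linarith
  constructor
  · intro i σ τ
    refine Fin.cases ?_ (fun j => ?_) i
    · rw [e0]
      exact (hdbal σ τ).trans (mul_le_mul_of_nonneg_right (le_max_left _ _) (hd τ).le)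
    · have h1 := hlow j τ
      have h2 : σ (B (u j.succ) (u j.succ)) ≤ (C' + 1) * ((a:ℝ) ^ 2 * τ (B (w j) (w j))) := by
        rw [f1, map_add, map_mul, map_pow, map_natCast]
        have h3 := (abs_le.1 (hs1 j j j σ τ)).2
        have h4 := mul_le_mul_of_nonneg_left (hwbal j σ τ) (by positivity : (0:ℝ) ≤ (a:ℝ) ^ 2)
        have h5 := mul_le_mul_of_nonneg_right ha2 (hww j τ).le
        linarith
      refine h2.trans (mul_le_mul (le_max_right _ _) h1 ?_ ?_)
      · have := hww j τ
        positivity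
      · exact (by linarith : (0:ℝ) ≤ C' + 1).trans (le_max_right _ _)
  · intro i j hij σ τ
    revert hij
    refine Fin.cases ?_ (fun i => ?_) i <;> refine Fin.cases ?_ (fun j => ?_) j
    · intro h; exact absurd rfl h
    · intro _
      rw [f2, e0, map_mul, abs_mul, abs_of_pos (hd σ)]
      refine (mul_le_mul (hν j σ) (hdbal σ τ) (hd σ).le hδ.le).trans ?_
      rw [← mul_assoc, mul_comm δ]
      exact mul_le_mul_of_nonneg_right hδC (hd τ).le
    · intro _
      rw [f3, map_mul, abs_mul, abs_of_pos (hd σ)]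
      refine (mul_le_mul_of_nonneg_right (hν i σ) (hd σ).le).trans ?_
      have h1 := mul_le_mul_of_nonneg_right hδε (hd σ).le
      have h2 := mul_le_mul_of_nonneg_left (hκw i σ τ) (by positivity : 0 ≤ ε / 2)
      have h3 := hlow i τ
      have h4 := mul_le_mul_of_nonneg_right ha2 (hww i τ).le
      have h5 := hww i τ
      nlinarith
    · intro hij
      have hij' : i ≠ j := fun h => hij (by rw [h])
      rw [f1, map_add]
      refine (abs_add_le _ _).trans ?_
      rw [map_mul, map_pow, map_natCast, abs_mul, abs_of_pos (by positivity : (0:ℝ) < (a:ℝ) ^ 2)]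
      have h1 := mul_le_mul_of_nonneg_left (hwoff i j hij' σ τ) (by positivity : (0:ℝ) ≤ (a:ℝ) ^ 2)
      have h2 := hs2 i j i σ τ
      have h3 := mul_le_mul_of_nonneg_left (hlow i τ) hε.le
      have h4 := mul_le_mul_of_nonneg_left (mul_le_mul_of_nonneg_right ha2 (hww i τ).le)
        (by positivity : 0 ≤ ε / 2)
      linarith

theorem TotallyReal.exists_isReducedFamily (hK : TotallyReal K) (n : ℕ) :
    ∃ C : ℝ, 1 ≤ C ∧ ∀ ε : ℝ, 0 < ε → ∃ N : ℕ, N ≠ 0 ∧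
      ∀ (V : Type) [AddCommGroup V] [Module K V] [FiniteDimensional K V]
        (B : V →ₗ[K] V →ₗ[K] K), (∀ x y, B x y = B y x) →
        (∀ v, v ≠ 0 → ∀ σ : K →+* ℝ, 0 < σ (B v v)) →
        ∀ (L : AddSubgroup V), (∀ a : K, IsIntegral ℤ a → ∀ x ∈ L, a • x ∈ L) →
        ∀ m : ℕ, m ≠ 0 → (∀ x ∈ L, ∀ y ∈ L, IsIntegral ℤ (m * B x y)) →
        Module.finrank K (Submodule.span K (L : Set V)) = n →
        ∃ v : Fin n → V, IsReducedFamily B L C ε N v := by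
  induction n with
  | zero =>
    refine ⟨1, le_rfl, fun ε _ => ⟨1, one_ne_zero, ?_⟩⟩
    intro V _ _ _ B hB hpos L hL m hm hInt hn
    refine ⟨Fin.elim0, fun i => i.elim0, fun x hx => ⟨Fin.elim0, fun i => i.elim0, ?_⟩,
      fun i => i.elim0, fun i => i.elim0⟩
    have h0 : x ∈ Submodule.span K (L : Set V) := Submodule.subset_span hx
    rw [Submodule.finrank_eq_zero.1 hn, Submodule.mem_bot] at h0
    simp [h0]
  | succ n ih =>
    obtain ⟨C', hC', ih⟩ := ih
    obtain ⟨C₁, hC₁, hbal⟩ := exists_balanced_const (K := K)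
    obtain ⟨M₀, hM₀⟩ := hK.exists_approx 1 (by norm_num : (0:ℝ) < 1 / 2)
    have : Nonempty (K →+* ℝ) := hK.nonempty_embedding
    have hM₀1 : 1 ≤ M₀ := by
      obtain ⟨a, -, h1, h2, -⟩ := hM₀ fun _ => 0
      exact h1.trans h2
    obtain ⟨D, hD, hDc⟩ : ∃ D : ℝ, 1 ≤ D ∧ D = Fintype.card (K →+* ℝ) :=
      ⟨_, by exact_mod_cast Fintype.card_pos (α := K →+* ℝ), rfl⟩
    have hM₀' : (1:ℝ) ≤ M₀ := by exact_mod_cast hM₀1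
    obtain ⟨κ, hκ0, hκ⟩ : ∃ κ : ℝ, 0 < κ ∧ κ * (M₀ ^ 2 * (D * C')) = 3 / 4 :=
      ⟨3 / 4 / (M₀ ^ 2 * (D * C')), by positivity, by field_simp⟩
    refine ⟨max C₁ (C' + 1), hC₁.trans (le_max_left _ _), fun ε hε => ?_⟩
    obtain ⟨δ, hδ0, hδ1, hδκ, hδε, hδC⟩ : ∃ δ : ℝ, 0 < δ ∧ δ ≤ 1 ∧ δ ≤ κ ∧ δ ≤ κ * (ε / 2) ∧
        C₁ * δ ≤ ε := by
      refine ⟨min 1 (min κ (min (κ * (ε / 2)) (ε / C₁))), ?_, min_le_left _ _, ?_, ?_, ?_⟩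
      · have : 0 < ε / C₁ := by positivity
        have : 0 < κ * (ε / 2) := by positivity
        simp [*]
      · exact (min_le_right _ _).trans (min_le_left _ _)
      · exact (min_le_right _ _).trans ((min_le_right _ _).trans (min_le_left _ _))
      · rw [mul_comm, ← le_div_iff₀ (by linarith)]
        exact (min_le_right _ _).trans ((min_le_right _ _).trans (min_le_right _ _))
    obtain ⟨N', hN', ih⟩ := ih (ε / 2) (by positivity)
    obtain ⟨M, hM⟩ := hK.exists_approx n hδ0
    refine ⟨N' * M.factorial * M₀.factorial, by positivity, ?_⟩
    intro V _ _ _ B hB hpos L hL m hm hInt hn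
    have hne : ∃ x ∈ L, x ≠ 0 := by
      by_contra! h
      have : Submodule.span K (L : Set V) = ⊥ := by
        rw [Submodule.span_eq_bot]; exact h
      rw [this, finrank_bot] at hn
      omega
    obtain ⟨v, hv, hv0, hmin⟩ := hK.exists_minimal B hpos L hm hInt hne
    have hdpos := hpos v hv0
    have hd : B v v ≠ 0 := by
      intro h
      obtain ⟨σ⟩ := this
      have := hdpos σ
      simp [h] at this
    have hdbal : ∀ σ τ : K →+* ℝ, σ (B v v) ≤ C₁ * τ (B v v) := by
      refine hbal _ hdpos fun a b ha hb hab => ?_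
      have h1 := hmin (a • v) (hL a ha v hv) (smul_ne_zero (left_ne_zero_of_mul_eq_one hab) hv0)
      refine h1.trans_eq (Finset.sum_congr rfl fun σ _ => ?_)
      simp only [LinearMap.map_smul, LinearMap.smul_apply, smul_eq_mul]
      ring_nf
    obtain ⟨m', hm', hInt'⟩ := isIntegral_projected_form hB hm hInt hv hd
    have hspan : Submodule.span K ((L.map (orthProj B v).toAddMonoidHom : AddSubgroup V) : Set V) =
        (Submodule.span K (L : Set V)).map (orthProj B v) := by
      rw [Submodule.map_span]; rfl
    obtain ⟨w, hw⟩ := ih V B hB hpos (L.map (orthProj B v).toAddMonoidHom) (by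
        rintro a ha _ ⟨x, hx, rfl⟩
        exact ⟨a • x, hL a ha x hx, (orthProj B v).map_smul a x⟩) m' hm' hInt' (by
        rw [hspan]
        have := finrank_map_orthProj hd (W := Submodule.span K (L : Set V))
          (Submodule.subset_span hv)
        omega)
    have hli := hw.linearIndependent hN' (by
        rw [hspan]
        have := finrank_map_orthProj hd (W := Submodule.span K (L : Set V))
          (Submodule.subset_span hv)
        omega)
    choose y hy hyw using hw.mem
    have hyw' : ∀ j, orthProj B v (y j) = w j := hyw
    have hκw : ∀ j, ∀ σ τ : K →+* ℝ, κ * σ (B v v) ≤ τ (B (w j) (w j)) := by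
      intro j σ τ
      have h1 := trace_minimal_le hB hpos hd hL hM₀ hv hv0 hmin (hy j)
        (by rw [hyw']; exact hli.ne_zero j)
      rw [hyw'] at h1
      have h2 : ∑ σ : K →+* ℝ, σ (B (w j) (w j)) ≤ D * (C' * τ (B (w j) (w j))) := by
        refine (Finset.sum_le_card_nsmul _ _ _ fun σ _ => hw.balanced j σ τ).trans_eq ?_
        rw [Finset.card_univ, nsmul_eq_mul, hDc]
      have h3 : σ (B v v) ≤ ∑ σ : K →+* ℝ, σ (B v v) :=
        Finset.single_le_sum (f := fun σ : K →+* ℝ => σ (B v v))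
          (fun σ _ => (hdpos σ).le) (Finset.mem_univ σ)
      have h4 := mul_le_mul_of_nonneg_left h2 (by positivity : (0:ℝ) ≤ (M₀:ℝ) ^ 2)
      have h5 : (M₀ ^ 2 * (D * C')) * (κ * σ (B v v)) ≤
          (M₀ ^ 2 * (D * C')) * τ (B (w j) (w j)) := by
        calc (M₀ ^ 2 * (D * C')) * (κ * σ (B v v)) = 3 / 4 * σ (B v v) := by rw [← hκ]; ring
          _ ≤ _ := by linarith
      exact le_of_mul_le_mul_left h5 (by positivity)
    obtain ⟨a, α, ha1, haM, hα, hν⟩ := hM fun j => (B v v)⁻¹ * B (y j) v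
    have hyj : ∀ j, (a : K) • y j - α j • v =
        (a : K) • w j + (a * ((B v v)⁻¹ * B (y j) v) - α j) • v := by
      intro j
      rw [← hyw', orthProj_apply, smul_sub, smul_smul, sub_smul]
      abel
    have hmem : ∀ j, (a : K) • y j - α j • v ∈ L := fun j =>
      L.sub_mem (hL _ (isIntegral_natCast _) _ (hy j)) (hL _ (hα j) _ hv)
    have hform := isReducedFamily_step hB ha1 (w := w) (fun j => by
        rw [← hyw', form_orthProj_left hd]) hC' hε hδ0 hδ1 hκ0 hδκ hδε hδC hdpos hdbal
      hw.balanced hw.offDiag hκw hν _ rfl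
    refine ⟨_, ?_, ?_, hform.1, hform.2⟩
    · refine Fin.cases ?_ fun j => ?_
      · simpa using hv
      · rw [Fin.cons_succ, ← hyj]
        exact hmem j
    · intro x hx
      obtain ⟨c, hc, hcx⟩ := hw.span _ ⟨x, hx, rfl⟩
      have hker : orthProj B v ((N' : K) • x - ∑ j, c j • y j) = 0 := by
        rw [map_sub, map_smul, map_sum, sub_eq_zero]
        simp only [map_smul, hyw']
        exact hcx
      obtain ⟨ξ, hξ⟩ := exists_smul_of_orthProj_eq_zero hker
      have hξL : ξ • v ∈ L := by
        rw [← hξ]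
        exact L.sub_mem (hL _ (isIntegral_natCast _) _ hx)
          (L.sum_mem fun j _ => hL _ (hc j) _ (hy j))
      have hξi := isIntegral_coeff_of_minimal hpos hK hL hM₀ hv hv0 hmin hξL
      obtain ⟨k, hk⟩ := Nat.dvd_factorial ha1 haM
      refine ⟨Fin.cons (M.factorial * (M₀.factorial * ξ) + k * M₀.factorial * ∑ j, c j * α j)
        fun j => k * M₀.factorial * c j, ?_, ?_⟩
      · refine Fin.cases ?_ fun j => ?_
        · rw [Fin.cons_zero]
          exact ((isIntegral_natCast _).mul hξi).add (((isIntegral_natCast _).mul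
            (isIntegral_natCast _)).mul (IsIntegral.sum _ fun j _ => (hc j).mul (hα j)))
        · rw [Fin.cons_succ]
          exact ((isIntegral_natCast _).mul (isIntegral_natCast _)).mul (hc j)
      · rw [Fin.sum_univ_succ]
        simp only [Fin.cons_zero, Fin.cons_succ, ← hyj]
        have h1 : (N' : K) • x = ξ • v + ∑ j, c j • y j := by rw [← hξ, sub_add_cancel]
        have h2 : ((N' * M.factorial * M₀.factorial : ℕ) : K) • x =
            ((M.factorial : K) * M₀.factorial) • ((N' : K) • x) := by
          rw [smul_smul]; push_cast; ring_nf
        rw [h2, h1, hk]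
        simp only [smul_sub, smul_add, smul_smul, Finset.sum_sub_distrib, Finset.smul_sum, add_smul,
          Finset.mul_sum, Finset.sum_smul, Nat.cast_mul]
        have h3 : ∀ j, (k * M₀.factorial * c j * a : K) = (a * k * M₀.factorial * c j : K) :=
          fun j => by ring
        have h4 : ∀ j, (k * M₀.factorial * (c j * α j) : K) = (k * M₀.factorial * c j * α j : K) :=
          fun j => by ring
        have h5 : (a * k * M₀.factorial * ξ : K) = a * k * (M₀.factorial * ξ) := by ring
        simp only [h3, h4, h5]
        abel

end Reduction

section Cone

variable {K : Type} [Field K]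

/-- Totally positive integers all of whose conjugates are at most `S`. -/
def boundedPos (K : Type) [Field K] (S : ℝ) : Set K :=
  {g | IsIntegral ℤ g ∧ ∀ σ : K →+* ℝ, 0 < σ g ∧ σ g ≤ S}

theorem boundedPos_mono {S T : ℝ} (h : S ≤ T) : boundedPos K S ⊆ boundedPos K T :=
  fun _ hg => ⟨hg.1, fun σ => ⟨(hg.2 σ).1, (hg.2 σ).2.trans h⟩⟩

theorem rat_mul_mem_span [CharZero K] {W : Type} {A : Set (W → K)} {q : ℚ} (hq : 0 ≤ q)
    {f : W → K} (hf : f ∈ Submodule.span ℚ≥0 A) :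
    (fun c => (q : K) * f c) ∈ Submodule.span ℚ≥0 A := by
  lift q to ℚ≥0 using hq
  have : (fun c => ((q : ℚ) : K) * f c) = q • f := by
    ext c
    rw [Pi.smul_apply, NNRat.smul_def, Rat.cast_nnratCast]
  rw [this]
  exact Submodule.smul_mem _ _ hf

theorem rat_mul_mem_span' [CharZero K] {A : Set K} {q : ℚ} (hq : 0 ≤ q)
    {x : K} (hf : x ∈ Submodule.span ℚ≥0 A) : (q : K) * x ∈ Submodule.span ℚ≥0 A := by
  lift q to ℚ≥0 using hq
  have : ((q : ℚ) : K) * x = q • x := by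
    rw [NNRat.smul_def, Rat.cast_nnratCast]
  rw [this]
  exact Submodule.smul_mem _ _ hf

variable [NumberField K]

theorem TotallyReal.finite_boundedPos (hK : TotallyReal K) (S : ℝ) : (boundedPos K S).Finite :=
  (hK.finite_bounded S).subset fun _ hg =>
    ⟨hg.1, fun σ => (abs_of_pos (hg.2 σ).1).trans_le (hg.2 σ).2⟩

theorem exists_nat_bound {d : ℕ} (ω : Fin d → K) :
    ∃ S : ℕ, 0 < S ∧ ∀ k, ∀ σ : K →+* ℝ, |σ (ω k)| < S := by
  obtain ⟨S, hS⟩ := exists_nat_gt (∑ k, ∑ σ : K →+* ℝ, |σ (ω k)|)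
  refine ⟨S + 1, S.succ_pos, fun k σ => ?_⟩
  have h1 := Finset.single_le_sum (f := fun σ : K →+* ℝ => |σ (ω k)|)
    (fun _ _ => abs_nonneg _) (Finset.mem_univ σ)
  have h2 := Finset.single_le_sum (f := fun k => ∑ σ : K →+* ℝ, |σ (ω k)|)
    (fun _ _ => Finset.sum_nonneg fun _ _ => abs_nonneg _) (Finset.mem_univ k)
  push_cast
  linarith

/-- Balanced elements lie in the rational cone of finitely many totally positive integers. -/
theorem TotallyReal.exists_balanced_mem_span (hK : TotallyReal K) {C : ℝ} (hC : 1 ≤ C) :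
    ∃ S : ℝ, ∀ x : K, (∀ σ : K →+* ℝ, 0 < σ x) → (∀ σ τ : K →+* ℝ, σ x ≤ C * τ x) →
      x ∈ Submodule.span ℚ≥0 (boundedPos K S) := by
  obtain ⟨d, ω, t, c, hc, hω, hx, -, -⟩ := hK.exists_integral_coordinates
  obtain ⟨s, hs0, hs⟩ := exists_nat_bound ω
  obtain ⟨σ₀⟩ := hK.nonempty_embedding
  have hs1 : (1:ℝ) ≤ s := by exact_mod_cast hs0
  set A : ℝ := C * (2 * (d * s) + 1) with hA
  have hds : (0:ℝ) ≤ d * s := by positivity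
  have hA0 : 0 < A := by positivity
  refine ⟨C * (2 * A) + 2 * s + d * s, fun x hpos hbal => ?_⟩
  obtain ⟨T, hT1, hT2⟩ : ∃ T : ℚ, A ≤ T * σ₀ x ∧ T * σ₀ x ≤ 2 * A := by
    obtain ⟨T, h1, h2⟩ := exists_rat_btwn (show A / σ₀ x < 2 * A / σ₀ x from
      div_lt_div_of_pos_right (by linarith) (hpos σ₀))
    rw [div_lt_iff₀ (hpos σ₀)] at h1
    rw [lt_div_iff₀ (hpos σ₀)] at h2
    exact ⟨T, h1.le, h2.le⟩
  have hT0 : 0 < T := by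
    have : (0:ℝ) < T := (pos_iff_pos_of_mul_pos (hA0.trans_le hT1)).2 (hpos σ₀)
    exact_mod_cast this
  have hT0' : (0:ℝ) < T := by exact_mod_cast hT0
  have hlow : ∀ σ : K →+* ℝ, 2 * (d * s) + 1 ≤ T * σ x := by
    intro σ
    refine le_of_mul_le_mul_left ?_ (by linarith : 0 < C)
    have := mul_le_mul_of_nonneg_left (hbal σ₀ σ) hT0'.le
    linarith
  have hup : ∀ σ : K →+* ℝ, T * σ x ≤ C * (2 * A) := by
    intro σ
    have := mul_le_mul_of_nonneg_left (hbal σ σ₀) hT0'.le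
    have := mul_le_mul_of_nonneg_left hT2 (by linarith : 0 ≤ C)
    linarith
  set y : Fin d → ℚ := fun k => T * t k x with hy
  set f : Fin d → ℚ := fun k => Int.fract (y k) with hf
  set z : K := ∑ k, (⌊y k⌋ : K) * ω k - d * s with hz
  have hfσ : ∀ σ : K →+* ℝ, |∑ k, (f k : ℝ) * σ (ω k)| ≤ d * s := by
    intro σ
    refine (Finset.abs_sum_le_sum_abs _ _).trans ?_
    refine (Finset.sum_le_card_nsmul _ _ (s:ℝ) fun k _ => ?_).trans_eq
      (by rw [Finset.card_univ, Fintype.card_fin, nsmul_eq_mul])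
    rw [abs_mul]
    have h1 : |(f k : ℝ)| ≤ 1 := by
      have h1 : 0 ≤ f k := Int.fract_nonneg _
      have h2 : f k ≤ 1 := (Int.fract_lt_one _).le
      rw [abs_of_nonneg (by exact_mod_cast h1)]
      exact_mod_cast h2
    calc |(f k : ℝ)| * |σ (ω k)| ≤ 1 * s :=
          mul_le_mul h1 (hs k σ).le (abs_nonneg _) zero_le_one
      _ = s := one_mul _
  have hTx : (T : K) * x = ∑ k, (⌊y k⌋ : K) * ω k + ∑ k, (f k : K) * ω k := by
    conv_lhs => rw [hx x]
    rw [Finset.mul_sum, ← Finset.sum_add_distrib]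
    refine Finset.sum_congr rfl fun k _ => ?_
    rw [← add_mul, ← mul_assoc]
    congr 1
    have : ((⌊y k⌋ : ℚ) + Int.fract (y k)) = y k := Int.floor_add_fract _
    rw [hf]
    have h2 := congrArg (fun q : ℚ => (q : K)) this
    push_cast at h2 ⊢
    rw [h2, hy]
    push_cast
    rfl
  have hzσ : ∀ σ : K →+* ℝ, σ z = T * σ x - ∑ k, (f k : ℝ) * σ (ω k) - d * s := by
    intro σ
    have h1 := congrArg σ hTx
    simp only [map_mul, map_add, map_sum, map_ratCast, map_intCast] at h1
    rw [hz]
    simp only [map_mul, map_sub, map_sum, map_intCast, map_natCast]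
    linarith
  have hmem : ∀ w : K, w ∈ boundedPos K (C * (2 * A) + 2 * s + d * s) →
      w ∈ Submodule.span ℚ≥0 (boundedPos K (C * (2 * A) + 2 * s + d * s)) :=
    fun w hw => Submodule.subset_span hw
  have hCA : 0 ≤ C * (2 * A) := by positivity
  have hzm := hmem z ⟨(IsIntegral.sum _ fun k _ => (isIntegral_intCast _).mul (hω k)).sub
    ((isIntegral_natCast _).mul (isIntegral_natCast _)), fun σ => by
      have h1 := hzσ σ
      have h2 := abs_le.1 (hfσ σ)
      have h3 := hlow σ
      have h4 := hup σ
      constructor <;> linarith⟩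
  have hωm : ∀ k, ω k + s ∈ _ := fun k => hmem (ω k + s)
    ⟨(hω k).add (isIntegral_natCast _), fun σ => by
      have h1 := abs_lt.1 (hs k σ)
      rw [map_add, map_natCast]
      constructor <;> linarith⟩
  have hsm := hmem (s : K) ⟨isIntegral_natCast _, fun σ => by
      rw [map_natCast]
      constructor <;> linarith⟩
  have key : x = ((T⁻¹ : ℚ) : K) *
      (z + ∑ k, ((f k : K) * (ω k + s) + ((1 - f k : ℚ) : K) * s)) := by
    have h1 : z + ∑ k, ((f k : K) * (ω k + s) + ((1 - f k : ℚ) : K) * s) = T * x := by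
      rw [hTx, hz]
      have : ∀ k, (f k : K) * (ω k + s) + ((1 - f k : ℚ) : K) * s = (f k : K) * ω k + s := by
        intro k; push_cast; ring
      simp only [this, Finset.sum_add_distrib, Finset.sum_const, Finset.card_univ,
        Fintype.card_fin, nsmul_eq_mul]
      ring
    rw [h1]
    have : (T : K) ≠ 0 := by exact_mod_cast hT0.ne'
    push_cast
    field_simp
  rw [key]
  refine rat_mul_mem_span' (inv_nonneg.2 hT0.le) (Submodule.add_mem _ hzm
    (Submodule.sum_mem _ fun k _ => Submodule.add_mem _ (rat_mul_mem_span' ?_ (hωm k))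
      (rat_mul_mem_span' ?_ hsm)))
  · exact Int.fract_nonneg _
  · exact sub_nonneg.2 (Int.fract_lt_one _).le

/-- Completing a cross term to a nonnegative combination of squares. -/
theorem TotallyReal.exists_cross_mem_span (hK : TotallyReal K) :
    ∃ S c : ℝ, 0 < c ∧ ∀ e : K, ∃ r : K, (∀ σ : K →+* ℝ, 0 ≤ σ r) ∧
      (∀ s, (∀ σ : K →+* ℝ, |σ e| ≤ s) → ∀ σ : K →+* ℝ, σ r ≤ c * s) ∧
      ∀ (W : Type) (X Y : W → K) (A : Set (W → K)),
        (∀ g ∈ boundedPos K S, (fun w => g * (X w + Y w) ^ 2) ∈ A) →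
        (∀ g ∈ boundedPos K S, (fun w => g * (X w - Y w) ^ 2) ∈ A) →
        (fun w => 2 * e * X w * Y w + r * (X w ^ 2 + Y w ^ 2)) ∈ Submodule.span ℚ≥0 A := by
  obtain ⟨d, ω, t, c, hc, hω, hx, -, ht⟩ := hK.exists_integral_coordinates
  obtain ⟨s, hs0, hs⟩ := exists_nat_bound ω
  have hs1 : (1:ℝ) ≤ s := by exact_mod_cast hs0
  have hωm : ∀ k, ω k + s ∈ boundedPos K (2 * s) := fun k =>
    ⟨(hω k).add (isIntegral_natCast _), fun σ => by
      have h1 := abs_lt.1 (hs k σ)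
      rw [map_add, map_natCast]
      constructor <;> linarith⟩
  have hsm : (s : K) ∈ boundedPos K (2 * s) := ⟨isIntegral_natCast _, fun σ => by
      rw [map_natCast]
      constructor <;> linarith⟩
  refine ⟨2 * s, 1 + d * (c * (3 * s)), by positivity, fun e =>
    ⟨∑ k, ((|t k e| : ℚ) : K) * ((ω k + s) + s), ?_, ?_, ?_⟩⟩
  · intro σ
    rw [map_sum]
    refine Finset.sum_nonneg fun k _ => ?_
    rw [map_mul, map_ratCast, map_add]
    have h1 := (hωm k).2 σ
    have h2 := hsm.2 σ
    have h3 : (0:ℝ) ≤ ((|t k e| : ℚ) : ℝ) := by exact_mod_cast abs_nonneg _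
    exact mul_nonneg h3 (by linarith)
  · intro S hS σ
    have hS0 : 0 ≤ S := (abs_nonneg _).trans (hS σ)
    rw [map_sum]
    have : ∑ k, σ (((|t k e| : ℚ) : K) * ((ω k + s) + s)) ≤ ∑ _k : Fin d, c * S * (3 * s) := by
      refine Finset.sum_le_sum fun k _ => ?_
      rw [map_mul, map_ratCast, map_add, map_natCast]
      have h1 := (hωm k).2 σ
      have h3 := ht e S hS k
      rw [Rat.cast_abs]
      exact mul_le_mul h3 (by linarith) (by linarith) (by positivity)
    refine this.trans ?_
    rw [Finset.sum_const, Finset.card_univ, Fintype.card_fin, nsmul_eq_mul]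
    nlinarith
  · intro W X Y A hA1 hA2
    have hterm : ∀ (q : ℚ) (g : K), g ∈ boundedPos K (2 * s) →
        (fun w => 2 * (q * g) * X w * Y w + ((|q| : ℚ) : K) * g * (X w ^ 2 + Y w ^ 2)) ∈
          Submodule.span ℚ≥0 A := by
      intro q g hg
      rcases le_total 0 q with hq | hq
      · rw [abs_of_nonneg hq]
        convert rat_mul_mem_span hq (Submodule.subset_span (hA1 g hg)) using 2
        ring
      · rw [abs_of_nonpos hq]
        convert rat_mul_mem_span (neg_nonneg.2 hq) (Submodule.subset_span (hA2 g hg)) using 2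
        push_cast
        ring
    have hsum := Submodule.sum_mem (Submodule.span ℚ≥0 A) (t := Finset.univ) fun k _ =>
      Submodule.add_mem _ (hterm (t k e) _ (hωm k)) (hterm (-t k e) _ hsm)
    convert hsum using 1
    ext w
    rw [Finset.sum_apply]
    simp only [Pi.add_apply, abs_neg, Rat.cast_neg]
    have he : 2 * e * X w * Y w = ∑ k, 2 * ((t k e : K) * ω k) * X w * Y w := by
      conv_lhs => rw [hx e]
      rw [Finset.mul_sum, Finset.sum_mul, Finset.sum_mul]
    rw [he, Finset.sum_mul, ← Finset.sum_add_distrib]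
    refine Finset.sum_congr rfl fun k _ => ?_
    ring

/-- The linear forms `c i`, `c i ± c j` on `K ^ n`. -/
def coneForm {n : ℕ} (p : Fin n × Fin n × Fin 3) (c : Fin n → K) : K :=
  c p.1 + ((p.2.2 : ℕ) - 1 : ℤ) * c p.2.1

/-- Nearly diagonal balanced forms are nonnegative combinations of finitely many
rank one forms. -/
theorem TotallyReal.exists_cone_presentation (hK : TotallyReal K) (n : ℕ) {C : ℝ} (hC : 1 ≤ C) :
    ∃ ε S : ℝ, 0 < ε ∧ ∀ E : Fin n → Fin n → K, (∀ i, ∀ σ : K →+* ℝ, 0 < σ (E i i)) →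
      (∀ i, ∀ σ τ : K →+* ℝ, σ (E i i) ≤ C * τ (E i i)) →
      (∀ i j, i ≠ j → ∀ σ τ : K →+* ℝ, |σ (E i j)| ≤ ε * τ (E i i)) →
      (∀ i j, i ≠ j → ∀ σ τ : K →+* ℝ, |σ (E i j)| ≤ ε * τ (E j j)) →
      ∃ f : boundedPos K S × (Fin n × Fin n × Fin 3) → ℚ≥0, ∀ c : Fin n → K,
        ∑ i, ∑ j, E i j * c i * c j =
          ∑ᶠ p, (f p : K) * ((p.1 : K) * coneForm p.2 c ^ 2) := by
  classical
  obtain ⟨S₁, hS₁⟩ := hK.exists_balanced_mem_span (C := 2 * C) (by linarith)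
  obtain ⟨S₂, c₂, hc₂, hS₂⟩ := hK.exists_cross_mem_span
  refine ⟨1 / (4 * c₂ * (n + 1)), max S₁ S₂, by positivity, fun E hpos hbal hoff₁ hoff₂ => ?_⟩
  have := (hK.finite_boundedPos (max S₁ S₂)).fintype
  set G : boundedPos K (max S₁ S₂) × (Fin n × Fin n × Fin 3) → ((Fin n → K) → K) :=
    fun p c => (p.1 : K) * coneForm p.2 c ^ 2 with hG
  suffices h : (fun c : Fin n → K => ∑ i, ∑ j, E i j * c i * c j) ∈
      Submodule.span ℚ≥0 (Set.range G) by
    obtain ⟨f, hf⟩ := (Submodule.mem_span_range_iff_exists_fun ℚ≥0).1 h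
    refine ⟨f, fun c => ?_⟩
    rw [finsum_eq_sum_of_fintype, ← congrFun hf c, Finset.sum_apply]
    exact Finset.sum_congr rfl fun p _ => by rw [Pi.smul_apply, NNRat.smul_def]
  set e : Fin n → Fin n → K := fun i j => if i = j then 0 else E i j / 2 with he
  choose r hr0 hr hrm using fun i j => hS₂ (e i j)
  have hε : ∀ x : ℝ, c₂ * (1 / (4 * c₂ * (n + 1)) * x) = x / (4 * (n + 1)) := by
    intro x; field_simp
  have hEτ : ∀ i j, ∀ σ τ : K →+* ℝ, |σ (e i j)| ≤ 1 / (4 * c₂ * (n + 1)) * τ (E i i) := by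
    intro i j σ τ
    have h0 : 0 ≤ 1 / (4 * c₂ * (n + 1)) * τ (E i i) := mul_nonneg (by positivity) (hpos i τ).le
    by_cases h : i = j
    · simpa [he, h] using (h ▸ h0 : 0 ≤ 1 / (4 * c₂ * (n + 1)) * τ (E j j))
    · simp only [he, if_neg h, map_div₀, map_ofNat, abs_div, Nat.abs_ofNat]
      have := hoff₁ i j h σ τ
      have := abs_nonneg (σ (E i j))
      linarith
  have hEτ' : ∀ i j, ∀ σ τ : K →+* ℝ, |σ (e i j)| ≤ 1 / (4 * c₂ * (n + 1)) * τ (E j j) := by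
    intro i j σ τ
    have h0 : 0 ≤ 1 / (4 * c₂ * (n + 1)) * τ (E j j) := mul_nonneg (by positivity) (hpos j τ).le
    by_cases h : i = j
    · simpa [he, h] using h0
    · simp only [he, if_neg h, map_div₀, map_ofNat, abs_div, Nat.abs_ofNat]
      have := hoff₂ i j h σ τ
      have := abs_nonneg (σ (E i j))
      linarith
  set D : Fin n → K := fun i => E i i - ∑ j, (r i j + r j i) with hD
  have hsum : ∀ i, ∀ σ τ : K →+* ℝ, σ (∑ j, (r i j + r j i)) ≤ τ (E i i) / 2 := by
    intro i σ τ
    rw [map_sum]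
    have h1 : ∑ j, σ (r i j + r j i) ≤ ∑ _j : Fin n, 2 * (τ (E i i) / (4 * (n + 1))) := by
      refine Finset.sum_le_sum fun j _ => ?_
      have h1 := hr i j _ (fun σ' => hEτ i j σ' τ) σ
      have h2 := hr j i _ (fun σ' => hEτ' j i σ' τ) σ
      rw [hε] at h1 h2
      rw [map_add]
      linarith
    refine h1.trans ?_
    rw [Finset.sum_const, Finset.card_univ, Fintype.card_fin, nsmul_eq_mul]
    have := hpos i τ
    rw [← mul_assoc, ← mul_div_assoc, div_le_div_iff₀ (by positivity) (by positivity)]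
    nlinarith
  have hsum0 : ∀ i, ∀ σ : K →+* ℝ, 0 ≤ σ (∑ j, (r i j + r j i)) := by
    intro i σ
    rw [map_sum]
    exact Finset.sum_nonneg fun j _ => by
      rw [map_add]; exact add_nonneg (hr0 i j σ) (hr0 j i σ)
  have hDpos : ∀ i, ∀ σ : K →+* ℝ, 0 < σ (D i) := by
    intro i σ
    have h1 := hsum i σ σ
    have h2 := hpos i σ
    simp only [hD, map_sub]
    linarith
  have hDbal : ∀ i, ∀ σ τ : K →+* ℝ, σ (D i) ≤ 2 * C * τ (D i) := by
    intro i σ τ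
    have h1 := hsum i τ τ
    have h2 := hsum0 i σ
    have h3 := hbal i σ τ
    have h4 : C * (τ (E i i) / 2) ≤ C * (τ (E i i) - τ (∑ j, (r i j + r j i))) :=
      mul_le_mul_of_nonneg_left (by linarith) (by linarith)
    simp only [hD, map_sub]
    linarith
  have hdiag : ∀ i, (fun c : Fin n → K => D i * c i ^ 2) ∈ Submodule.span ℚ≥0 (Set.range G) := by
    intro i
    have h1 := hS₁ (D i) (hDpos i) (hDbal i)
    refine Submodule.span_induction
      (p := fun x _ => (fun c : Fin n → K => x * c i ^ 2) ∈ Submodule.span ℚ≥0 (Set.range G))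
      ?_ ?_ ?_ ?_ h1
    · intro g hg
      refine Submodule.subset_span ⟨(⟨g, boundedPos_mono (le_max_left _ _) hg⟩, (i, i, 1)), ?_⟩
      ext c
      simp [hG, coneForm]
    · simp only [zero_mul]
      exact Submodule.zero_mem _
    · intro x y _ _ h h'
      simp only [add_mul]
      exact Submodule.add_mem _ h h'
    · intro q x _ h
      have : (fun c : Fin n → K => q • x * c i ^ 2) = q • fun c : Fin n → K => x * c i ^ 2 := by
        ext c
        rw [Pi.smul_apply, smul_mul_assoc]
      rw [this]
      exact Submodule.smul_mem _ _ h
  have hcross : ∀ i j, (fun c : Fin n → K =>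
      2 * e i j * c i * c j + r i j * (c i ^ 2 + c j ^ 2)) ∈ Submodule.span ℚ≥0 (Set.range G) := by
    intro i j
    refine hrm i j (Fin n → K) (fun c => c i) (fun c => c j) _ ?_ ?_
    · intro g hg
      refine ⟨(⟨g, boundedPos_mono (le_max_right _ _) hg⟩, (i, j, 2)), ?_⟩
      ext c
      simp only [hG, coneForm]
      norm_num
    · intro g hg
      refine ⟨(⟨g, boundedPos_mono (le_max_right _ _) hg⟩, (i, j, 0)), ?_⟩
      ext c
      simp [hG, coneForm, sub_eq_add_neg]
  have htot := Submodule.add_mem _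
    (Submodule.sum_mem (Submodule.span ℚ≥0 (Set.range G)) (t := Finset.univ) fun i _ => hdiag i)
    (Submodule.sum_mem (Submodule.span ℚ≥0 (Set.range G)) (t := Finset.univ) fun i _ =>
      Submodule.sum_mem _ (t := Finset.univ) fun j _ => hcross i j)
  convert htot using 1
  ext c
  simp only [Pi.add_apply, Finset.sum_apply]
  have h1 : ∀ i, ∑ j, E i j * c i * c j = E i i * c i ^ 2 + ∑ j, 2 * e i j * c i * c j := by
    intro i
    rw [← Finset.add_sum_erase _ _ (Finset.mem_univ i),
      ← Finset.add_sum_erase _ (fun j => 2 * e i j * c i * c j) (Finset.mem_univ i)]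
    have h2 : ∑ j ∈ Finset.univ.erase i, E i j * c i * c j =
        ∑ j ∈ Finset.univ.erase i, 2 * e i j * c i * c j := by
      refine Finset.sum_congr rfl fun j hj => ?_
      simp only [he, if_neg (Finset.ne_of_mem_erase hj).symm]
      ring
    rw [h2]
    simp only [he, if_true]
    ring
  simp only [h1, Finset.sum_add_distrib, hD, sub_mul, Finset.sum_mul, Finset.sum_sub_distrib,
    mul_add, add_mul]
  rw [Finset.sum_comm (f := fun i j => r i j * c j ^ 2)]
  ring

end Cone

namespace OKLattice

section Space

variable {K : Type} [Field K]

/-- The ambient quadratic space of a lattice. -/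
abbrev space (L : OKLattice K) : Type := K ⊗[𝓞 K] L.carrier

/-- The inclusion of a lattice in its ambient space. -/
def emb (L : OKLattice K) : L.carrier →ₗ[𝓞 K] L.space := TensorProduct.mk (𝓞 K) K L.carrier 1

/-- The bilinear form on the ambient space. -/
def bil (L : OKLattice K) : L.space →ₗ[K] L.space →ₗ[K] K :=
  LinearMap.BilinForm.baseChange K L.form

theorem bil_tmul (L : OKLattice K) (a b : K) (x y : L.carrier) :
    L.bil (a ⊗ₜ x) (b ⊗ₜ y) = (L.form x y : K) * (a * b) := by
  rw [bil, LinearMap.BilinForm.baseChange_tmul, Algebra.smul_def]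

@[simp]
theorem bil_emb (L : OKLattice K) (x y : L.carrier) : L.bil (L.emb x) (L.emb y) = L.form x y := by
  simp [emb, bil_tmul]

theorem bil_symm (L : OKLattice K) (u v : L.space) : L.bil u v = L.bil v u := by
  induction u using TensorProduct.induction_on with
  | zero => simp
  | add u u' h h' => simp [h, h']
  | tmul a x =>
    induction v using TensorProduct.induction_on with
    | zero => simp
    | add v v' h h' => simp [h, h']
    | tmul b y => rw [bil_tmul, bil_tmul, L.symm, mul_comm a]

theorem eq_zero_of_form_self (L : OKLattice K) (σ : K →+* ℝ) {x : L.carrier}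
    (h : L.form x x = 0) : x = 0 := by
  by_contra hx
  have := L.posDef x hx σ
  rw [h, map_zero, map_zero] at this
  exact this.false

theorem emb_injective (L : OKLattice K) (σ : K →+* ℝ) : Function.Injective L.emb := by
  rw [injective_iff_map_eq_zero]
  intro x hx
  refine L.eq_zero_of_form_self σ (RingOfIntegers.ext ?_)
  rw [← bil_emb, hx]
  simp

variable [NumberField K]

theorem exists_natCast_smul_eq_emb (L : OKLattice K) (v : L.space) :
    ∃ n : ℕ, n ≠ 0 ∧ ∃ x, (n : K) • v = L.emb x := by
  induction v using TensorProduct.induction_on with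
  | zero => exact ⟨1, one_ne_zero, 0, by simp⟩
  | tmul k x =>
    obtain ⟨n, hn, hnk⟩ := exists_natCast_mul_isIntegral k
    obtain ⟨a, ha⟩ : ∃ a : 𝓞 K, (a : K) = n * k := ⟨⟨n * k, hnk⟩, rfl⟩
    refine ⟨n, hn, a • x, ?_⟩
    rw [emb, TensorProduct.mk_apply, ← TensorProduct.smul_tmul, TensorProduct.smul_tmul',
      Algebra.smul_def a (1 : K), show algebraMap (𝓞 K) K a = n * k from ha, smul_eq_mul, mul_one]
  | add u v hu hv =>
    obtain ⟨n, hn, x, hx⟩ := hu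
    obtain ⟨m, hm, y, hy⟩ := hv
    refine ⟨n * m, mul_ne_zero hn hm, m • x + n • y, ?_⟩
    rw [map_add, map_nsmul, map_nsmul, ← hx, ← hy, ← Nat.cast_smul_eq_nsmul K m,
      ← Nat.cast_smul_eq_nsmul K n, smul_smul, smul_smul, smul_add]
    push_cast
    rw [mul_comm (m : K)]

theorem bil_pos (L : OKLattice K) {v : L.space} (hv : v ≠ 0) (σ : K →+* ℝ) :
    0 < σ (L.bil v v) := by
  obtain ⟨n, hn, x, hx⟩ := L.exists_natCast_smul_eq_emb v
  have hn' : (n : K) ≠ 0 := Nat.cast_ne_zero.2 hn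
  have hx0 : x ≠ 0 := by
    rintro rfl
    rw [map_zero, smul_eq_zero] at hx
    exact hx.elim hn' hv
  have h := L.posDef x hx0 σ
  have h2 : (n : K) * (n * L.bil v v) = algebraMap (𝓞 K) K (L.form x x) := by
    refine Eq.trans ?_ (L.bil_emb x x)
    rw [← hx]
    simp
  rw [← h2, map_mul, map_mul, map_natCast, ← mul_assoc] at h
  exact (pos_iff_pos_of_mul_pos h).1 (mul_self_pos.2 (Nat.cast_ne_zero.2 hn))

theorem span_range_emb (L : OKLattice K) : Submodule.span K (Set.range L.emb) = ⊤ := by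
  rw [eq_top_iff]
  intro v _
  obtain ⟨n, hn, x, hx⟩ := L.exists_natCast_smul_eq_emb v
  have hn' : (n : K) ≠ 0 := Nat.cast_ne_zero.2 hn
  have : v = (n : K)⁻¹ • L.emb x := by rw [← hx, smul_smul, inv_mul_cancel₀ hn', one_smul]
  rw [this]
  exact Submodule.smul_mem _ _ (Submodule.subset_span ⟨x, rfl⟩)

/-- An embedding of a lattice in a space which it spans computes the rank. -/
theorem rank_eq_finrank (L : OKLattice K) {W : Type} [AddCommGroup W] [Module K W]
    [Module (𝓞 K) W] [IsScalarTower (𝓞 K) K W] (f : L.carrier →ₗ[𝓞 K] W)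
    (hf : Function.Injective f) (hs : Submodule.span K (Set.range f) = ⊤) :
    L.rank = Module.finrank K W := by
  refine LinearEquiv.finrank_eq (LinearEquiv.ofBijective (LinearMap.liftBaseChange K f) ⟨?_, ?_⟩)
  · rw [injective_iff_map_eq_zero]
    intro v hv
    obtain ⟨n, hn, x, hx⟩ := L.exists_natCast_smul_eq_emb v
    have hn' : (n : K) ≠ 0 := Nat.cast_ne_zero.2 hn
    have h : f x = 0 := by
      have h1 := congrArg (LinearMap.liftBaseChange K f) hx
      rw [map_smul, hv, smul_zero] at h1
      simpa [emb] using h1.symm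
    rw [hf (h.trans (map_zero f).symm), map_zero, smul_eq_zero] at hx
    exact hx.resolve_left hn'
  · rw [← LinearMap.range_eq_top, eq_top_iff, ← hs, Submodule.span_le]
    rintro _ ⟨x, rfl⟩
    exact ⟨1 ⊗ₜ x, by simp⟩

/-- Orthogonal sum. -/
def prod (L M : OKLattice K) : OKLattice K where
  carrier := L.carrier × M.carrier
  torsionFree := ⟨fun {c x} h => by
    rw [Prod.ext_iff] at h ⊢
    by_contra! hc
    exact hc.2 ((smul_eq_zero.1 h.1).resolve_left hc.1) ((smul_eq_zero.1 h.2).resolve_left hc.1)⟩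
  form := L.form.compl₁₂ (LinearMap.fst _ _ _) (LinearMap.fst _ _ _) +
    M.form.compl₁₂ (LinearMap.snd _ _ _) (LinearMap.snd _ _ _)
  symm x y := by simp [L.symm x.1, M.symm x.2]
  posDef v hv σ := by
    have hL : ∀ x : L.carrier, 0 ≤ σ (algebraMap (𝓞 K) K (L.form x x)) := fun x => by
      rcases eq_or_ne x 0 with rfl | h
      · simp
      · exact (L.posDef x h σ).le
    have hM : ∀ x : M.carrier, 0 ≤ σ (algebraMap (𝓞 K) K (M.form x x)) := fun x => by
      rcases eq_or_ne x 0 with rfl | h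
      · simp
      · exact (M.posDef x h σ).le
    simp only [LinearMap.add_apply, LinearMap.compl₁₂_apply, map_add, LinearMap.fst_apply,
      LinearMap.snd_apply]
    by_cases h : v.1 = 0
    · have h2 : v.2 ≠ 0 := fun h2 => hv (Prod.ext h h2)
      exact add_pos_of_nonneg_of_pos (hL _) (M.posDef _ h2 σ)
    · exact add_pos_of_pos_of_nonneg (L.posDef _ h σ) (hM _)

theorem prod_form (L M : OKLattice K) (x y : (L.prod M).carrier) :
    (L.prod M).form x y = L.form x.1 y.1 + M.form x.2 y.2 := rfl

/-- Finite orthogonal sum. -/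
def pi {ι : Type} [Fintype ι] (L : ι → OKLattice K) : OKLattice K where
  carrier := ∀ i, (L i).carrier
  form := ∑ i, (L i).form.compl₁₂ (LinearMap.proj i) (LinearMap.proj i)
  symm x y := by
    simp only [LinearMap.sum_apply, LinearMap.compl₁₂_apply, LinearMap.proj_apply]
    exact Finset.sum_congr rfl fun i _ => (L i).symm _ _
  posDef v hv σ := by
    simp only [LinearMap.sum_apply, LinearMap.compl₁₂_apply, map_sum, LinearMap.proj_apply]
    obtain ⟨i, hi⟩ := Function.ne_iff.1 hv
    refine Finset.sum_pos' (fun j _ => ?_) ⟨i, Finset.mem_univ i, (L i).posDef _ hi σ⟩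
    rcases eq_or_ne (v j) 0 with h | h
    · simp [h]
    · exact ((L j).posDef _ h σ).le

theorem pi_form {ι : Type} [Fintype ι] (L : ι → OKLattice K) (x y : ∀ i, (L i).carrier) :
    (pi L).form x y = ∑ i, (L i).form (x i) (y i) := by
  change (∑ i, (L i).form.compl₁₂ (LinearMap.proj i) (LinearMap.proj i)) x y = _
  simp only [LinearMap.sum_apply, LinearMap.compl₁₂_apply, LinearMap.proj_apply]

/-- A positive definite form on the carrier of a lattice. -/
def withForm (L : OKLattice K) (B : L.carrier →ₗ[𝓞 K] L.carrier →ₗ[𝓞 K] 𝓞 K)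
    (hB : ∀ x y, B x y = B y x)
    (hpos : ∀ v : L.carrier, v ≠ 0 → ∀ σ : K →+* ℝ, 0 < σ (algebraMap (𝓞 K) K (B v v))) :
    OKLattice K where
  carrier := L.carrier
  form := B
  symm := hB
  posDef := hpos

/-- The free lattice with a given Gram matrix. -/
def ofMatrix {r : ℕ} (G : Matrix (Fin r) (Fin r) (𝓞 K)) (hG : G.IsSymm)
    (hpos : ∀ v : Fin r → 𝓞 K, v ≠ 0 → ∀ σ : K →+* ℝ,
      0 < σ (algebraMap (𝓞 K) K (Matrix.toLinearMap₂' (𝓞 K) G v v))) : OKLattice K where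
  carrier := Fin r → 𝓞 K
  form := Matrix.toLinearMap₂' (𝓞 K) G
  symm x y := by
    rw [Matrix.toLinearMap₂'_apply', Matrix.toLinearMap₂'_apply', Matrix.dotProduct_mulVec,
      ← Matrix.mulVec_transpose, hG, dotProduct_comm]
  posDef := hpos

theorem rank_ofMatrix {r : ℕ} (G : Matrix (Fin r) (Fin r) (𝓞 K)) (hG : G.IsSymm) (hpos) :
    (ofMatrix G hG hpos).rank = r := by
  rw [rank_eq_finrank _ (W := Fin r → K) (LinearMap.compLeft (Algebra.linearMap (𝓞 K) K) (Fin r))]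
  · simp
  · intro x y h
    funext i
    exact RingOfIntegers.ext (congrFun h i)
  · rw [eq_top_iff, ← (Pi.basisFun K (Fin r)).span_eq]
    refine Submodule.span_mono ?_
    rintro _ ⟨i, rfl⟩
    refine ⟨Pi.single i 1, ?_⟩
    funext j
    change ((Pi.single i 1 : Fin r → 𝓞 K) j : K) = Pi.basisFun K (Fin r) i j
    by_cases h : j = i
    · subst h; simp
    · simp [h]

/-- The rank one lattice `⟨a⟩`. -/
def unary (a : 𝓞 K) (ha : ∀ σ : K →+* ℝ, 0 < σ a) : OKLattice K where
  carrier := 𝓞 K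
  form := a • LinearMap.mul (𝓞 K) (𝓞 K)
  symm x y := by simp [mul_comm x]
  posDef v hv σ := by
    have hv' : σ (v : K) ≠ 0 := (map_ne_zero σ).2 (RingOfIntegers.coe_ne_zero_iff.2 hv)
    simp only [LinearMap.smul_apply, LinearMap.mul_apply', smul_eq_mul, map_mul]
    exact mul_pos (ha σ) (mul_self_pos.2 hv')

theorem unary_form {K : Type} [Field K] (a : 𝓞 K) (ha) (x y : 𝓞 K) :
    (unary a ha).form x y = a * (x * y) := rfl

theorem rank_prod (L M : OKLattice K) (σ : K →+* ℝ) : (L.prod M).rank = L.rank + M.rank := by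
  rw [rank_eq_finrank _ (W := L.space × M.space)
    (show L.carrier × M.carrier →ₗ[𝓞 K] _ from LinearMap.prodMap L.emb M.emb),
    Module.finrank_prod]
  · rfl
  · exact (L.emb_injective σ).prodMap (M.emb_injective σ)
  · rw [eq_top_iff]
    rintro ⟨u, v⟩ -
    have hu : u ∈ Submodule.span K (Set.range L.emb) := L.span_range_emb ▸ Submodule.mem_top
    have hv : v ∈ Submodule.span K (Set.range M.emb) := M.span_range_emb ▸ Submodule.mem_top
    have h1 := Submodule.mem_map_of_mem (f := LinearMap.inl K L.space M.space) hu
    have h2 := Submodule.mem_map_of_mem (f := LinearMap.inr K L.space M.space) hv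
    rw [Submodule.map_span] at h1 h2
    have : (u, v) = LinearMap.inl K L.space M.space u + LinearMap.inr K L.space M.space v := by simp
    rw [this]
    refine Submodule.add_mem _ (Submodule.span_mono ?_ h1) (Submodule.span_mono ?_ h2)
    · rintro _ ⟨_, ⟨x, rfl⟩, rfl⟩
      exact ⟨(x, 0), Prod.ext rfl (map_zero M.emb)⟩
    · rintro _ ⟨_, ⟨x, rfl⟩, rfl⟩
      exact ⟨(0, x), Prod.ext (map_zero L.emb) rfl⟩

theorem Represents.pi {ι : Type} [Fintype ι] {L : ι → OKLattice K} {M : OKLattice K}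
    (f : ∀ i, M.carrier →ₗ[𝓞 K] (L i).carrier)
    (h : ∀ x, ∑ i, (L i).form (f i x) (f i x) = M.form x x) : (OKLattice.pi L).Represents M :=
  ⟨LinearMap.pi f, fun x => (pi_form L _ _).trans (h x)⟩

/-- A representation preserves the bilinear form. -/
theorem form_map_map {L M : OKLattice K} {f : M.carrier →ₗ[𝓞 K] L.carrier}
    (h : ∀ x, L.form (f x) (f x) = M.form x x) (x y : M.carrier) :
    L.form (f x) (f y) = M.form x y := by
  have h1 := h (x + y)
  simp only [map_add, LinearMap.add_apply, h, L.symm (f y) (f x), M.symm y x] at h1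
  have h2 : (2 : 𝓞 K) * (L.form (f x) (f y) - M.form x y) = 0 := by linear_combination h1
  exact sub_eq_zero.1 ((mul_eq_zero.1 h2).resolve_left two_ne_zero)

theorem IsUniversal.represents_of_rank_le {L : OKLattice K} {n : ℕ} (hL : L.IsUniversal n)
    (σ : K →+* ℝ) {M : OKLattice K} (hM : M.rank ≤ n) : L.Represents M := by
  obtain ⟨k, rfl⟩ := Nat.exists_eq_add_of_le hM
  have hpos : ∀ v : Fin k → 𝓞 K, v ≠ 0 → ∀ σ : K →+* ℝ, 0 < σ (algebraMap (𝓞 K) K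
      (Matrix.toLinearMap₂' (𝓞 K) (1 : Matrix (Fin k) (Fin k) (𝓞 K)) v v)) := by
    intro v hv σ
    rw [Matrix.toLinearMap₂'_apply', Matrix.one_mulVec, dotProduct, map_sum, map_sum]
    obtain ⟨i, hi⟩ := Function.ne_iff.1 hv
    refine Finset.sum_pos' (fun j _ => ?_) ⟨i, Finset.mem_univ i, ?_⟩
    · rw [map_mul, map_mul]
      exact mul_self_nonneg _
    · rw [map_mul, map_mul]
      exact mul_self_pos.2 ((map_ne_zero σ).2 (RingOfIntegers.coe_ne_zero_iff.2 hi))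
  obtain ⟨f, hf⟩ := hL (M.prod (ofMatrix 1 Matrix.isSymm_one hpos))
    ((rank_prod _ _ σ).trans (congrArg _ (rank_ofMatrix _ _ _)))
  refine ⟨f ∘ₗ LinearMap.inl (𝓞 K) M.carrier (Fin k → 𝓞 K), fun x => (hf _).trans ?_⟩
  change M.form x x + (ofMatrix 1 Matrix.isSymm_one hpos).form 0 0 = _
  rw [map_zero, add_zero]

end Space

end OKLattice

namespace OKLattice

section Existence

variable {K : Type} [Field K] [NumberField K]

theorem pi_represents {ι : Type} [Fintype ι] {L : ι → OKLattice K} {M : OKLattice K} (i : ι)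
    (h : (L i).Represents M) : (OKLattice.pi L).Represents M := by
  classical
  obtain ⟨f, hf⟩ := h
  refine ⟨(show (L i).carrier →ₗ[𝓞 K] (OKLattice.pi L).carrier from
    LinearMap.single (𝓞 K) (fun i => (L i).carrier) i) ∘ₗ f, fun x => (pi_form L _ _).trans ?_⟩
  rw [← hf x]
  have h : ∀ j, (L j).form ((Pi.single i (f x) : ∀ i, (L i).carrier) j)
      ((Pi.single i (f x) : ∀ i, (L i).carrier) j) =
      if j = i then (L i).form (f x) (f x) else 0 := by
    intro j
    by_cases hj : j = i
    · subst hj; simp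
    · simp [hj]
  exact (Finset.sum_congr rfl fun j _ => h j).trans (by simp)

/-- `φ` embeds `M` in `O ^ n` with image containing `N O ^ n`. -/
structure IsFramed (M : OKLattice K) {n : ℕ} (N : ℕ)
    (φ : M.carrier →ₗ[𝓞 K] Fin n → 𝓞 K) (g : Fin n → M.carrier) : Prop where
  injective : Function.Injective φ
  map_frame : ∀ i, φ (g i) = Pi.single i (N : 𝓞 K)

theorem IsFramed.smul_eq {K : Type} [Field K] {M : OKLattice K} {n N : ℕ}
    {φ : M.carrier →ₗ[𝓞 K] Fin n → 𝓞 K} {g : Fin n → M.carrier} (h : M.IsFramed N φ g)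
    (x : M.carrier) :
    (N : 𝓞 K) • x = ∑ i, φ x i • g i := by
  refine h.injective ?_
  rw [map_smul, map_sum]
  funext j
  simp [h.map_frame, Pi.single_apply, mul_comm]

theorem IsFramed.mem_range_iff {K : Type} [Field K] {M : OKLattice K} {n N : ℕ}
    {φ : M.carrier →ₗ[𝓞 K] Fin n → 𝓞 K} {g : Fin n → M.carrier} (h : M.IsFramed N φ g)
    (y : Fin n → 𝓞 K) :
    (fun i => Ideal.Quotient.mk (Ideal.span {(N : 𝓞 K)}) (y i)) ∈
      Set.range (fun x i => Ideal.Quotient.mk (Ideal.span {(N : 𝓞 K)}) (φ x i)) ↔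
      y ∈ Set.range φ := by
  constructor
  · rintro ⟨x, hx⟩
    have h1 : ∀ i, ∃ c, y i = φ x i + N * c := by
      intro i
      obtain ⟨c, hc⟩ := Ideal.mem_span_singleton.1 (Ideal.Quotient.eq.1 (congrFun hx i))
      exact ⟨-c, by linear_combination -hc⟩
    choose c hc using h1
    refine ⟨x + ∑ i, c i • g i, ?_⟩
    funext j
    simp [h.map_frame, Pi.single_apply, hc, mul_comm]
  · rintro ⟨x, rfl⟩
    exact ⟨x, rfl⟩

theorem IsFramed.represents {M M' : OKLattice K} {n N : ℕ} (hN : N ≠ 0)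
    {φ : M.carrier →ₗ[𝓞 K] Fin n → 𝓞 K} {g : Fin n → M.carrier} (h : M.IsFramed N φ g)
    {φ' : M'.carrier →ₗ[𝓞 K] Fin n → 𝓞 K} {g' : Fin n → M'.carrier} (h' : M'.IsFramed N φ' g')
    (hφ : Set.range (fun x i => Ideal.Quotient.mk (Ideal.span {(N : 𝓞 K)}) (φ x i)) =
      Set.range (fun x i => Ideal.Quotient.mk (Ideal.span {(N : 𝓞 K)}) (φ' x i)))
    (hg : ∀ i j, M.form (g i) (g j) = M'.form (g' i) (g' j)) : M'.Represents M := by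
  have hN' : (N : 𝓞 K) ≠ 0 := Nat.cast_ne_zero.2 hN
  have hex : ∀ x, ∃ y, φ' y = φ x := by
    intro x
    exact (h'.mem_range_iff (φ x)).1 (hφ ▸ (h.mem_range_iff (φ x)).2 ⟨x, rfl⟩)
  choose f hf using hex
  refine ⟨⟨⟨f, fun x y => h'.injective ?_⟩, fun a x => h'.injective ?_⟩, fun x => ?_⟩
  · simp [hf]
  · simp [hf]
  · have h1 : (N : 𝓞 K) * (N * M.form x x) = N * (N * M'.form (f x) (f x)) := by
      have e1 : (N : 𝓞 K) * (N * M.form x x) = M.form ((N : 𝓞 K) • x) ((N : 𝓞 K) • x) := by simp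
      have e2 : (N : 𝓞 K) * (N * M'.form (f x) (f x)) =
          M'.form ((N : 𝓞 K) • f x) ((N : 𝓞 K) • f x) := by simp
      rw [e1, e2, h.smul_eq, h'.smul_eq]
      simp [hf, hg]
    exact (mul_left_cancel₀ hN' (mul_left_cancel₀ hN' h1)).symm

theorem exists_represents_framed (hK : TotallyReal K) (n : ℕ) {N : ℕ} (hN : N ≠ 0) (B : ℝ) :
    ∃ U : OKLattice K, ∀ (M : OKLattice K) (φ : M.carrier →ₗ[𝓞 K] Fin n → 𝓞 K)
      (g : Fin n → M.carrier), M.IsFramed N φ g →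
      (∀ i j, ∀ σ : K →+* ℝ, |σ (M.form (g i) (g j))| ≤ B) → U.Represents M := by
  classical
  have hN' : Ideal.span {(N : 𝓞 K)} ≠ ⊥ := by
    simpa using hN
  have : Finite (𝓞 K ⧸ Ideal.span {(N : 𝓞 K)}) := Ideal.finiteQuotientOfFreeOfNeBot _ hN'
  have : Finite {x : 𝓞 K // ∀ σ : K →+* ℝ, |σ x| ≤ B} := by
    have := (hK.finite_bounded B).to_subtype
    refine Finite.of_injective (β := {x | IsIntegral ℤ x ∧ ∀ σ : K →+* ℝ, |σ x| ≤ B})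
      (fun x => ⟨x.1, RingOfIntegers.isIntegral_coe _, x.2⟩) fun x y h => ?_
    have h' : ((x : 𝓞 K) : K) = (y : 𝓞 K) := congrArg (fun z => (z.1 : K)) h
    exact Subtype.ext (RingOfIntegers.ext h')
  let D : Type := Set (Fin n → 𝓞 K ⧸ Ideal.span {(N : 𝓞 K)}) ×
    (Fin n → Fin n → {x : 𝓞 K // ∀ σ : K →+* ℝ, |σ x| ≤ B})
  have : Fintype D := Fintype.ofFinite _
  let P : D → OKLattice K → Prop := fun d M => ∃ φ g, M.IsFramed N φ g ∧
    Set.range (fun x i => Ideal.Quotient.mk (Ideal.span {(N : 𝓞 K)}) (φ x i)) = d.1 ∧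
    ∀ i j, M.form (g i) (g j) = d.2 i j
  refine ⟨OKLattice.pi fun d : D =>
    if h : ∃ M, P d M then h.choose else unary 1 (by simp), fun M φ g hM hB => ?_⟩
  let d : D := (Set.range (fun x i => Ideal.Quotient.mk (Ideal.span {(N : 𝓞 K)}) (φ x i)),
    fun i j => ⟨M.form (g i) (g j), hB i j⟩)
  have hd : ∃ M, P d M := ⟨M, φ, g, hM, rfl, fun _ _ => rfl⟩
  refine pi_represents d ?_
  rw [dif_pos hd]
  obtain ⟨φ', g', h1, h2, h3⟩ := hd.choose_spec
  exact hM.represents hN h1 h2.symm fun i j => (h3 i j).symm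

/-- Four copies of `⟨a⟩` for each `a` represent any sum of natural multiples of `a ℓ²`. -/
theorem exists_represents_squares {P : Type} [Fintype P] (a : P → 𝓞 K)
    (ha : ∀ p, ∀ σ : K →+* ℝ, 0 < σ (a p)) :
    ∃ U : OKLattice K, ∀ (V : Type) [AddCommGroup V] [Module (𝓞 K) V] (ℓ : P → V →ₗ[𝓞 K] 𝓞 K)
      (m : P → ℕ), ∃ f : V →ₗ[𝓞 K] U.carrier, ∀ x,
        U.form (f x) (f x) = ∑ p, (m p : 𝓞 K) * (a p * ℓ p x ^ 2) := by
  refine ⟨OKLattice.pi fun q : P × Fin 4 => unary (a q.1) (ha q.1), fun V _ _ ℓ m => ?_⟩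
  choose s₁ s₂ s₃ s₄ hs using fun p => Nat.sum_four_squares (m p)
  let s : P × Fin 4 → ℕ := fun q => ![s₁ q.1, s₂ q.1, s₃ q.1, s₄ q.1] q.2
  refine ⟨LinearMap.pi fun q : P × Fin 4 =>
    (show V →ₗ[𝓞 K] (unary (a q.1) (ha q.1)).carrier from (s q : 𝓞 K) • ℓ q.1), fun x => ?_⟩
  refine (pi_form _ _ _).trans ?_
  rw [Fintype.sum_prod_type]
  refine Finset.sum_congr rfl fun p _ => ?_
  have h : ∀ i : Fin 4, (unary (a p) (ha p)).form (((s (p, i) : 𝓞 K) • ℓ p) x)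
      (((s (p, i) : 𝓞 K) • ℓ p) x) = (s (p, i) : 𝓞 K) ^ 2 * (a p * ℓ p x ^ 2) := by
    intro i
    rw [unary_form, LinearMap.smul_apply, smul_eq_mul]
    ring
  refine (Finset.sum_congr rfl fun i _ => h i).trans ?_
  rw [← Finset.sum_mul, ← hs p]
  simp only [Fin.sum_univ_four, s]
  push_cast
  rfl

theorem abs_form_le (M : OKLattice K) {x y : M.carrier} {B : ℝ} (σ : K →+* ℝ)
    (hx : σ (M.form x x) ≤ B) (hy : σ (M.form y y) ≤ B) : |σ (M.form x y)| ≤ B := by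
  have hpos : ∀ z : M.carrier, 0 ≤ σ (algebraMap (𝓞 K) K (M.form z z)) := fun z => by
    rcases eq_or_ne z 0 with rfl | h
    · simp
    · exact (M.posDef z h σ).le
  have h1 := hpos (x + y)
  have h2 := hpos (x - y)
  simp only [map_add, map_sub, LinearMap.add_apply, LinearMap.sub_apply, M.symm y x] at h1 h2
  rw [abs_le]
  constructor <;> linarith

/-- The integral version of `coneForm`. -/
def intConeForm {n : ℕ} (p : Fin n × Fin n × Fin 3) : (Fin n → 𝓞 K) →ₗ[𝓞 K] 𝓞 K :=
  LinearMap.proj p.1 + (((p.2.2 : ℕ) - 1 : ℤ) : 𝓞 K) • LinearMap.proj p.2.1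

theorem coe_intConeForm {K : Type} [Field K] {n : ℕ} (p : Fin n × Fin n × Fin 3)
    (c : Fin n → 𝓞 K) :
    (intConeForm p c : K) = coneForm p fun i => (c i : K) := by
  simp [intConeForm, coneForm]

theorem abs_intConeForm_single_le {n : ℕ} (p : Fin n × Fin n × Fin 3) (i : Fin n) (N : ℕ)
    (σ : K →+* ℝ) : |σ (intConeForm p (Pi.single i (N : 𝓞 K)) : K)| ≤ 2 * N := by
  have h : ∀ j : Fin n, |σ ((Pi.single i (N : 𝓞 K) : Fin n → 𝓞 K) j : K)| ≤ N := by
    intro j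
    by_cases hj : j = i
    · subst hj; simp
    · simp [hj]
  have h3 : |(((p.2.2 : ℕ) - 1 : ℤ) : ℝ)| ≤ 1 := by
    obtain ⟨_, _, k⟩ := p
    fin_cases k <;> simp
  rw [coe_intConeForm, coneForm, map_add, map_mul, map_intCast]
  refine (abs_add_le _ _).trans ?_
  rw [abs_mul]
  have := mul_le_mul h3 (h p.2.1) (abs_nonneg _) zero_le_one
  linarith [h p.1]

/-- There are lattices of finite rank representing all lattices of rank `n`. -/
theorem exists_isUniversal (hK : TotallyReal K) (n : ℕ) :
    ∃ U : OKLattice K, U.IsUniversal n := by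
  classical
  obtain ⟨σ₀⟩ := hK.nonempty_embedding
  obtain ⟨C, hC, hred⟩ := hK.exists_isReducedFamily n
  obtain ⟨ε, S, hε, hcone⟩ := hK.exists_cone_presentation n hC
  obtain ⟨N, hN, hred⟩ := hred ε hε
  have hN' : (N : K) ≠ 0 := Nat.cast_ne_zero.2 hN
  have := (hK.finite_boundedPos S).fintype
  let P : Type := boundedPos K S × (Fin n × Fin n × Fin 3)
  let a : P → 𝓞 K := fun p => ⟨p.1, p.1.2.1⟩
  have ha : ∀ p, ∀ σ : K →+* ℝ, 0 < σ (a p) := fun p σ => (p.1.2.2 σ).1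
  have haS : ∀ p, ∀ σ : K →+* ℝ, σ (a p) ≤ S := fun p σ => (p.1.2.2 σ).2
  obtain ⟨U₁, hU₁⟩ := exists_represents_framed hK n hN (∑ _p : P, S * (2 * N) ^ 2)
  obtain ⟨U₂, hU₂⟩ := exists_represents_squares a ha
  refine ⟨U₁.prod U₂, fun L hL => ?_⟩
  obtain ⟨v, hv⟩ := hred L.space L.bil L.bil_symm (fun v hv σ => L.bil_pos hv σ)
    L.emb.toAddMonoidHom.range
    (by
      rintro b hb _ ⟨x, rfl⟩
      obtain ⟨b, rfl⟩ : ∃ b' : 𝓞 K, (b' : K) = b := ⟨⟨b, hb⟩, rfl⟩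
      exact ⟨b • x, by rw [LinearMap.toAddMonoidHom_coe, map_smul]; rfl⟩)
    1 one_ne_zero
    (by
      rintro _ ⟨x, rfl⟩ _ ⟨y, rfl⟩
      rw [LinearMap.toAddMonoidHom_coe, bil_emb, Nat.cast_one, one_mul]
      exact RingOfIntegers.isIntegral_coe _)
    (by
      have : ((L.emb.toAddMonoidHom.range : AddSubgroup L.space) : Set L.space) =
        Set.range L.emb := rfl
      rw [this, L.span_range_emb, finrank_top]
      exact hL)
  have hli : LinearIndependent K v := hv.linearIndependent hN (by
    have : ((L.emb.toAddMonoidHom.range : AddSubgroup L.space) : Set L.space) =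
      Set.range L.emb := rfl
    rw [this, L.span_range_emb, finrank_top]
    exact hL)
  have hinj : ∀ c d : Fin n → 𝓞 K, ∑ i, (c i : K) • v i = ∑ i, (d i : K) • v i → c = d := by
    intro c d h
    funext i
    refine RingOfIntegers.ext (sub_eq_zero.1 (Fintype.linearIndependent_iff.1 hli
      (fun i => (c i : K) - d i) ?_ i))
    simp only [sub_smul, Finset.sum_sub_distrib, h, sub_self]
  have hmem : ∀ i, ∃ g, L.emb g = v i := fun i => hv.mem i
  choose g hg using hmem
  have hφ : ∀ x : L.carrier, ∃ c : Fin n → 𝓞 K, (N : K) • L.emb x = ∑ i, (c i : K) • v i := by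
    intro x
    obtain ⟨c, hc, h⟩ := hv.span _ ⟨x, rfl⟩
    exact ⟨fun i => ⟨c i, hc i⟩, h⟩
  choose φ₀ hφ₀ using hφ
  let φ : L.carrier →ₗ[𝓞 K] Fin n → 𝓞 K :=
    { toFun := φ₀
      map_add' := fun x y => hinj _ _ (by
        rw [← hφ₀, map_add, smul_add, hφ₀, hφ₀, ← Finset.sum_add_distrib]
        simp [add_smul])
      map_smul' := fun b x => hinj _ _ (by
        rw [← hφ₀, map_smul, smul_comm, hφ₀, Finset.smul_sum]
        refine Finset.sum_congr rfl fun i _ => ?_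
        simp [mul_smul, algebraMap_smul]) }
  have hφN : ∀ x, (N : K) • L.emb x = ∑ i, (φ x i : K) • v i := hφ₀
  have hframe : L.IsFramed N φ g := by
    refine ⟨fun x y h => L.emb_injective σ₀ (smul_right_injective _ hN' ?_), fun i => hinj _ _ ?_⟩
    · change (N : K) • L.emb x = (N : K) • L.emb y
      rw [hφN, hφN, h]
    · rw [← hφN, hg, Finset.sum_eq_single i]
      · simp
      · intro j _ hj
        simp [hj]
      · simp
  obtain ⟨f, hf⟩ := hcone (fun i j => L.bil (v i) (v j))
    (fun i σ => L.bil_pos (hli.ne_zero i) σ) hv.balanced hv.offDiag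
    (fun i j hij σ τ => by rw [L.bil_symm]; exact hv.offDiag j i hij.symm σ τ)
  let q : P → ℚ≥0 := fun p => f p / N ^ 2
  let m : P → ℕ := fun p => ⌈q p⌉₊ - 1
  let r : P → ℚ := fun p => q p - m p
  have hr : ∀ p, 0 ≤ r p ∧ r p ≤ 1 ∧ (q p ≠ 0 → 0 < r p) := by
    intro p
    have h1 : ⌈q p⌉₊ ≤ m p + 1 := by simp only [m]; omega
    have h2 : q p ≤ m p + 1 := (Nat.ceil_le.1 h1).trans_eq (by push_cast; rfl)
    have h2' : (q p : ℚ) ≤ m p + 1 := by exact_mod_cast h2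
    rcases eq_or_ne (q p) 0 with h0 | h0
    · have : m p = 0 := by simp [m, h0]
      simp [r, h0, this]
    · have h3 : m p < ⌈q p⌉₊ := by
        have := Nat.ceil_pos.2 (pos_iff_ne_zero.2 h0)
        simp only [m]; omega
      have h4 : (m p : ℚ≥0) < q p := Nat.lt_ceil.1 h3
      have h4' : (m p : ℚ) < q p := by exact_mod_cast h4
      simp only [r]
      exact ⟨by linarith, by linarith, fun _ => by linarith⟩
  let ℓ : P → L.carrier →ₗ[𝓞 K] 𝓞 K := fun p => intConeForm p.2 ∘ₗ φ
  have hform : ∀ x, (L.form x x : K) = ∑ p, (q p : K) * ((a p : K) * (ℓ p x : K) ^ 2) := by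
    intro x
    have h1 := hf fun i => (φ x i : K)
    rw [finsum_eq_sum_of_fintype] at h1
    have h2 : (N : K) * (N * (L.form x x : K)) =
        ∑ i, ∑ j, L.bil (v i) (v j) * (φ x i : K) * (φ x j : K) := by
      have h3 : (N : K) * (N * (L.form x x : K)) =
          L.bil ((N : K) • L.emb x) ((N : K) • L.emb x) := by simp
      rw [h3, hφN]
      simp only [map_sum, LinearMap.sum_apply, map_smul, LinearMap.smul_apply, smul_eq_mul]
      rw [Finset.sum_comm]
      refine Finset.sum_congr rfl fun i _ => ?_
      rw [Finset.mul_sum]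
      exact Finset.sum_congr rfl fun j _ => by ring
    rw [h1, ← mul_assoc] at h2
    rw [← mul_right_inj' (mul_ne_zero hN' hN'), h2, Finset.mul_sum]
    refine Finset.sum_congr rfl fun p _ => ?_
    simp only [q, ℓ, LinearMap.comp_apply, coe_intConeForm]
    push_cast
    have : (a p : K) = p.1 := rfl
    rw [this]
    field_simp
  obtain ⟨f₂, hf₂⟩ := hU₂ L.carrier ℓ m
  let M : L.carrier →ₗ[𝓞 K] L.carrier →ₗ[𝓞 K] 𝓞 K :=
    L.form - U₂.form.compl₁₂ f₂ f₂
  have hM : ∀ x, (M x x : K) = ∑ p, (r p : K) * ((a p : K) * (ℓ p x : K) ^ 2) := by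
    intro x
    simp only [M, LinearMap.sub_apply, LinearMap.compl₁₂_apply, hf₂, map_sub, hform, map_sum,
      map_mul, map_pow, map_natCast]
    rw [← Finset.sum_sub_distrib]
    refine Finset.sum_congr rfl fun p _ => ?_
    simp only [r]
    push_cast
    ring
  have hMnn : ∀ x (σ : K →+* ℝ) p, 0 ≤ σ ((r p : K) * ((a p : K) * (ℓ p x : K) ^ 2)) := by
    intro x σ p
    rw [map_mul, map_mul, map_pow, map_ratCast]
    exact mul_nonneg (by exact_mod_cast (hr p).1) (mul_nonneg (ha p σ).le (sq_nonneg _))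
  let R : OKLattice K := L.withForm M (fun x y => by
      simp only [M, LinearMap.sub_apply, LinearMap.compl₁₂_apply, L.symm x, U₂.symm (f₂ x)])
    (by
      intro x hx σ
      rw [show algebraMap (𝓞 K) K (M x x) = _ from hM x, map_sum]
      have h0 : L.form x x ≠ 0 := fun h => hx (L.eq_zero_of_form_self σ h)
      have h1 : (L.form x x : K) ≠ 0 := RingOfIntegers.coe_ne_zero_iff.2 h0
      rw [hform] at h1
      obtain ⟨p, -, hp⟩ := Finset.exists_ne_zero_of_sum_ne_zero h1
      refine Finset.sum_pos' (fun p _ => hMnn x σ p) ⟨p, Finset.mem_univ p,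
        (hMnn x σ p).lt_of_ne' ?_⟩
      rw [map_ne_zero]
      refine mul_ne_zero ?_ (right_ne_zero_of_mul hp)
      have := (hr p).2.2 (by rintro h; simp [h] at hp)
      exact_mod_cast this.ne')
  obtain ⟨f₁, hf₁⟩ := hU₁ R φ g ⟨hframe.injective, hframe.map_frame⟩ (by
    intro i j σ
    have hb : ∀ i, σ (M (g i) (g i)) ≤ ∑ _p : P, S * (2 * N) ^ 2 := by
      intro i
      rw [hM, map_sum]
      refine Finset.sum_le_sum fun p _ => ?_
      rw [map_mul, map_mul, map_pow, map_ratCast]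
      have h1 : |σ (ℓ p (g i) : K)| ≤ 2 * N := by
        simp only [ℓ, LinearMap.comp_apply, hframe.map_frame]
        exact abs_intConeForm_single_le _ _ _ _
      have h2 : σ (ℓ p (g i) : K) ^ 2 ≤ (2 * N) ^ 2 := sq_le_sq.2 (h1.trans (le_abs_self _))
      have h3 := mul_le_mul (haS p σ) h2 (sq_nonneg _) ((ha p σ).le.trans (haS p σ))
      have h4 : ((r p : ℚ) : ℝ) ≤ 1 := by exact_mod_cast (hr p).2.1
      exact (mul_le_of_le_one_left (mul_nonneg (ha p σ).le (sq_nonneg _)) h4).trans h3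
    exact abs_form_le R σ (hb i) (hb j))
  refine ⟨LinearMap.prod f₁ f₂, fun x => ?_⟩
  refine (prod_form _ _ _ _).trans ?_
  change U₁.form (f₁ x) (f₁ x) + U₂.form (f₂ x) (f₂ x) = _
  rw [show U₁.form (f₁ x) (f₁ x) = M x x from hf₁ x]
  simp [M]

end Existence

end OKLattice

section Count

theorem Nat.le_two_mul_totient_sq {n : ℕ} (hn : n ≠ 0) :
    n ≤ (if Even n then 2 else 1) * n.totient ^ 2 := by
  induction n using Nat.recOnPosPrimePosCoprime with
  | prime_pow p k hp hk =>
    obtain ⟨k, rfl⟩ := Nat.exists_eq_succ_of_ne_zero hk.ne'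
    rw [Nat.totient_prime_pow_succ hp]
    have h2 := hp.two_le
    rcases hp.eq_two_or_odd' with rfl | hodd
    · rw [if_pos (by simp [Nat.even_pow])]
      have : 1 ≤ 2 ^ k := Nat.one_le_two_pow
      simp only [Nat.add_one_sub_one, mul_one, Nat.succ_eq_add_one, pow_succ]
      norm_num
      nlinarith
    · rw [if_neg (by simpa [Nat.even_pow, Nat.not_even_iff_odd] using hodd)]
      obtain ⟨q, rfl⟩ := Nat.exists_eq_add_of_le h2
      have h3 : 1 ≤ q := by
        rcases Nat.eq_zero_or_pos q with rfl | h
        · exact absurd hodd (by decide)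
        · exact h
      have : 1 ≤ (2 + q) ^ k := Nat.one_le_pow _ _ (by omega)
      have e : 2 + q - 1 = q + 1 := by omega
      rw [e, one_mul, pow_succ, mul_pow]
      have h4 : 2 + q ≤ (q + 1) ^ 2 := by nlinarith
      have h5 : (2 + q) ^ k ≤ ((2 + q) ^ k) ^ 2 := by nlinarith
      exact Nat.mul_le_mul h5 h4
  | zero => exact absurd rfl hn
  | one => simp
  | coprime a b ha hb hab iha ihb =>
    rw [Nat.totient_mul hab, mul_pow]
    have iha := iha (by omega)
    have ihb := ihb (by omega)
    have h := Nat.mul_le_mul iha ihb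
    refine h.trans ?_
    rw [mul_mul_mul_comm]
    refine Nat.mul_le_mul_right _ ?_
    by_cases h1 : Even a <;> by_cases h2 : Even b
    · exact absurd (Nat.dvd_gcd h1.two_dvd h2.two_dvd) (by rw [hab]; decide)
    all_goals simp [h1, h2, Nat.even_mul]

theorem Complex.norm_eq_one_of_sq_add_one {u : ℂ} {t : ℝ} (ht : |t| ≤ 2) (h : u ^ 2 + 1 = t * u) :
    ‖u‖ = 1 := by
  have hre := congrArg Complex.re h
  have him := congrArg Complex.im h
  simp [pow_two] at hre him
  have hn : u.re * u.re + u.im * u.im = 1 := by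
    rw [abs_le] at ht
    rcases eq_or_ne u.im 0 with h0 | h0
    · rw [h0] at hre ⊢
      have h1 : (u.re * u.re + 1) ^ 2 ≤ 4 * u.re ^ 2 := by
        have h2 : u.re * u.re + 1 = t * u.re := by linarith
        rw [h2, mul_pow]
        exact mul_le_mul_of_nonneg_right (by nlinarith) (sq_nonneg _)
      have h3 : (u.re * u.re - 1) ^ 2 = 0 := le_antisymm (by nlinarith) (sq_nonneg _)
      have h4 := pow_eq_zero_iff two_ne_zero |>.1 h3
      linarith
    · have h2 : 2 * u.re = t := mul_right_cancel₀ h0 (by linarith)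
      rw [← h2] at hre
      linarith
  rw [← sq_eq_sq₀ (norm_nonneg _) zero_le_one, ← Complex.normSq_eq_norm_sq, Complex.normSq_apply,
    hn, one_pow]

variable {K : Type} [Field K] [NumberField K]

theorem TotallyReal.exists_root_of_unity (hK : TotallyReal K) (φ : K →+* ℂ) {a : K}
    (ha : IsIntegral ℤ a) (hb : ∀ σ : K →+* ℝ, |σ a| ≤ 2) :
    ∃ z : ℂ, ∃ m : ℕ, 0 < m ∧ m ≤ 8 * Module.finrank ℚ K ^ 2 ∧ z ^ m = 1 ∧ φ a = z + z⁻¹ := by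
  obtain ⟨z, hz⟩ : ∃ z : ℂ, z ^ 2 + 1 = φ a * z := by
    obtain ⟨z, hz⟩ := IsAlgClosed.exists_pow_nat_eq ((φ a / 2) ^ 2 - 1) (n := 2) two_pos
    refine ⟨z + φ a / 2, ?_⟩
    linear_combination hz
  have hz0 : z ≠ 0 := by
    rintro rfl
    simp at hz
  have hsum : φ a = z + z⁻¹ := by
    field_simp
    linear_combination -hz
  have haC : IsIntegral ℤ (φ a) := ha.map φ.toIntAlgHom
  have hzi : IsIntegral ℤ z := by
    have h1 : IsIntegral (integralClosure ℤ ℂ) z := by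
      obtain ⟨b, hb⟩ : ∃ b : integralClosure ℤ ℂ, (b : ℂ) = -φ a := ⟨-⟨φ a, haC⟩, rfl⟩
      refine ⟨Polynomial.X ^ 2 + (Polynomial.C b * Polynomial.X + Polynomial.C 1), ?_, ?_⟩
      · exact Polynomial.monic_X_pow_add (Polynomial.degree_linear_le.trans_lt (by norm_num))
      · simp only [Polynomial.eval₂_add, Polynomial.eval₂_mul, Polynomial.eval₂_pow,
          Polynomial.eval₂_X, Polynomial.eval₂_C]
        change z ^ 2 + ((b : ℂ) * z + 1) = 0
        rw [hb]
        linear_combination hz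
    exact isIntegral_trans z h1
  have hzQ : IsIntegral ℚ z := hzi.tower_top
  have : FiniteDimensional ℚ (IntermediateField.adjoin ℚ {z}) :=
    IntermediateField.adjoin.finiteDimensional hzQ
  have : NumberField (IntermediateField.adjoin ℚ {z}) := ⟨⟩
  set E := IntermediateField.adjoin ℚ {z} with hE
  set Z : E := IntermediateField.AdjoinSimple.gen ℚ z with hZ
  have hZz : (Z : ℂ) = z := rfl
  have hroot : ∀ ψ : E →+* ℂ, ‖ψ Z‖ = 1 := by
    intro ψ
    set W : E := Z + Z⁻¹ with hW
    have hWa : (W : ℂ) = φ a := by rw [hsum]; rfl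
    have hrange := NumberField.Embeddings.range_eval_eq_rootSet_minpoly E ℂ W
    have hmem : ψ W ∈ (minpoly ℚ a).rootSet ℂ := by
      rw [← minpoly.algHom_eq φ.toRatAlgHom φ.injective a, RingHom.toRatAlgHom_apply, ← hWa,
        show (W : ℂ) = E.val W from rfl, minpoly.algHom_eq E.val E.val.injective]
      convert (show ψ W ∈ (minpoly ℚ W).rootSet ℂ from hrange ▸ ⟨ψ, rfl⟩)
      exact Subsingleton.elim _ _
    rw [← NumberField.Embeddings.range_eval_eq_rootSet_minpoly] at hmem
    obtain ⟨φ', hφ'⟩ := hmem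
    obtain ⟨σ, hσ⟩ := hK.exists_real φ'
    have hZ0 : ψ Z ≠ 0 := (map_ne_zero ψ).2 fun h => hz0 (hZz ▸ congrArg (fun x : E => (x : ℂ)) h)
    refine Complex.norm_eq_one_of_sq_add_one (hb σ) ?_
    have hφ'' : φ' a = ψ W := hφ'
    rw [← hσ, hφ'', hW, map_add, map_inv₀]
    field_simp
  obtain ⟨k, hk, hk1⟩ := NumberField.Embeddings.pow_eq_one_of_norm_eq_one E ℂ
    (x := Z) (IntermediateField.coe_isIntegral_iff.1 hzi) hroot
  have hzk : z ^ k = 1 := by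
    have := congrArg (fun x : E => (x : ℂ)) hk1
    simpa [← hZz] using this
  have hm : 0 < orderOf z := orderOf_pos_iff.2 (isOfFinOrder_iff_pow_eq_one.2 ⟨k, hk, hzk⟩)
  refine ⟨z, orderOf z, hm, ?_, pow_orderOf_eq_one z, hsum⟩
  have htot : (orderOf z).totient = (minpoly ℚ z).natDegree := by
    rw [← Polynomial.cyclotomic_eq_minpoly_rat (IsPrimitiveRoot.orderOf z) hm,
      Polynomial.natDegree_cyclotomic]
  have hdeg : (minpoly ℚ z).natDegree ≤ 2 * Module.finrank ℚ K := by
    let F : IntermediateField ℚ ℂ := φ.toRatAlgHom.fieldRange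
    have hF : Module.finrank ℚ F = Module.finrank ℚ K :=
      (AlgEquiv.ofInjectiveField φ.toRatAlgHom).toLinearEquiv.finrank_eq.symm
    have hFfin : FiniteDimensional ℚ F :=
      (AlgEquiv.ofInjectiveField φ.toRatAlgHom).toLinearEquiv.finiteDimensional
    have hzF : IsIntegral F z := hzi.tower_top
    have h2 : (minpoly F z).natDegree ≤ 2 := by
      let b : F := ⟨φ a, ⟨a, rfl⟩⟩
      have hmon : (Polynomial.X ^ 2 + (Polynomial.C (-b) * Polynomial.X + Polynomial.C 1)).Monic :=
        Polynomial.monic_X_pow_add (Polynomial.degree_linear_le.trans_lt (by norm_num))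
      refine (Polynomial.natDegree_le_natDegree (minpoly.min F z hmon ?_)).trans ?_
      · simp only [map_add, map_mul, map_pow, Polynomial.aeval_X, Polynomial.aeval_C, map_neg,
          map_one]
        change z ^ 2 + (-(φ a) * z + 1) = 0
        linear_combination hz
      · compute_degree
    have := IntermediateField.adjoin.finiteDimensional hzF
    have := FiniteDimensional.trans ℚ F (IntermediateField.adjoin F {z})
    have h3 := Module.finrank_mul_finrank ℚ F (IntermediateField.adjoin F {z})
    rw [hF, IntermediateField.adjoin.finrank hzF] at h3
    have h4 := minpoly.natDegree_le (A := ℚ) (IntermediateField.AdjoinSimple.gen F z)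
    have h5 : minpoly ℚ (IntermediateField.AdjoinSimple.gen F z) = minpoly ℚ z :=
      (minpoly.algHom_eq ((IntermediateField.adjoin F {z}).val.restrictScalars ℚ)
        (IntermediateField.adjoin F {z}).val.injective _).symm
    rw [h5, ← h3, mul_comm] at h4
    exact h4.trans (Nat.mul_le_mul_right _ h2)
  have h1 := Nat.le_two_mul_totient_sq hm.ne'
  have h2 : (if Even (orderOf z) then 2 else 1) ≤ 2 := by split_ifs <;> norm_num
  calc orderOf z ≤ _ := h1
    _ ≤ 2 * (2 * Module.finrank ℚ K) ^ 2 :=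
      Nat.mul_le_mul h2 (Nat.pow_le_pow_left (htot ▸ hdeg) 2)
    _ = 8 * Module.finrank ℚ K ^ 2 := by ring

theorem TotallyReal.card_le_of_abs_le_two (hK : TotallyReal K) :
    Nat.card {a : 𝓞 K // ∀ σ : K →+* ℝ, |σ a| ≤ 2} ≤ (8 * Module.finrank ℚ K ^ 2) ^ 2 := by
  classical
  obtain ⟨φ⟩ : Nonempty (K →+* ℂ) := inferInstance
  set M := 8 * Module.finrank ℚ K ^ 2 with hM
  choose z m hm0 hm hz hs using fun a : {a : 𝓞 K // ∀ σ : K →+* ℝ, |σ a| ≤ 2} =>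
    hK.exists_root_of_unity φ (RingOfIntegers.isIntegral_coe a.1) a.2
  let T : Finset ℂ :=
    (Finset.range M).biUnion fun k => (Polynomial.nthRoots (k + 1) (1 : ℂ)).toFinset
  have hT : T.card ≤ M ^ 2 := by
    refine (Finset.card_biUnion_le_card_mul _ _ M fun k hk => ?_).trans ?_
    · refine (Multiset.toFinset_card_le _).trans ((Polynomial.card_nthRoots _ _).trans ?_)
      exact Finset.mem_range.1 hk
    · rw [Finset.card_range, sq]
  have hzT : ∀ a, z a ∈ T := by
    intro a
    rw [Finset.mem_biUnion]
    refine ⟨m a - 1, Finset.mem_range.2 (by have := hm a; have := hm0 a; omega), ?_⟩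
    rw [Nat.sub_add_cancel (hm0 a), Multiset.mem_toFinset, Polynomial.mem_nthRoots (hm0 a)]
    exact hz a
  have hinj : Function.Injective fun a => (⟨z a, hzT a⟩ : T) := by
    intro a b h
    have h' : z a = z b := congrArg Subtype.val h
    refine Subtype.ext (RingOfIntegers.ext (φ.injective ?_))
    rw [hs a, hs b, h']
  refine (Nat.card_le_card_of_injective _ hinj).trans ?_
  rw [Nat.card_eq_fintype_card, Fintype.card_coe]
  exact hT

end Count

namespace OKLattice

section DegreeBound

variable {K : Type} [Field K]

/-- The Gram matrix of an overlattice of `⟨2, 2, 2⟩`. -/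
def frameGram (b : 𝓞 K) : Matrix (Fin 3) (Fin 3) (𝓞 K) :=
  !![1 + b + b ^ 2, b, 1 + b; b, 2, 0; 1 + b, 0, 2]

theorem frameGram_apply (b : 𝓞 K) (x y : Fin 3 → 𝓞 K) :
    Matrix.toLinearMap₂' (𝓞 K) (frameGram b) x y =
      (1 + b + b ^ 2) * x 0 * y 0 + b * (x 0 * y 1 + x 1 * y 0) +
        (1 + b) * (x 0 * y 2 + x 2 * y 0) + 2 * x 1 * y 1 + 2 * x 2 * y 2 := by
  rw [Matrix.toLinearMap₂'_apply', frameGram]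
  simp [dotProduct, Matrix.mulVec, Fin.sum_univ_three]
  ring

variable [NumberField K]

theorem finite_abs_le (hK : TotallyReal K) (B : ℝ) :
    Finite {a : 𝓞 K // ∀ σ : K →+* ℝ, |σ a| ≤ B} := by
  have := (hK.finite_bounded B).to_subtype
  refine Finite.of_injective (fun a : {a : 𝓞 K // ∀ σ : K →+* ℝ, |σ a| ≤ B} =>
    (⟨a.1, RingOfIntegers.isIntegral_coe a.1, a.2⟩ :
      {x : K | IsIntegral ℤ x ∧ ∀ σ : K →+* ℝ, |σ x| ≤ B})) fun a b h => ?_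
  exact Subtype.ext (RingOfIntegers.ext (by simpa using h))

theorem card_form_self_eq_two_le (hK : TotallyReal K) (L : OKLattice K) :
    Finite {v : L.carrier // L.form v v = 2} ∧ Nat.card {v : L.carrier // L.form v v = 2} ≤
      Nat.card {a : 𝓞 K // ∀ σ : K →+* ℝ, |σ a| ≤ 2} ^ L.rank := by
  classical
  have := finite_abs_le hK 2
  obtain ⟨σ₀⟩ := hK.nonempty_embedding
  obtain ⟨b, hbU, hspan, hli⟩ := exists_linearIndependent K (L.emb '' {v | L.form v v = 2})
  have := hli.setFinite.fintype
  choose w hw2 hwb using fun u : b => hbU u.2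
  have hb2 : ∀ (v : {v : L.carrier // L.form v v = 2}) (u : b) (σ : K →+* ℝ),
      |σ (L.form v.1 (w u) : K)| ≤ 2 := by
    intro v u σ
    refine L.abs_form_le σ ?_ ?_
    · rw [v.2, ← map_ofNat σ 2]
      exact le_of_eq rfl
    · rw [hw2 u, ← map_ofNat σ 2]
      exact le_of_eq rfl
  have hinj : Function.Injective fun (v : {v : L.carrier // L.form v v = 2}) (u : b) =>
      (⟨L.form v.1 (w u), hb2 v u⟩ : {a : 𝓞 K // ∀ σ : K →+* ℝ, |σ a| ≤ 2}) := by
    intro v v' h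
    have h0 : ∀ u ∈ Submodule.span K b, L.bil (L.emb v.1 - L.emb v'.1) u = 0 := by
      intro u hu
      induction hu using Submodule.span_induction with
      | mem u hu =>
        have h1 := congrArg Subtype.val (congrFun h ⟨u, hu⟩)
        have h2 : L.emb (w ⟨u, hu⟩) = u := hwb ⟨u, hu⟩
        rw [map_sub, LinearMap.sub_apply, ← h2, bil_emb, bil_emb, sub_eq_zero]
        exact congrArg _ h1
      | zero => simp
      | add x y _ _ hx hy => rw [map_add, hx, hy, add_zero]
      | smul a x _ hx => rw [map_smul, hx, smul_zero]
    have h1 : L.emb v.1 - L.emb v'.1 = 0 := by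
      by_contra hne
      have := L.bil_pos hne σ₀
      rw [h0, map_zero] at this
      · exact this.false
      · rw [hspan]
        exact sub_mem (Submodule.subset_span ⟨_, v.2, rfl⟩) (Submodule.subset_span ⟨_, v'.2, rfl⟩)
    exact Subtype.ext (L.emb_injective σ₀ (sub_eq_zero.1 h1))
  refine ⟨Finite.of_injective _ hinj, (Nat.card_le_card_of_injective _ hinj).trans ?_⟩
  rw [Nat.card_fun]
  refine Nat.pow_le_pow_right ?_ ?_
  · have : Nonempty {a : 𝓞 K // ∀ σ : K →+* ℝ, |σ a| ≤ 2} := ⟨⟨0, fun σ => by simp⟩⟩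
    exact Nat.card_pos
  · rw [Nat.card_eq_fintype_card]
    exact hli.fintype_card_le_finrank

theorem exists_frameGram_lattice (b : 𝓞 K) : ∃ (hG : (frameGram b).IsSymm)
    (hpos : ∀ v : Fin 3 → 𝓞 K, v ≠ 0 → ∀ σ : K →+* ℝ,
      0 < σ (algebraMap (𝓞 K) K (Matrix.toLinearMap₂' (𝓞 K) (frameGram b) v v))),
    (ofMatrix (frameGram b) hG hpos).rank = 3 := by
  refine ⟨?_, ?_, rank_ofMatrix _ _ _⟩
  · ext i j
    fin_cases i <;> fin_cases j <;> rfl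
  · intro v hv σ
    have h : (2 : 𝓞 K) * Matrix.toLinearMap₂' (𝓞 K) (frameGram b) v v =
        v 0 * v 0 + (2 * v 1 + b * v 0) * (2 * v 1 + b * v 0) +
          (2 * v 2 + (1 + b) * v 0) * (2 * v 2 + (1 + b) * v 0) := by
      rw [frameGram_apply]; ring
    have h' := congrArg (fun x : 𝓞 K => σ x) h
    simp only [map_mul, map_ofNat, map_add (algebraMap (𝓞 K) K), map_add σ] at h'
    have hne : ∀ x : 𝓞 K, x ≠ 0 → σ (x : K) ≠ 0 := fun x hx =>
      (map_ne_zero σ).2 (RingOfIntegers.coe_ne_zero_iff.2 hx)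
    by_contra! hle
    have h0 : σ (v 0 : K) = 0 := mul_self_eq_zero.1 (by
      nlinarith [mul_self_nonneg (σ (v 0 : K)),
        mul_self_nonneg (2 * σ (v 1 : K) + σ (b : K) * σ (v 0 : K)),
        mul_self_nonneg (2 * σ (v 2 : K) + (σ (algebraMap (𝓞 K) K 1) + σ (b : K)) * σ (v 0 : K))])
    rw [h0] at h'
    have h1 : σ (v 1 : K) = 0 := mul_self_eq_zero.1 (by
      nlinarith [mul_self_nonneg (σ (v 1 : K)), mul_self_nonneg (σ (v 2 : K))])
    have h2 : σ (v 2 : K) = 0 := mul_self_eq_zero.1 (by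
      nlinarith [mul_self_nonneg (σ (v 1 : K)), mul_self_nonneg (σ (v 2 : K))])
    refine hv (funext fun i => ?_)
    by_contra hi
    fin_cases i
    · exact hne _ hi h0
    · exact hne _ hi h1
    · exact hne _ hi h2

theorem two_pow_finrank_le (hK : TotallyReal K) (L : OKLattice K)
    (hL : ∀ M : OKLattice K, M.rank = 3 → L.Represents M) :
    2 ^ Module.finrank ℚ K ≤ Nat.card {v : L.carrier // L.form v v = 2} ^ 3 := by
  have hfin := (card_form_self_eq_two_le hK L).1
  have hex : ∀ b : 𝓞 K, ∃ w f₁ f₂ f₃ : L.carrier,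
      (2 : 𝓞 K) • w = f₁ + b • f₂ + (1 + b) • f₃ ∧ L.form f₁ f₁ = 2 ∧ L.form f₂ f₂ = 2 ∧
      L.form f₃ f₃ = 2 ∧ L.form f₁ f₂ = 0 ∧ L.form f₁ f₃ = 0 ∧ L.form f₂ f₃ = 0 := by
    intro b
    obtain ⟨hG, hpos, hr⟩ := exists_frameGram_lattice b
    obtain ⟨f, hf⟩ := hL _ hr
    have hf' : ∀ x y : Fin 3 → 𝓞 K, L.form (f x) (f y) =
        Matrix.toLinearMap₂' (𝓞 K) (frameGram b) x y := fun x y => form_map_map hf x y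
    refine ⟨f ![1, 0, 0], f ![2, -b, -(1 + b)], f ![0, 1, 0], f ![0, 0, 1], ?_, ?_, ?_, ?_, ?_,
      ?_, ?_⟩
    · let g : (Fin 3 → 𝓞 K) →ₗ[𝓞 K] L.carrier := f
      change (2 : 𝓞 K) • g ![1, 0, 0] =
        g ![2, -b, -(1 + b)] + b • g ![0, 1, 0] + (1 + b) • g ![0, 0, 1]
      rw [← map_smul, ← map_smul, ← map_smul, ← map_add, ← map_add]
      congr 1
      ext i
      fin_cases i <;> simp
    all_goals
      rw [hf', frameGram_apply]
      simp
      try ring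
  choose w f₁ f₂ f₃ hw h11 h22 h33 h12 h13 h23 using hex
  let F : 𝓞 K ⧸ Ideal.span {(2 : 𝓞 K)} → {v : L.carrier // L.form v v = 2} ×
      {v : L.carrier // L.form v v = 2} × {v : L.carrier // L.form v v = 2} :=
    fun q => (⟨f₁ q.out, h11 _⟩, ⟨f₂ q.out, h22 _⟩, ⟨f₃ q.out, h33 _⟩)
  have hF : Function.Injective F := by
    intro q q' h
    obtain ⟨b, hb⟩ : ∃ b, b = q.out := ⟨_, rfl⟩
    obtain ⟨b', hb'⟩ : ∃ b', b' = q'.out := ⟨_, rfl⟩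
    have e1 : f₁ b = f₁ b' := by rw [hb, hb']; exact congrArg (fun x => x.1.1) h
    have e2 : f₂ b = f₂ b' := by rw [hb, hb']; exact congrArg (fun x => x.2.1.1) h
    have e3 : f₃ b = f₃ b' := by rw [hb, hb']; exact congrArg (fun x => x.2.2.1) h
    have hB : L.form ((2 : 𝓞 K) • w b) ((2 : 𝓞 K) • w b') = 4 + 4 * b * b' + 2 * b + 2 * b' := by
      rw [hw, hw, ← e1, ← e2, ← e3]
      simp only [map_add, map_smul, LinearMap.add_apply, LinearMap.smul_apply, h11, h22, h33, h12,
        h13, h23, L.symm (f₂ b) (f₁ b), L.symm (f₃ b) (f₁ b), L.symm (f₃ b) (f₂ b), smul_eq_mul]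
      ring
    simp only [map_smul, LinearMap.smul_apply, smul_eq_mul] at hB
    have h2 : (2 : 𝓞 K) * (b - b') = 2 * (2 * (L.form (w b) (w b') - 1 - b * b' - b')) := by
      linear_combination -hB
    have h3 := mul_left_cancel₀ two_ne_zero h2
    rw [← q.out_eq', ← q'.out_eq']
    exact (Ideal.Quotient.eq).2 (Ideal.mem_span_singleton.2 ⟨_, by rw [← hb, ← hb']; exact h3⟩)
  have h1 := Nat.card_le_card_of_injective F hF
  have h2 : Nat.card (𝓞 K ⧸ Ideal.span {(2 : 𝓞 K)}) = 2 ^ Module.finrank ℚ K := by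
    have h3 := Ideal.absNorm_span_singleton (2 : 𝓞 K)
    rw [Ideal.absNorm_apply, Submodule.cardQuot_apply] at h3
    rw [h3, show (2 : 𝓞 K) = algebraMap ℤ (𝓞 K) 2 by simp, Algebra.norm_algebraMap,
      RingOfIntegers.rank, Int.natAbs_pow]
    rfl
  rw [h2, Nat.card_prod, Nat.card_prod] at h1
  refine h1.trans (le_of_eq (by ring))

theorem exists_degree_bound (R : ℕ) : ∃ D : ℕ, ∀ (K : Type) [Field K] [NumberField K],
    TotallyReal K → ∀ L : OKLattice K, L.rank ≤ R →
    (∀ M : OKLattice K, M.rank = 3 → L.Represents M) → Module.finrank ℚ K ≤ D := by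
  have h := tendsto_pow_const_div_const_pow_of_one_lt (12 * R) (r := (2 : ℝ)) (by norm_num)
  have h2 : ∀ᶠ d : ℕ in Filter.atTop, (d : ℝ) ^ (12 * R) / 2 ^ d < 1 / 8 ^ (6 * R) :=
    h.eventually_lt_const (by positivity)
  obtain ⟨D, hD⟩ := Filter.eventually_atTop.1 h2
  refine ⟨D, fun K _ _ hK L hR hL => ?_⟩
  by_contra! hlt
  set d := Module.finrank ℚ K with hd
  have h3 := hD d hlt.le
  have h4 : 2 ^ d ≤ ((8 * d ^ 2) ^ 2) ^ (R * 3) := by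
    refine (two_pow_finrank_le hK L hL).trans ?_
    rw [pow_mul]
    refine Nat.pow_le_pow_left ((card_form_self_eq_two_le hK L).2.trans ?_) 3
    refine (Nat.pow_le_pow_left hK.card_le_of_abs_le_two _).trans (Nat.pow_le_pow_right ?_ hR)
    have : 0 < d := by omega
    positivity
  have h5 : ((2 : ℝ) ^ d) ≤ ((8 * d ^ 2) ^ 2) ^ (R * 3) := by exact_mod_cast h4
  rw [div_lt_div_iff₀ (by positivity) (by positivity)] at h3
  have h6 : (((8 : ℝ) * d ^ 2) ^ 2) ^ (R * 3) = d ^ (12 * R) * 8 ^ (6 * R) := by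
    rw [← pow_mul, mul_pow, ← pow_mul, mul_comm]
    congr 2 <;> ring
  linarith

end DegreeBound

end OKLattice

namespace OKLattice

section Splitting

variable {K : Type} [Field K]

/-- A sublattice which is an orthogonal summand. -/
def IsSplitting (L : OKLattice K) (N : Submodule (𝓞 K) L.carrier) : Prop :=
  ∀ l, ∃ y ∈ N, ∀ x ∈ N, L.form l x = L.form y x

/-- A nonzero vector which is not a sum of two nonzero orthogonal vectors. -/
def IsIndecomposable (L : OKLattice K) (x : L.carrier) : Prop :=
  x ≠ 0 ∧ ∀ y z, x = y + z → L.form y z = 0 → y = 0 ∨ z = 0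

theorem IsSplitting.mem_or_orthogonal {L : OKLattice K} {N : Submodule (𝓞 K) L.carrier}
    (hN : L.IsSplitting N) {x : L.carrier} (hx : L.IsIndecomposable x) :
    x ∈ N ∨ ∀ y ∈ N, L.form x y = 0 := by
  obtain ⟨y, hy, h⟩ := hN x
  rcases hx.2 y (x - y) (by abel) (by rw [map_sub, L.symm y x, h y hy, sub_self]) with h0 | h0
  · exact Or.inr fun z hz => by rw [h z hz, h0, map_zero, LinearMap.zero_apply]
  · rw [sub_eq_zero.1 h0]
    exact Or.inl hy

variable [NumberField K]

theorem mem_closure_isIndecomposable (hK : TotallyReal K) (L : OKLattice K) (x : L.carrier) :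
    x ∈ AddSubmonoid.closure {x | L.IsIndecomposable x} := by
  have hone : ∀ y, y ≠ 0 → 1 ≤ ∑ σ : K →+* ℝ, σ (L.form y y : K) := fun y hy =>
    hK.one_le_trace (RingOfIntegers.isIntegral_coe _) fun σ => L.posDef y hy σ
  have key : ∀ n : ℕ, ∀ x, ∑ σ : K →+* ℝ, σ (L.form x x : K) ≤ n →
      x ∈ AddSubmonoid.closure {x | L.IsIndecomposable x} := by
    intro n
    induction n with
    | zero =>
      intro x hx
      by_cases h0 : x = 0
      · rw [h0]; exact zero_mem _
      · have := hone x h0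
        norm_num at hx
        linarith
    | succ n ih =>
      intro x hx
      by_cases h0 : x = 0
      · rw [h0]; exact zero_mem _
      by_cases hirr : L.IsIndecomposable x
      · exact AddSubmonoid.subset_closure hirr
      simp only [IsIndecomposable, not_and, not_forall, not_or] at hirr
      obtain ⟨y, z, rfl, hyz, hy, hz⟩ := hirr h0
      have hsum : ∑ σ : K →+* ℝ, σ (L.form (y + z) (y + z) : K) =
          ∑ σ : K →+* ℝ, σ (L.form y y : K) + ∑ σ : K →+* ℝ, σ (L.form z z : K) := by
        rw [← Finset.sum_add_distrib]
        refine Finset.sum_congr rfl fun σ _ => ?_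
        rw [← map_add, ← map_add]
        congr 2
        simp [hyz, L.symm z y]
      have h1 := hone y hy
      have h2 := hone z hz
      push_cast at hx
      exact add_mem (ih y (by linarith)) (ih z (by linarith))
  obtain ⟨n, hn⟩ := exists_nat_ge (∑ σ : K →+* ℝ, σ (L.form x x : K))
  exact key n x hn

theorem exists_separating_isIndecomposable (hK : TotallyReal K) (L : OKLattice K) :
    ∃ b : Finset L.carrier, b.card ≤ L.rank ∧ (∀ x ∈ b, L.IsIndecomposable x) ∧
      ∀ z, (∀ x ∈ b, L.form x z = 0) → z = 0 := by
  classical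
  obtain ⟨σ₀⟩ := hK.nonempty_embedding
  obtain ⟨b, hbU, hspan, hli⟩ := exists_linearIndependent K (L.emb '' {v | L.IsIndecomposable v})
  have := hli.setFinite.fintype
  choose w hw hwb using fun u : b => hbU u.2
  refine ⟨Finset.univ.image w, ?_, ?_, ?_⟩
  · exact Finset.card_image_le.trans hli.fintype_card_le_finrank
  · intro x hx
    obtain ⟨u, -, rfl⟩ := Finset.mem_image.1 hx
    exact hw u
  · intro z hz
    have h0 : ∀ u ∈ Submodule.span K b, L.bil u (L.emb z) = 0 := by
      intro u hu
      induction hu using Submodule.span_induction with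
      | mem u hu =>
        have h2 : L.emb (w ⟨u, hu⟩) = u := hwb ⟨u, hu⟩
        rw [← h2, bil_emb, hz _ (Finset.mem_image_of_mem w (Finset.mem_univ _))]; rfl
      | zero => simp
      | add x y _ _ hx hy => rw [map_add, LinearMap.add_apply, hx, hy, add_zero]
      | smul a x _ hx => rw [map_smul, LinearMap.smul_apply, hx, smul_zero]
    refine L.eq_zero_of_form_self σ₀ (RingOfIntegers.ext ?_)
    have hz' := L.mem_closure_isIndecomposable hK z
    clear hz
    have h1 : L.emb z ∈ Submodule.span K b := by
      rw [hspan]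
      clear h0
      induction hz' using AddSubmonoid.closure_induction with
      | mem x hx => exact Submodule.subset_span ⟨x, hx, rfl⟩
      | zero => rw [map_zero]; exact zero_mem _
      | add x y _ _ hx hy => rw [map_add]; exact add_mem hx hy
    rw [← bil_emb, h0 _ h1]; rfl

/-- The number of orthogonal summands of a lattice is bounded in terms of its rank. -/
theorem card_isSplitting_le (hK : TotallyReal K) (L : OKLattice K) :
    Finite {N // L.IsSplitting N} ∧ Nat.card {N // L.IsSplitting N} ≤ 2 ^ L.rank := by
  classical
  obtain ⟨b, hb, hirr, hsep⟩ := L.exists_separating_isIndecomposable hK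
  have hle : ∀ N N', L.IsSplitting N → L.IsSplitting N' → (∀ x ∈ b, x ∈ N ↔ x ∈ N') → N ≤ N' := by
    intro N N' hN hN' h n hn
    obtain ⟨y, hy, hyn⟩ := hN' n
    have h0 : n - y = 0 := by
      refine hsep _ fun x hx => ?_
      rw [map_sub]
      rcases hN.mem_or_orthogonal (hirr x hx) with h1 | h1
      · rw [L.symm x, L.symm x, hyn x ((h x hx).1 h1), sub_self]
      rcases hN'.mem_or_orthogonal (hirr x hx) with h2 | h2
      · rw [L.symm x, L.symm x, hyn x h2, sub_self]
      · rw [h1 n hn, h2 y hy, sub_self]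
    rw [sub_eq_zero.1 h0]
    exact hy
  have hinj : Function.Injective fun N : {N // L.IsSplitting N} =>
      (⟨b.filter (· ∈ N.1), Finset.mem_powerset.2 (Finset.filter_subset _ _)⟩ : b.powerset) := by
    intro N N' h
    have h' : ∀ x ∈ b, x ∈ N.1 ↔ x ∈ N'.1 := fun x hx => by
      have := congrArg (x ∈ ·) (congrArg Subtype.val h)
      simpa [hx] using this
    exact Subtype.ext (le_antisymm (hle _ _ N.2 N'.2 h')
      (hle _ _ N'.2 N.2 fun x hx => (h' x hx).symm))
  refine ⟨Finite.of_injective _ hinj, (Nat.card_le_card_of_injective _ hinj).trans ?_⟩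
  rw [Nat.card_eq_fintype_card, Fintype.card_coe, Finset.card_powerset]
  exact Nat.pow_le_pow_right two_pos hb

end Splitting

end OKLattice

section Neighbor

/-- `p` times the `p`-neighbour of the standard lattice along `w`. -/
def neighbor {O : Type} [CommRing O] (p : O) (w : Fin 3 → O) : Submodule O (Fin 3 → O) where
  carrier := {y | ∃ (x : Fin 3 → O) (c : O), y = p • x + c • w ∧ p ∣ x ⬝ᵥ w}
  zero_mem' := ⟨0, 0, by simp, by simp⟩
  add_mem' := by
    rintro _ _ ⟨x, c, rfl, h⟩ ⟨x', c', rfl, h'⟩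
    refine ⟨x + x', c + c', by rw [smul_add, add_smul]; abel, ?_⟩
    rw [add_dotProduct]
    exact dvd_add h h'
  smul_mem' := by
    rintro a _ ⟨x, c, rfl, h⟩
    refine ⟨a • x, a * c, by rw [smul_add, smul_comm, mul_smul], ?_⟩
    rw [smul_dotProduct, smul_eq_mul]
    exact h.mul_left a

section

variable {O : Type} [CommRing O] {p : O} {w : Fin 3 → O}

theorem self_mem_neighbor : w ∈ neighbor p w := ⟨0, 1, by simp, by simp⟩

theorem smul_mem_neighbor {x : Fin 3 → O} (h : p ∣ x ⬝ᵥ w) : p • x ∈ neighbor p w :=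
  ⟨x, 0, by simp, h⟩

theorem sq_smul_mem_neighbor (x : Fin 3 → O) : p ^ 2 • x ∈ neighbor p w := by
  rw [sq, mul_smul]
  exact smul_mem_neighbor (by rw [smul_dotProduct]; exact dvd_mul_right _ _)

theorem sq_dvd_dotProduct_of_mem_neighbor (hw : p ^ 2 ∣ w ⬝ᵥ w) {y z : Fin 3 → O}
    (hy : y ∈ neighbor p w) (hz : z ∈ neighbor p w) : p ^ 2 ∣ y ⬝ᵥ z := by
  obtain ⟨x, c, rfl, k, hk⟩ := hy
  obtain ⟨x', c', rfl, k', hk'⟩ := hz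
  obtain ⟨m, hm⟩ := hw
  refine ⟨x ⬝ᵥ x' + c' * k + c * k' + c * c' * m, ?_⟩
  simp only [add_dotProduct, dotProduct_add, smul_dotProduct, dotProduct_smul, smul_eq_mul,
    dotProduct_comm w x', hk, hk', hm]
  ring

variable [IsDomain O]

/-- Neighbours are self-dual. -/
theorem mem_neighbor_of_forall_sq_dvd (hp : p ≠ 0) (hw : p ^ 2 ∣ w ⬝ᵥ w) {u : Fin 3 → O}
    (hu : p ∣ 1 - u ⬝ᵥ w) {g : Fin 3 → O} (hg : ∀ y ∈ neighbor p w, p ^ 2 ∣ g ⬝ᵥ y) :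
    g ∈ neighbor p w := by
  have h1 : ∀ i, p ∣ g i - (g ⬝ᵥ u) * w i := by
    intro i
    have hmem : p • (Pi.single i 1 - w i • u) ∈ neighbor p w := by
      refine smul_mem_neighbor ?_
      rw [sub_dotProduct, smul_dotProduct, single_dotProduct, one_mul, smul_eq_mul]
      obtain ⟨k, hk⟩ := hu
      exact ⟨w i * k, by linear_combination w i * hk⟩
    have h2 := hg _ hmem
    rw [dotProduct_smul, dotProduct_sub, dotProduct_smul, dotProduct_single, mul_one, smul_eq_mul,
      smul_eq_mul, sq] at h2
    have h3 := (mul_dvd_mul_iff_left hp).1 h2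
    rwa [mul_comm (w i)] at h3
  choose x hx using h1
  have hgx : g = p • x + (g ⬝ᵥ u) • w := by
    funext i
    simp only [Pi.add_apply, Pi.smul_apply, smul_eq_mul]
    linear_combination hx i
  refine ⟨x, g ⬝ᵥ u, hgx, ?_⟩
  have h4 := hg w self_mem_neighbor
  rw [hgx, add_dotProduct, smul_dotProduct, smul_dotProduct, smul_eq_mul, smul_eq_mul] at h4
  have h5 := (dvd_add_left (hw.mul_left _)).1 h4
  rw [sq] at h5
  exact (mul_dvd_mul_iff_left hp).1 h5

end

section

variable {O S : Type} [CommRing O] [CommRing S]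

theorem span_neighbor_vecMul (ρ : O →+* S) {p : O} {w w₀ : Fin 3 → O}
    {P : Matrix (Fin 3) (Fin 3) O}
    (hP : ∀ y ∈ neighbor p w, ∃ y' ∈ neighbor p w₀, p ^ 2 • y' = Matrix.vecMul y P)
    {v : Fin 3 → S}
    (hv : v ∈ Submodule.span S ((fun y => ρ ∘ y) '' (neighbor p w : Set (Fin 3 → O)))) :
    ∃ (g : Fin 3 → S) (α : S),
      ρ p ^ 2 • (ρ p • g + α • (ρ ∘ w₀)) = Matrix.vecMul v (P.map ρ) := by
  induction hv using Submodule.span_induction with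
  | mem v hv =>
    obtain ⟨y, hy, rfl⟩ := hv
    obtain ⟨_, ⟨x, c, rfl, -⟩, h⟩ := hP y hy
    refine ⟨ρ ∘ x, ρ c, ?_⟩
    funext i
    rw [← RingHom.map_vecMul, ← h]
    simp
  | zero => exact ⟨0, 0, by simp⟩
  | add v v' _ _ h h' =>
    obtain ⟨g, α, h⟩ := h
    obtain ⟨g', α', h'⟩ := h'
    refine ⟨g + g', α + α', ?_⟩
    rw [Matrix.add_vecMul, ← h, ← h']
    module
  | smul a v _ h =>
    obtain ⟨g, α, h⟩ := h
    refine ⟨a • g, a * α, ?_⟩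
    rw [Matrix.smul_vecMul, ← h]
    module

theorem smul_mem_span_neighbor (ρ : O →+* S) {p : O} {w u : Fin 3 → O}
    (hu : p ∣ 1 - u ⬝ᵥ w) {v : Fin 3 → S} (hv : ρ p ∣ v ⬝ᵥ (ρ ∘ w)) :
    ρ p • v ∈ Submodule.span S ((fun y => ρ ∘ y) '' (neighbor p w : Set (Fin 3 → O))) := by
  obtain ⟨m, hm⟩ := hv
  have hmem : ∀ i, p • (Pi.single i 1 - w i • u) ∈ neighbor p w := by
    intro i
    refine smul_mem_neighbor ?_
    rw [sub_dotProduct, smul_dotProduct, single_dotProduct, one_mul, smul_eq_mul]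
    obtain ⟨k, hk⟩ := hu
    exact ⟨w i * k, by linear_combination w i * hk⟩
  have h : ρ p • v = ∑ i, v i • (ρ ∘ (p • (Pi.single i 1 - w i • u))) +
      m • (ρ ∘ (p ^ 2 • u)) := by
    simp only [dotProduct, Fin.sum_univ_three, Function.comp_apply] at hm
    funext j
    simp only [Fin.sum_univ_three, Pi.add_apply, Pi.smul_apply, Function.comp_apply, smul_eq_mul,
      map_mul, map_sub, map_pow, Pi.sub_apply]
    fin_cases j <;> simp
    · linear_combination ρ p * ρ (u 0) * hm
    · linear_combination ρ p * ρ (u 1) * hm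
    · linear_combination ρ p * ρ (u 2) * hm
  rw [h]
  refine add_mem (sum_mem fun i _ => Submodule.smul_mem _ _ (Submodule.subset_span ?_))
    (Submodule.smul_mem _ _ (Submodule.subset_span ?_))
  · exact ⟨_, hmem i, rfl⟩
  · exact ⟨_, sq_smul_mem_neighbor u, rfl⟩

variable [IsDomain S]

/-- A matrix invariant under two homomorphisms which carries one neighbour to another is integral,
provided the homomorphisms separate the neighbours modulo `p`. -/
theorem sq_dvd_of_neighbor_vecMul (ρ₁ ρ₂ : O →+* S) {p : O} (hp : ρ₁ p ≠ 0) (hpp : ρ₁ p = ρ₂ p)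
    {w w₀ u : Fin 3 → O} {P : Matrix (Fin 3) (Fin 3) O}
    (hP : ∀ y ∈ neighbor p w, ∃ y' ∈ neighbor p w₀, p ^ 2 • y' = Matrix.vecMul y P)
    (hρ : P.map ρ₁ = P.map ρ₂) (hw : p ∣ w ⬝ᵥ w) (hw₀ : p ∣ w₀ ⬝ᵥ w₀) (hu : p ∣ 1 - u ⬝ᵥ w)
    {γ γ₀ : S} (hγ : ρ₁ p ∣ 1 - γ * ((ρ₁ ∘ w) ⬝ᵥ (ρ₂ ∘ w)))
    (hγ₀ : ρ₁ p ∣ 1 - γ₀ * ((ρ₁ ∘ w₀) ⬝ᵥ (ρ₂ ∘ w₀))) (i j : Fin 3) :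
    ρ₁ p ^ 2 ∣ ρ₁ (P i j) := by
  set q := ρ₁ p with hq
  have hq2 : q ^ 2 ≠ 0 := pow_ne_zero 2 hp
  have hself : ∀ ρ : O →+* S, ρ p = q → P.map ρ = P.map ρ₁ →
      ∃ g : Fin 3 → S, q ^ 2 • g = Matrix.vecMul (ρ ∘ w) (P.map ρ₁) := by
    intro ρ h1 h2
    obtain ⟨g, α, h⟩ := span_neighbor_vecMul ρ hP
      (Submodule.subset_span ⟨w, self_mem_neighbor, rfl⟩)
    rw [h1, h2] at h
    exact ⟨_, h⟩
  have horth : ∀ v : Fin 3 → S, q ∣ v ⬝ᵥ (ρ₁ ∘ w) → q ∣ v ⬝ᵥ (ρ₂ ∘ w) →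
      ∃ g : Fin 3 → S, q ^ 2 • g = Matrix.vecMul v (P.map ρ₁) := by
    intro v h1 h2
    obtain ⟨g₁, α₁, e₁⟩ := span_neighbor_vecMul ρ₁ hP (smul_mem_span_neighbor ρ₁ hu h1)
    obtain ⟨g₂, α₂, e₂⟩ := span_neighbor_vecMul ρ₂ hP
      (smul_mem_span_neighbor ρ₂ hu (by rw [← hpp]; exact h2))
    rw [← hq] at e₁
    rw [← hpp, ← hρ, ← e₁] at e₂
    have e₃ := smul_right_injective _ hq2 e₂
    have hQ : q ∣ (ρ₂ ∘ w₀) ⬝ᵥ (ρ₂ ∘ w₀) := by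
      have := map_dvd ρ₂ hw₀
      rwa [RingHom.map_dotProduct, ← hpp] at this
    have hα : q ∣ α₁ := by
      have e₄ := congrArg (· ⬝ᵥ (ρ₂ ∘ w₀)) e₃
      simp only [add_dotProduct, smul_dotProduct, smul_eq_mul] at e₄
      have h3 : q ∣ α₁ * ((ρ₁ ∘ w₀) ⬝ᵥ (ρ₂ ∘ w₀)) := by
        obtain ⟨m, hm⟩ := hQ
        exact ⟨g₂ ⬝ᵥ (ρ₂ ∘ w₀) + α₂ * m - g₁ ⬝ᵥ (ρ₂ ∘ w₀), by
          linear_combination -e₄ + α₂ * hm⟩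
      obtain ⟨m, hm⟩ := h3
      obtain ⟨k, hk⟩ := hγ₀
      exact ⟨α₁ * k + γ₀ * m, by linear_combination α₁ * hk + γ₀ * hm⟩
    obtain ⟨β, rfl⟩ := hα
    refine ⟨g₁ + β • (ρ₁ ∘ w₀), smul_right_injective _ hp ?_⟩
    change q • _ = q • _
    rw [Matrix.smul_vecMul] at e₁
    rw [← e₁]
    module
  obtain ⟨g₁, e₁⟩ := hself ρ₁ rfl rfl
  obtain ⟨g₂, e₂⟩ := hself ρ₂ hpp.symm hρ.symm
  have hQ₁ : q ∣ (ρ₁ ∘ w) ⬝ᵥ (ρ₁ ∘ w) := by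
    have := map_dvd ρ₁ hw
    rwa [RingHom.map_dotProduct] at this
  have hQ₂ : q ∣ (ρ₂ ∘ w) ⬝ᵥ (ρ₂ ∘ w) := by
    have := map_dvd ρ₂ hw
    rwa [RingHom.map_dotProduct, ← hpp] at this
  obtain ⟨m₁, hm₁⟩ := hQ₁
  obtain ⟨m₂, hm₂⟩ := hQ₂
  obtain ⟨k, hk⟩ := hγ
  obtain ⟨g, e⟩ := horth (Pi.single i 1 - (γ * ρ₂ (w i)) • (ρ₁ ∘ w) - (γ * ρ₁ (w i)) • (ρ₂ ∘ w))
    (by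
      refine ⟨ρ₁ (w i) * k - γ * ρ₂ (w i) * m₁, ?_⟩
      rw [sub_dotProduct, sub_dotProduct, smul_dotProduct, smul_dotProduct, single_dotProduct,
        hm₁, dotProduct_comm (ρ₂ ∘ w)]
      simp only [smul_eq_mul, Function.comp_apply]
      linear_combination ρ₁ (w i) * hk)
    (by
      refine ⟨ρ₂ (w i) * k - γ * ρ₁ (w i) * m₂, ?_⟩
      rw [sub_dotProduct, sub_dotProduct, smul_dotProduct, smul_dotProduct, single_dotProduct,
        hm₂]
      simp only [smul_eq_mul, Function.comp_apply]
      linear_combination ρ₂ (w i) * hk)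
  rw [Matrix.sub_vecMul, Matrix.sub_vecMul, Matrix.smul_vecMul, Matrix.smul_vecMul, ← e₁, ← e₂,
    Matrix.single_one_vecMul] at e
  have e' := congrFun e j
  simp only [Pi.sub_apply, Pi.smul_apply, smul_eq_mul, Matrix.row_apply, Matrix.map_apply] at e'
  exact ⟨g j + γ * ρ₂ (w i) * g₁ j + γ * ρ₁ (w i) * g₂ j, by linear_combination -e'⟩

end

end Neighbor

namespace OKLattice

section NeighborLattice

variable {K : Type} [Field K]

/-- The unimodular lattice obtained by scaling `neighbor p w`. -/
def neighborLattice [NumberField K] (p : 𝓞 K) (w : Fin 3 → 𝓞 K) (hp : p ≠ 0)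
    (hw : p ^ 2 ∣ w ⬝ᵥ w) : OKLattice K where
  carrier := neighbor p w
  torsionFree := ⟨fun {c x} h => by
    rw [Subtype.ext_iff, Submodule.coe_smul] at h
    exact (smul_eq_zero.1 h).imp_right Subtype.ext⟩
  form :=
    LinearMap.mk₂ (𝓞 K) (fun y z => (sq_dvd_dotProduct_of_mem_neighbor hw y.2 z.2).choose)
      (fun y y' z => mul_left_cancel₀ (pow_ne_zero 2 hp) (by
        rw [mul_add, ← (sq_dvd_dotProduct_of_mem_neighbor hw y.2 z.2).choose_spec,
          ← (sq_dvd_dotProduct_of_mem_neighbor hw y'.2 z.2).choose_spec,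
          ← (sq_dvd_dotProduct_of_mem_neighbor hw (y + y').2 z.2).choose_spec,
          Submodule.coe_add, add_dotProduct]))
      (fun c y z => mul_left_cancel₀ (pow_ne_zero 2 hp) (by
        rw [mul_smul_comm, ← (sq_dvd_dotProduct_of_mem_neighbor hw y.2 z.2).choose_spec,
          ← (sq_dvd_dotProduct_of_mem_neighbor hw (c • y).2 z.2).choose_spec,
          Submodule.coe_smul, smul_dotProduct]))
      (fun y z z' => mul_left_cancel₀ (pow_ne_zero 2 hp) (by
        rw [mul_add, ← (sq_dvd_dotProduct_of_mem_neighbor hw y.2 z.2).choose_spec,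
          ← (sq_dvd_dotProduct_of_mem_neighbor hw y.2 z'.2).choose_spec,
          ← (sq_dvd_dotProduct_of_mem_neighbor hw y.2 (z + z').2).choose_spec,
          Submodule.coe_add, dotProduct_add]))
      (fun c y z => mul_left_cancel₀ (pow_ne_zero 2 hp) (by
        rw [mul_smul_comm, ← (sq_dvd_dotProduct_of_mem_neighbor hw y.2 z.2).choose_spec,
          ← (sq_dvd_dotProduct_of_mem_neighbor hw y.2 (c • z).2).choose_spec,
          Submodule.coe_smul, dotProduct_smul]))
  symm y z := mul_left_cancel₀ (pow_ne_zero 2 hp) (by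
    rw [LinearMap.mk₂_apply, LinearMap.mk₂_apply,
      ← (sq_dvd_dotProduct_of_mem_neighbor hw y.2 z.2).choose_spec,
      ← (sq_dvd_dotProduct_of_mem_neighbor hw z.2 y.2).choose_spec, dotProduct_comm])
  posDef v hv σ := by
    rw [LinearMap.mk₂_apply]
    have h := congrArg (fun x : 𝓞 K => σ x)
      (sq_dvd_dotProduct_of_mem_neighbor hw v.2 v.2).choose_spec
    simp only [map_mul, map_pow, dotProduct, map_sum] at h
    have hv' : v.1 ≠ 0 := fun h => hv (Subtype.ext h)
    obtain ⟨i, hi⟩ := Function.ne_iff.1 hv'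
    have hpos : 0 < ∑ i, σ (v.1 i : K) * σ (v.1 i : K) :=
      Finset.sum_pos' (fun _ _ => mul_self_nonneg _) ⟨i, Finset.mem_univ i,
        mul_self_pos.2 ((map_ne_zero σ).2 (RingOfIntegers.coe_ne_zero_iff.2 hi))⟩
    rw [h] at hpos
    exact pos_of_mul_pos_right hpos (sq_nonneg _)

variable [NumberField K] {p : 𝓞 K} {w : Fin 3 → 𝓞 K} {hp : p ≠ 0} {hw : p ^ 2 ∣ w ⬝ᵥ w}

theorem sq_mul_neighborLattice_form (y z : neighbor p w) :
    p ^ 2 * (neighborLattice p w hp hw).form y z = y.1 ⬝ᵥ z.1 :=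
  (sq_dvd_dotProduct_of_mem_neighbor hw y.2 z.2).choose_spec.symm

theorem rank_neighborLattice : (neighborLattice p w hp hw).rank = 3 := by
  have hp' : (p : K) ^ 2 ≠ 0 := pow_ne_zero 2 (RingOfIntegers.coe_ne_zero_iff.2 hp)
  rw [rank_eq_finrank _ (W := Fin 3 → K) (show neighbor p w →ₗ[𝓞 K] Fin 3 → K from
    LinearMap.compLeft (Algebra.linearMap (𝓞 K) K) (Fin 3) ∘ₗ (neighbor p w).subtype)]
  · simp
  · intro x y h
    refine Subtype.ext (funext fun i => RingOfIntegers.ext (congrFun h i))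
  · rw [eq_top_iff, ← (Pi.basisFun K (Fin 3)).span_eq, Submodule.span_le]
    rintro _ ⟨i, rfl⟩
    have h : Pi.basisFun K (Fin 3) i = ((p : K) ^ 2)⁻¹ • (show neighbor p w →ₗ[𝓞 K] Fin 3 → K from
        LinearMap.compLeft (Algebra.linearMap (𝓞 K) K) (Fin 3) ∘ₗ (neighbor p w).subtype)
          ⟨p ^ 2 • Pi.single i 1, sq_smul_mem_neighbor _⟩ := by
      funext j
      change _ = ((p : K) ^ 2)⁻¹ * algebraMap (𝓞 K) K (p ^ 2 * (Pi.single i 1 : Fin 3 → 𝓞 K) j)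
      rw [map_mul, map_pow, inv_mul_cancel_left₀ hp']
      by_cases h : j = i
      · subst h; simp
      · simp [h]
    rw [h]
    exact Submodule.smul_mem _ _ (Submodule.subset_span ⟨_, rfl⟩)

theorem exists_eq_form_neighborLattice {u : Fin 3 → 𝓞 K} (hu : p ∣ 1 - u ⬝ᵥ w)
    (ℓ : neighbor p w →ₗ[𝓞 K] 𝓞 K) :
    ∃ g : neighbor p w, ∀ y, ℓ y = (neighborLattice p w hp hw).form g y := by
  set e : Fin 3 → neighbor p w := fun i => ⟨p ^ 2 • Pi.single i 1, sq_smul_mem_neighbor _⟩ with he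
  have hℓ : ∀ y : neighbor p w, p ^ 2 * ℓ y = (fun i => ℓ (e i)) ⬝ᵥ y.1 := by
    intro y
    have h : p ^ 2 • y = ∑ i, y.1 i • e i := by
      refine Subtype.ext (funext fun j => ?_)
      simp only [Fin.sum_univ_three, he, Submodule.coe_add, Submodule.coe_smul, Pi.add_apply,
        Pi.smul_apply, smul_eq_mul]
      fin_cases j <;> simp [mul_comm]
    rw [← smul_eq_mul, ← map_smul, h, map_sum]
    simp [dotProduct, mul_comm]
  refine ⟨⟨fun i => ℓ (e i), mem_neighbor_of_forall_sq_dvd hp hw hu fun y hy =>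
    ⟨_, (hℓ ⟨y, hy⟩).symm⟩⟩, fun y => mul_left_cancel₀ (pow_ne_zero 2 hp) ?_⟩
  rw [hℓ, sq_mul_neighborLattice_form]

theorem isSplitting_range {u : Fin 3 → 𝓞 K} (hu : p ∣ 1 - u ⬝ᵥ w) {L : OKLattice K}
    {f : neighbor p w →ₗ[𝓞 K] L.carrier}
    (hf : ∀ x, L.form (f x) (f x) = (neighborLattice p w hp hw).form x x) :
    L.IsSplitting (LinearMap.range f) := by
  intro l
  obtain ⟨g, hg⟩ := exists_eq_form_neighborLattice (hp := hp) (hw := hw) hu (L.form l ∘ₗ f)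
  refine ⟨f g, ⟨g, rfl⟩, ?_⟩
  rintro _ ⟨y, rfl⟩
  exact (hg y).trans (form_map_map (M := neighborLattice p w hp hw) hf g y).symm

/-- The matrix comparing two neighbours with the same image. -/
theorem exists_matrix_of_range_eq {L : OKLattice K} {w₀ : Fin 3 → 𝓞 K} {hw₀ : p ^ 2 ∣ w₀ ⬝ᵥ w₀}
    {f : neighbor p w →ₗ[𝓞 K] L.carrier} {f₀ : neighbor p w₀ →ₗ[𝓞 K] L.carrier}
    (hf : ∀ x, L.form (f x) (f x) = (neighborLattice p w hp hw).form x x)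
    (hf₀ : ∀ x, L.form (f₀ x) (f₀ x) = (neighborLattice p w₀ hp hw₀).form x x)
    (hr : LinearMap.range f = LinearMap.range f₀) :
    ∃ P : Matrix (Fin 3) (Fin 3) (𝓞 K),
      (∀ y ∈ neighbor p w, ∃ y' ∈ neighbor p w₀, p ^ 2 • y' = Matrix.vecMul y P) ∧
      (∀ y, y ∈ neighbor p w ↔ ∃ y' ∈ neighbor p w₀, p ^ 2 • y = Matrix.mulVec P y') ∧
      ∀ (σ : K →+* ℝ) i j, |σ (P i j)| ≤ σ (p ^ 2 : 𝓞 K) := by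
  have hp2 : p ^ 2 ≠ 0 := pow_ne_zero 2 hp
  set e : Fin 3 → neighbor p w := fun i => ⟨p ^ 2 • Pi.single i 1, sq_smul_mem_neighbor _⟩ with he
  set e₀ : Fin 3 → neighbor p w₀ := fun i => ⟨p ^ 2 • Pi.single i 1, sq_smul_mem_neighbor _⟩
    with he₀
  have hexp : ∀ y : neighbor p w, p ^ 2 • y = ∑ i, y.1 i • e i := fun y => by
    refine Subtype.ext (funext fun j => ?_)
    simp only [Fin.sum_univ_three, he, Submodule.coe_add, Submodule.coe_smul, Pi.add_apply,
      Pi.smul_apply, smul_eq_mul]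
    fin_cases j <;> simp [mul_comm]
  have hexp₀ : ∀ y : neighbor p w₀, p ^ 2 • y = ∑ i, y.1 i • e₀ i := fun y => by
    refine Subtype.ext (funext fun j => ?_)
    simp only [Fin.sum_univ_three, he₀, Submodule.coe_add, Submodule.coe_smul, Pi.add_apply,
      Pi.smul_apply, smul_eq_mul]
    fin_cases j <;> simp [mul_comm]
  have hform : ∀ y i, L.form (f y) (f (e i)) = y.1 i := fun y i =>
    mul_left_cancel₀ hp2 <| (congrArg (p ^ 2 * ·)
      (form_map_map (M := neighborLattice p w hp hw) hf y (e i))).trans <|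
        (sq_mul_neighborLattice_form y (e i)).trans (by simp [he])
  have hform₀ : ∀ y i, L.form (f₀ y) (f₀ (e₀ i)) = y.1 i := fun y i =>
    mul_left_cancel₀ hp2 <| (congrArg (p ^ 2 * ·)
      (form_map_map (M := neighborLattice p w₀ hp hw₀) hf₀ y (e₀ i))).trans <|
        (sq_mul_neighborLattice_form y (e₀ i)).trans (by simp [he₀])
  set P : Matrix (Fin 3) (Fin 3) (𝓞 K) := Matrix.of fun i j => L.form (f (e i)) (f₀ (e₀ j)) with hP
  have h1 : ∀ (y : neighbor p w) (y' : neighbor p w₀), f y = f₀ y' →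
      p ^ 2 • y'.1 = Matrix.vecMul y.1 P := by
    intro y y' h
    funext j
    rw [Pi.smul_apply, ← hform₀ y' j, ← h, ← LinearMap.smul_apply, ← map_smul, ← map_smul, hexp]
    simp [Matrix.vecMul, dotProduct, hP]
  have h2 : ∀ (y : neighbor p w) (y' : neighbor p w₀), f y = f₀ y' →
      p ^ 2 • y.1 = Matrix.mulVec P y'.1 := by
    intro y y' h
    funext i
    rw [Pi.smul_apply, ← hform y i, h, ← LinearMap.smul_apply, ← map_smul, ← map_smul, hexp₀]
    simp [Matrix.mulVec, dotProduct, hP, L.symm (f (e i)), mul_comm]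
  refine ⟨P, fun y hy => ?_, fun y => ⟨fun hy => ?_, ?_⟩, fun σ i j => ?_⟩
  · obtain ⟨y', hy'⟩ : f ⟨y, hy⟩ ∈ LinearMap.range f₀ := hr ▸ ⟨_, rfl⟩
    exact ⟨y'.1, y'.2, h1 _ _ hy'.symm⟩
  · obtain ⟨y', hy'⟩ : f ⟨y, hy⟩ ∈ LinearMap.range f₀ := hr ▸ ⟨_, rfl⟩
    exact ⟨y'.1, y'.2, h2 _ _ hy'.symm⟩
  · rintro ⟨y', hy', h⟩
    obtain ⟨z, hz⟩ : f₀ ⟨y', hy'⟩ ∈ LinearMap.range f := hr ▸ ⟨_, rfl⟩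
    rw [← h2 _ _ hz] at h
    rw [smul_right_injective _ hp2 h]
    exact z.2
  · refine L.abs_form_le σ ?_ ?_
    · rw [hform]; simp [he]
    · rw [hform₀]; simp [he₀]

end NeighborLattice

end OKLattice

section Family

variable {O : Type} [CommRing O]

/-- A parametrised isotropic vector for the sum of three squares modulo `a ^ 2 + b ^ 2 + 1`. -/
def isoVec (a b : ℤ) (t : O) : Fin 3 → O :=
  ![1 + t ^ 2, a * (1 - t ^ 2) + 2 * b * t, b * (1 - t ^ 2) - 2 * a * t]

theorem isoVec_dotProduct (a b : ℤ) (t s : O) : isoVec a b t ⬝ᵥ isoVec a b s =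
    2 * (t - s) ^ 2 + ((a ^ 2 + b ^ 2 + 1 : ℤ) : O) * ((1 - t ^ 2) * (1 - s ^ 2) + 4 * t * s) := by
  simp [isoVec, dotProduct, Fin.sum_univ_three]
  ring

theorem dotProduct_isoVec (a b m : ℤ) (t : O) : ![(m : O), -m * a, -m * b] ⬝ᵥ isoVec a b t =
    2 * m - ((a ^ 2 + b ^ 2 + 1 : ℤ) : O) * (m * (1 - t ^ 2)) := by
  simp [isoVec, dotProduct, Fin.sum_univ_three]
  ring

theorem RingHom.comp_isoVec {S : Type} [CommRing S] (ρ : O →+* S) (a b : ℤ) (t : O) :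
    ρ ∘ isoVec a b t = isoVec a b (ρ t) := by
  funext i
  have h2 : ρ 2 = 2 := map_ofNat ρ 2
  fin_cases i <;> simp [isoVec, h2]

end Family

section Separation

variable {K : Type} [Field K] [NumberField K]

theorem Int.dvd_of_natCast_dvd_intCast {p : ℕ} (hp : p.Prime) {z : ℤ}
    (h : (p : 𝓞 K) ∣ (z : 𝓞 K)) : (p : ℤ) ∣ z := by
  have h1 := map_dvd (Algebra.norm ℤ) h
  rw [show (p : 𝓞 K) = algebraMap ℤ (𝓞 K) p by simp, show (z : 𝓞 K) = algebraMap ℤ (𝓞 K) z by simp,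
    Algebra.norm_algebraMap, Algebra.norm_algebraMap, RingOfIntegers.rank] at h1
  exact (Nat.prime_iff_prime_int.1 hp).dvd_of_dvd_pow
    ((dvd_pow_self _ Module.finrank_pos.ne').trans h1)

section

variable {K : Type} [Field K]

/-- An embedding, on integers. -/
def integerHom (σ : K →+* ℝ) : 𝓞 K →+* integralClosure ℤ ℝ :=
  (σ.comp (algebraMap (𝓞 K) K)).codRestrict (integralClosure ℤ ℝ)
    fun x => (RingOfIntegers.isIntegral_coe x).map σ.toIntAlgHom

theorem coe_integerHom (σ : K →+* ℝ) (x : 𝓞 K) : (integerHom σ x : ℝ) = σ x := rfl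

end

theorem natCast_dvd_of_integerHom (σ : K →+* ℝ) {n : ℕ} (hn : n ≠ 0) {x : 𝓞 K}
    (h : integerHom σ n ∣ integerHom σ x) : (n : 𝓞 K) ∣ x := by
  obtain ⟨z, hz⟩ := h
  have hz' : σ x = n * (z : ℝ) := by
    rw [← coe_integerHom, hz]
    simp
  have hn' : (n : ℝ) ≠ 0 := Nat.cast_ne_zero.2 hn
  have hnK : (n : K) ≠ 0 := Nat.cast_ne_zero.2 hn
  have h1 : IsIntegral ℤ ((x : K) / n) := by
    refine (isIntegral_algHom_iff σ.toIntAlgHom σ.injective).1 ?_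
    have : σ.toIntAlgHom ((x : K) / n) = z := by
      change σ ((x : K) / n) = z
      rw [map_div₀, map_natCast, hz', mul_div_cancel_left₀ _ hn']
    rw [this]
    exact z.2
  obtain ⟨X, hX⟩ : ∃ X : 𝓞 K, algebraMap (𝓞 K) K X = (x : K) / n := ⟨⟨_, h1⟩, rfl⟩
  refine ⟨X, RingOfIntegers.ext ?_⟩
  change (x : K) = algebraMap (𝓞 K) K (n * X)
  rw [map_mul, map_natCast, hX, mul_div_cancel₀ _ hnK]

theorem exists_sq_add_sq_add_one {p : ℕ} (hp : p.Prime) (hodd : Odd p) :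
    ∃ a b : ℤ, (p : ℤ) ^ 2 ∣ a ^ 2 + b ^ 2 + 1 := by
  have := Fact.mk hp
  obtain ⟨a, b, k, -, -, h⟩ := Int.exists_sq_add_sq_add_one_eq_mul p
  have hpp := Nat.prime_iff_prime_int.1 hp
  have h' : (a : ℤ) ^ 2 + (b : ℤ) ^ 2 + 1 = k * p := by exact_mod_cast h
  have lift : ∀ a b : ℤ, a ^ 2 + b ^ 2 + 1 = k * p → ¬ (p : ℤ) ∣ a →
      ∃ a b : ℤ, (p : ℤ) ^ 2 ∣ a ^ 2 + b ^ 2 + 1 := by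
    intro a b h ha
    have h2 : ¬ (p : ℤ) ∣ 2 * a := fun hd => (hpp.dvd_or_dvd hd).elim (fun h2 => by
      have h3 := Nat.le_of_dvd two_pos (show p ∣ 2 by exact_mod_cast h2)
      have := hp.two_le
      obtain ⟨m, hm⟩ := hodd
      omega) ha
    obtain ⟨u, v, huv⟩ := (hpp.coprime_iff_not_dvd.2 h2).symm
    refine ⟨a - p * (k * u), b, k * v + (k * u) ^ 2, ?_⟩
    linear_combination h - p * k * huv
  by_cases ha : (p : ℤ) ∣ a
  · by_cases hb : (p : ℤ) ∣ b
    · refine absurd ?_ hpp.not_dvd_one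
      rw [show (1 : ℤ) = k * p - a ^ 2 - b ^ 2 by linear_combination h']
      exact dvd_sub (dvd_sub (dvd_mul_left _ _) (dvd_pow ha two_ne_zero)) (dvd_pow hb two_ne_zero)
    · exact lift b a (by linear_combination h') hb
  · exact lift a b h' ha

/-- Lattices representing all ternary lattices separate embeddings at all small primes. -/
theorem OKLattice.false_of_agree (hK : TotallyReal K) (L : OKLattice K) {R : ℕ} (hR : L.rank ≤ R)
    (hL : ∀ M : OKLattice K, M.rank = 3 → L.Represents M) {p : ℕ} (hp : p.Prime) (hodd : Odd p)
    (hpR : 2 ^ R * 3 ^ 9 < p) (σ₁ σ₂ : K →+* ℝ)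
    (hσ : ∀ x : 𝓞 K, (∀ σ : K →+* ℝ, |σ x| ≤ p ^ 2) → σ₁ x = σ₂ x) (t : 𝓞 K) {y k : ℝ}
    (hy : IsIntegral ℤ y) (hk : IsIntegral ℤ k) (ht : 1 - (σ₁ t - σ₂ t) * y = p * k) : False := by
  classical
  obtain ⟨a, b, n, hab⟩ := exists_sq_add_sq_add_one hp hodd
  obtain ⟨m, hm⟩ := hodd
  have hp0 : (p : 𝓞 K) ≠ 0 := Nat.cast_ne_zero.2 hp.ne_zero
  set w : ℕ → Fin 3 → 𝓞 K := fun c => isoVec a b (t + c) with hw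
  set u : Fin 3 → 𝓞 K := ![((m + 1 : ℤ) : 𝓞 K), -((m + 1 : ℤ) : 𝓞 K) * a, -((m + 1 : ℤ) : 𝓞 K) * b]
    with hu
  have hww : ∀ c, (p : 𝓞 K) ^ 2 ∣ w c ⬝ᵥ w c := fun c => by
    rw [hw, isoVec_dotProduct, hab]
    push_cast
    exact ⟨_, by rw [sub_self, zero_pow two_ne_zero, mul_zero, zero_add, mul_assoc]⟩
  have huw : ∀ c, (p : 𝓞 K) ∣ 1 - u ⬝ᵥ w c := fun c => by
    rw [hw, hu, dotProduct_isoVec, hab]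
    refine ⟨p * n * ((m + 1) * (1 - (t + c) ^ 2)) - 1, ?_⟩
    have : (p : 𝓞 K) = 2 * m + 1 := by rw [hm]; push_cast; ring
    push_cast
    rw [this]
    ring
  obtain ⟨γ, hγ⟩ : ∃ γ : integralClosure ℤ ℝ, ∀ c, integerHom σ₁ p ∣
      1 - γ * ((integerHom σ₁ ∘ w c) ⬝ᵥ (integerHom σ₂ ∘ w c)) := by
    obtain ⟨Y, rfl⟩ : ∃ Y : integralClosure ℤ ℝ, (Y : ℝ) = y := ⟨⟨y, hy⟩, rfl⟩
    obtain ⟨k, rfl⟩ : ∃ Y : integralClosure ℤ ℝ, (Y : ℝ) = k := ⟨⟨k, hk⟩, rfl⟩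
    have ht' : 1 - (integerHom σ₁ t - integerHom σ₂ t) * Y = p * k :=
      Subtype.ext (by simpa [coe_integerHom] using ht)
    refine ⟨(m + 1) * Y ^ 2, fun c => ?_⟩
    rw [hw, RingHom.comp_isoVec, RingHom.comp_isoVec, isoVec_dotProduct, hab]
    have : (p : integralClosure ℤ ℝ) = 2 * m + 1 := by rw [hm]; push_cast; ring
    simp only [map_add, map_natCast, add_sub_add_right_eq_sub]
    push_cast
    set q := (p : integralClosure ℤ ℝ)
    set δ := integerHom σ₁ t - integerHom σ₂ t
    set E := (1 - (integerHom σ₁ t + (c : integralClosure ℤ ℝ)) ^ 2) *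
      (1 - (integerHom σ₂ t + (c : integralClosure ℤ ℝ)) ^ 2) +
        4 * (integerHom σ₁ t + (c : integralClosure ℤ ℝ)) * (integerHom σ₂ t + c)
    refine ⟨2 * k - q * k ^ 2 - (1 - q * k) ^ 2 - (m + 1) * Y ^ 2 * (q * n * E), ?_⟩
    have h3 : δ * Y = 1 - q * k := by linear_combination -ht'
    have h4 : (2 * m + 2 : integralClosure ℤ ℝ) * (δ * Y) ^ 2 = (q + 1) * (1 - q * k) ^ 2 := by
      rw [h3, this]; ring
    linear_combination -h4
  choose f hf using fun c => hL (OKLattice.neighborLattice (p : 𝓞 K) (w c) hp0 (hww c))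
    OKLattice.rank_neighborLattice
  have hfin := (L.card_isSplitting_le hK).1
  have := Fintype.ofFinite {N // L.IsSplitting N}
  let F : Fin p → {N // L.IsSplitting N} := fun c =>
    ⟨LinearMap.range (f c), OKLattice.isSplitting_range (huw c) (hf c)⟩
  obtain ⟨N, hN⟩ := Fintype.exists_lt_card_fiber_of_mul_lt_card F (n := 3 ^ 9) (by
    rw [Fintype.card_fin, ← Nat.card_eq_fintype_card]
    exact (Nat.mul_le_mul_right _ ((L.card_isSplitting_le hK).2.trans
      (Nat.pow_le_pow_right two_pos hR))).trans_lt hpR)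
  obtain ⟨c₀, hc₀⟩ := Finset.card_pos.1 (Nat.zero_lt_of_lt hN)
  have hc₀' := congrArg Subtype.val (Finset.mem_filter.1 hc₀).2
  have hex : ∀ c : Fin p, F c = N → ∃ H : Fin 3 → Fin 3 → 𝓞 K,
      (∀ i j, H i j = 0 ∨ H i j = 1 ∨ H i j = -1) ∧
      ∀ y, y ∈ neighbor (p : 𝓞 K) (w c) ↔ ∃ y' ∈ neighbor (p : 𝓞 K) (w c₀),
        (p : 𝓞 K) ^ 2 • y = Matrix.mulVec ((p : 𝓞 K) ^ 2 • Matrix.of H) y' := by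
    intro c hc
    obtain ⟨P, hP₁, hP₂, hP₃⟩ := OKLattice.exists_matrix_of_range_eq (hf c) (hf c₀)
      ((congrArg Subtype.val hc).trans hc₀'.symm)
    have hp2 : ∀ σ : K →+* ℝ, σ ((p : 𝓞 K) ^ 2 : 𝓞 K) = p ^ 2 := fun σ => by
      change σ (algebraMap (𝓞 K) K ((p : 𝓞 K) ^ 2)) = _
      rw [map_pow, map_pow, map_natCast, map_natCast]
    have hdvd : ∀ i j, (p : 𝓞 K) ^ 2 ∣ P i j := by
      intro i j
      have h1 := sq_dvd_of_neighbor_vecMul (integerHom σ₁) (integerHom σ₂) (p := (p : 𝓞 K))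
        (by rw [map_natCast]; exact Nat.cast_ne_zero.2 hp.ne_zero)
        (by rw [map_natCast, map_natCast]) hP₁ (by
          ext i j
          exact hσ _ fun σ => hp2 σ ▸ hP₃ σ i j)
        ((dvd_pow_self _ two_ne_zero).trans (hww c)) ((dvd_pow_self _ two_ne_zero).trans (hww c₀))
        (huw c) (hγ c) (hγ c₀) i j
      have h2 := natCast_dvd_of_integerHom σ₁ (pow_ne_zero 2 hp.ne_zero) (x := P i j)
        (by rw [Nat.cast_pow, map_pow]; exact h1)
      rwa [Nat.cast_pow] at h2
    choose H hH using hdvd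
    have hPH : P = (p : 𝓞 K) ^ 2 • Matrix.of H := by
      ext i j
      rw [hH]; rfl
    refine ⟨H, fun i j => ?_, hPH ▸ hP₂⟩
    have h3 : ∀ σ : K →+* ℝ, |σ (H i j)| ≤ 1 := by
      intro σ
      have h4 := hP₃ σ i j
      have hpos : (0 : ℝ) < p ^ 2 := by have := hp.pos; positivity
      rw [hp2, hH] at h4
      change |σ (algebraMap (𝓞 K) K (_ * H i j))| ≤ _ at h4
      have hp2' : σ (algebraMap (𝓞 K) K ((p : 𝓞 K) ^ 2)) = p ^ 2 := hp2 σ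
      rw [map_mul, map_mul, hp2', abs_mul, abs_of_pos hpos] at h4
      exact le_of_mul_le_mul_left (by rwa [mul_one]) hpos
    rcases hK.eq_of_bounded_one (RingOfIntegers.isIntegral_coe (H i j)) h3 with h | h | h
    · exact Or.inl (RingOfIntegers.ext h)
    · exact Or.inr (Or.inl (RingOfIntegers.ext h))
    · exact Or.inr (Or.inr (RingOfIntegers.ext (h.trans (by simp))))
  choose! H hH₁ hH₂ using hex
  have hcard : (Finset.univ.filter fun c => F c = N).card ≤ 3 ^ 9 := by
    have hT : (Fintype.piFinset fun _ : Fin 3 => Fintype.piFinset fun _ : Fin 3 =>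
        ({0, 1, -1} : Finset (𝓞 K))).card ≤ 3 ^ 9 := by
      rw [Fintype.card_piFinset_const, Fintype.card_piFinset_const,
        show (3 : ℕ) ^ 9 = (3 ^ 3) ^ 3 by norm_num]
      exact Nat.pow_le_pow_left (Nat.pow_le_pow_left Finset.card_le_three 3) 3
    refine (Finset.card_le_card_of_injOn H ?_ ?_).trans hT
    · intro c hc
      have hc' := (Finset.mem_filter.1 hc).2
      simp only [Finset.mem_coe, Fintype.mem_piFinset, Finset.mem_insert, Finset.mem_singleton]
      exact hH₁ c hc'
    · intro c hc c' hc' h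
      have e := (Finset.mem_filter.1 hc).2
      have e' := (Finset.mem_filter.1 hc').2
      have hmem : w c' ∈ neighbor (p : 𝓞 K) (w c) := by
        rw [hH₂ c e, h, ← hH₂ c' e']
        exact self_mem_neighbor
      have h1 := sq_dvd_dotProduct_of_mem_neighbor (hww c) self_mem_neighbor hmem
      rw [hw, isoVec_dotProduct, hab] at h1
      push_cast at h1
      rw [mul_assoc] at h1
      have h2 := (dvd_pow_self _ two_ne_zero).trans ((dvd_add_left (dvd_mul_right _ _)).1 h1)
      have h3 : (p : 𝓞 K) ∣ ((2 * ((c : ℤ) - (c' : ℤ)) ^ 2 : ℤ) : 𝓞 K) := by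
        push_cast
        rwa [add_sub_add_left_eq_sub] at h2
      have hpp := Nat.prime_iff_prime_int.1 hp
      rcases hpp.dvd_or_dvd (Int.dvd_of_natCast_dvd_intCast hp h3) with h4 | h4
      · have h5 : p ∣ 2 := by exact_mod_cast h4
        have := Nat.le_of_dvd two_pos h5
        have h6 : 0 < 2 ^ R := by positivity
        have h7 : 1 * 3 ^ 9 ≤ 2 ^ R * 3 ^ 9 := Nat.mul_le_mul_right _ h6
        omega
      · have h5 := hpp.dvd_of_dvd_pow h4
        have h6 := Int.eq_zero_of_abs_lt_dvd h5 (by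
          have := c.2; have := c'.2
          rw [abs_lt]; constructor <;> omega)
        exact Fin.ext (by omega)
  omega

end Separation

section Primes

theorem exists_finset_primes (k : ℕ) {x : ℕ} (hx : x ≠ 0) :
    ∃ s : Finset ℕ, s.card = k ∧ ∀ p ∈ s, p.Prime ∧ x < p ∧ p ≤ 2 ^ k * x := by
  induction k with
  | zero => exact ⟨∅, rfl, by simp⟩
  | succ k ih =>
    obtain ⟨s, hs, h⟩ := ih
    obtain ⟨p, hp, hlt, hle⟩ := Nat.exists_prime_lt_and_le_two_mul (2 ^ k * x)
      (mul_ne_zero (by positivity) hx)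
    have hxk : x ≤ 2 ^ k * x := Nat.le_mul_of_pos_left _ (by positivity)
    have hps : p ∉ s := fun hp => (h p hp).2.2.not_gt hlt
    refine ⟨insert p s, by rw [Finset.card_insert_of_notMem hps, hs], fun q hq => ?_⟩
    rcases Finset.mem_insert.1 hq with rfl | hq
    · exact ⟨hp, hxk.trans_lt hlt, hle.trans_eq (by ring)⟩
    · obtain ⟨h1, h2, h3⟩ := h q hq
      exact ⟨h1, h2, h3.trans (Nat.mul_le_mul_right _ (Nat.pow_le_pow_right two_pos k.le_succ))⟩

theorem exists_prime_not_dvd {k x n : ℕ} (hx : x ≠ 0) (hn : n ≠ 0) (h : n < (x + 1) ^ k) :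
    ∃ p, p.Prime ∧ x < p ∧ p ≤ 2 ^ k * x ∧ ¬ p ∣ n := by
  obtain ⟨s, hs, hp⟩ := exists_finset_primes k hx
  by_contra! hc
  have h1 := Finset.prod_primes_dvd (s := s) n (fun p hps => (hp p hps).1.prime)
    fun p hps => hc p (hp p hps).1 (hp p hps).2.1 (hp p hps).2.2
  have h2 := Finset.pow_card_le_prod s (fun p => p) (x + 1) fun p hps => (hp p hps).2.1
  rw [hs] at h2
  exact (h2.trans (Nat.le_of_dvd (Nat.pos_of_ne_zero hn) h1)).not_gt h

end Primes

section Differences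

variable {K : Type} [Field K] [NumberField K]

theorem TotallyReal.exists_natCast_of_ne (hK : TotallyReal K) (σ₁ σ₂ : K →+* ℝ) (t : 𝓞 K) {B : ℝ}
    (hB : 1 ≤ B) (ht : ∀ σ : K →+* ℝ, |σ t| ≤ B) (hne : σ₁ t ≠ σ₂ t) {D : ℕ}
    (hD : Module.finrank ℚ K ≤ D) :
    ∃ (n : ℕ) (y : ℝ), n ≠ 0 ∧ IsIntegral ℤ y ∧ (σ₁ t - σ₂ t) * y = n ∧
      (n : ℝ) ≤ (2 * B) ^ D ^ 2 := by
  let F (σ : K →+* ℝ) : IntermediateField ℚ ℝ := σ.toRatAlgHom.fieldRange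
  have hfin (σ : K →+* ℝ) : FiniteDimensional ℚ (F σ) :=
    Module.Finite.range σ.toRatAlgHom.toLinearMap
  have hrank (σ : K →+* ℝ) : Module.finrank ℚ (F σ) ≤ D :=
    (LinearMap.finrank_range_le σ.toRatAlgHom.toLinearMap).trans hD
  have := hfin σ₁
  have := hfin σ₂
  let E := F σ₁ ⊔ F σ₂
  have : FiniteDimensional ℚ E := IntermediateField.finiteDimensional_sup _ _
  have : NumberField E := ⟨⟩
  let τ₁ : K →+* E := σ₁.codRestrict E fun x => (le_sup_left : F σ₁ ≤ E) ⟨x, rfl⟩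
  let τ₂ : K →+* E := σ₂.codRestrict E fun x => (le_sup_right : F σ₂ ≤ E) ⟨x, rfl⟩
  have hInt (τ : K →+* E) : IsIntegral ℤ (τ t) :=
    (RingOfIntegers.isIntegral_coe t).map τ.toIntAlgHom
  obtain ⟨n, y, hn, hy, hxy, hle⟩ := exists_isIntegral_mul_eq_natCast_le
    (x := τ₁ t - τ₂ t) ((hInt τ₁).sub (hInt τ₂))
    (fun h => hne (congrArg (algebraMap E ℝ) (sub_eq_zero.1 h))) (B := 2 * B) (fun φ => by
      rw [map_sub, two_mul]
      exact (norm_sub_le _ _).trans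
        (add_le_add (hK.norm_le ht (φ.comp τ₁)) (hK.norm_le ht (φ.comp τ₂))))
  refine ⟨n, y, hn, hy.map (algebraMap E ℝ).toIntAlgHom, ?_, hle.trans ?_⟩
  · have := congrArg (algebraMap E ℝ) hxy
    rw [map_mul, map_sub, map_natCast] at this
    exact this
  · refine pow_le_pow_right₀ (by linarith) ?_
    rw [sq]
    exact (IntermediateField.finrank_sup_le _ _).trans (Nat.mul_le_mul (hrank σ₁) (hrank σ₂))

end Differences

section Bound

/-- Integers with all conjugates bounded by `B` separate the real embeddings. -/
def Separates (K : Type) [Field K] (B : ℝ) : Prop :=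
  ∀ σ₁ σ₂ : K →+* ℝ, (∀ x : 𝓞 K, (∀ σ : K →+* ℝ, |σ x| ≤ B) → σ₁ x = σ₂ x) → σ₁ = σ₂

theorem Separates.mono {K : Type} [Field K] {B B' : ℝ} (h : Separates K B) (hB : B ≤ B') :
    Separates K B' :=
  fun σ₁ σ₂ hσ => h σ₁ σ₂ fun x hx => hσ x fun σ => (hx σ).trans hB

theorem exists_separates (K : Type) [Field K] [NumberField K] : ∃ n : ℕ, Separates K n := by
  have key : ∀ q : (K →+* ℝ) × (K →+* ℝ), ∃ n : ℕ,
      (∀ x : 𝓞 K, (∀ σ : K →+* ℝ, |σ x| ≤ n) → q.1 x = q.2 x) → q.1 = q.2 := by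
    rintro ⟨σ₁, σ₂⟩
    by_cases h : ∀ x : 𝓞 K, σ₁ x = σ₂ x
    · refine ⟨0, fun _ => RingHom.ext fun x => ?_⟩
      obtain ⟨m, hm, hx⟩ := exists_natCast_mul_isIntegral x
      have h1 : σ₁ (m * x) = σ₂ (m * x) := h ⟨_, hx⟩
      rw [map_mul, map_mul, map_natCast, map_natCast] at h1
      exact mul_left_cancel₀ (Nat.cast_ne_zero.2 hm) h1
    · push Not at h
      obtain ⟨x, hx⟩ := h
      obtain ⟨n, hn⟩ := exists_nat_ge (∑ σ : K →+* ℝ, |σ x|)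
      refine ⟨n, fun h => absurd (h x fun σ => ?_) hx⟩
      exact (Finset.single_le_sum (f := fun σ : K →+* ℝ => |σ x|) (fun _ _ => abs_nonneg _)
        (Finset.mem_univ σ)).trans hn
  choose f hf using key
  refine ⟨∑ q, f q, fun σ₁ σ₂ hσ => hf (σ₁, σ₂) fun x hx => hσ x fun σ => (hx σ).trans ?_⟩
  exact_mod_cast Finset.single_le_sum (fun _ _ => Nat.zero_le _) (Finset.mem_univ (σ₁, σ₂))

theorem Nat.exists_pow_four_le (n : ℕ) : ∃ x, x ^ 4 ≤ n ∧ n < (x + 1) ^ 4 := by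
  refine ⟨n.sqrt.sqrt, ?_, ?_⟩
  · calc n.sqrt.sqrt ^ 4 = (n.sqrt.sqrt ^ 2) ^ 2 := by ring
      _ ≤ n.sqrt ^ 2 := Nat.pow_le_pow_left (Nat.sqrt_le' _) 2
      _ ≤ n := Nat.sqrt_le' _
  · calc n < (n.sqrt + 1) ^ 2 := Nat.lt_succ_sqrt' n
      _ ≤ ((n.sqrt.sqrt + 1) ^ 2) ^ 2 := Nat.pow_le_pow_left (Nat.lt_succ_sqrt' _) 2
      _ = (n.sqrt.sqrt + 1) ^ 4 := by ring

theorem OKLattice.exists_separates_bound (R D : ℕ) : ∃ B : ℕ, ∀ (K : Type) [Field K]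
    [NumberField K], TotallyReal K → Module.finrank ℚ K ≤ D → ∀ L : OKLattice K, L.rank ≤ R →
      (∀ M : OKLattice K, M.rank = 3 → L.Represents M) → Separates K B := by
  classical
  set k := 5 * D ^ 2 + 1 with hk
  set X := max (2 ^ R * 3 ^ 9) (2 ^ (k + 1))
  refine ⟨X ^ 4, fun K _ _ hK hD L hR hL => ?_⟩
  have hex := exists_separates K
  by_contra hsep
  set l := Nat.find hex with hl
  have hXl : X ^ 4 < l := by
    by_contra! h
    exact hsep ((Nat.find_spec hex).mono (Nat.cast_le.2 h))
  obtain ⟨x, hxl, hlx⟩ := Nat.exists_pow_four_le l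
  have hXx : X ≤ x := Nat.lt_succ_iff.1 (lt_of_pow_lt_pow_left₀ 4 (Nat.zero_le _) (hXl.trans hlx))
  have hx1 : 2 ^ R * 3 ^ 9 ≤ x := (le_max_left _ _).trans hXx
  have hx2 : 2 ^ (k + 1) ≤ x := (le_max_right _ _).trans hXx
  have hx0 : 2 ≤ x := (by rw [pow_succ]; exact Nat.le_mul_of_pos_left _ (by positivity) :
    2 ≤ 2 ^ (k + 1)).trans hx2
  have hl1 : l - 1 < l := by omega
  have hmin := Nat.find_min hex hl1
  simp only [Separates, not_forall] at hmin
  obtain ⟨σ₁, σ₂, hσ, hne⟩ := hmin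
  obtain ⟨t, ht, hδ⟩ : ∃ t : 𝓞 K, (∀ σ : K →+* ℝ, |σ t| ≤ l) ∧ σ₁ t ≠ σ₂ t := by
    by_contra! h
    exact hne (Nat.find_spec hex σ₁ σ₂ h)
  obtain ⟨n, y, hn, hy, hny, hle⟩ := hK.exists_natCast_of_ne σ₁ σ₂ t
    (by exact_mod_cast (show 1 ≤ l by omega)) ht hδ hD
  have hle' : n ≤ (2 * l) ^ D ^ 2 := by exact_mod_cast hle
  have hnlt : n < (x + 1) ^ k := by
    calc n ≤ (2 * l) ^ D ^ 2 := hle'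
      _ ≤ ((x + 1) * (x + 1) ^ 4) ^ D ^ 2 :=
        Nat.pow_le_pow_left (Nat.mul_le_mul (by omega) hlx.le) _
      _ = (x + 1) ^ (5 * D ^ 2) := by rw [← pow_succ', ← pow_mul]
      _ < (x + 1) ^ k := Nat.pow_lt_pow_right (by omega) (by omega)
  obtain ⟨p, hp, hxp, hpx, hpn⟩ := exists_prime_not_dvd (by omega) hn hnlt
  have hpl : p ^ 2 ≤ l - 1 := by
    have h1 : 2 * p ≤ x ^ 2 := by
      calc 2 * p ≤ 2 * (2 ^ k * x) := by omega
        _ = 2 ^ (k + 1) * x := by ring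
        _ ≤ x * x := Nat.mul_le_mul_right _ hx2
        _ = x ^ 2 := by ring
    have h2 : (2 * p) ^ 2 ≤ l := (Nat.pow_le_pow_left h1 2).trans (by rwa [← pow_mul])
    have h3 : 0 < p ^ 2 := pow_pos hp.pos 2
    have h4 : (2 * p) ^ 2 = 4 * p ^ 2 := by ring
    omega
  obtain ⟨r, s, hrs⟩ : ∃ r s : ℤ, r * n + s * p = 1 := by
    have := (Nat.isCoprime_iff_coprime.2 ((Nat.Prime.coprime_iff_not_dvd hp).2 hpn)).symm
    exact this
  refine L.false_of_agree hK hR hL hp (hp.odd_of_ne_two (by omega)) (by omega) σ₁ σ₂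
    (fun z hz => hσ z fun σ => (hz σ).trans ?_) t (y := r * y) (k := s) ?_ ?_ ?_
  · exact_mod_cast hpl
  · exact (isIntegral_algebraMap (R := ℤ) (x := r)).mul hy
  · exact isIntegral_algebraMap (R := ℤ) (x := s)
  · have hrs' : (r : ℝ) * n + s * p = 1 := by exact_mod_cast hrs
    linear_combination -r * hny - hrs'

end Bound

section Finiteness

theorem Subfield.eq_closure_of_separates {K : Subfield ℝ} (hfin : FiniteDimensional ℚ K)
    (hK : TotallyReal K) {B : ℝ} (h : Separates K B) :
    Subfield.closure ((↑) '' {x : K | IsIntegral ℤ x ∧ ∀ σ : K →+* ℝ, |σ x| ≤ B}) = K := by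
  set T := {x : K | IsIntegral ℤ x ∧ ∀ σ : K →+* ℝ, |σ x| ≤ B} with hT
  have htop : IntermediateField.adjoin ℚ T = ⊤ := by
    set F := IntermediateField.adjoin ℚ T
    have hsub : Subsingleton (K →ₐ[F] ℂ) := by
      refine ⟨fun φ₁ φ₂ => ?_⟩
      obtain ⟨σ₁, h₁⟩ := hK.exists_real φ₁.toRingHom
      obtain ⟨σ₂, h₂⟩ := hK.exists_real φ₂.toRingHom
      have hσ : σ₁ = σ₂ := h σ₁ σ₂ fun x hx => by
        have hx' : (x : K) ∈ F := IntermediateField.subset_adjoin ℚ T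
          ⟨RingOfIntegers.isIntegral_coe x, hx⟩
        have h3 : φ₁ (x : K) = φ₂ x :=
          (φ₁.commutes (⟨x, hx'⟩ : F)).trans (φ₂.commutes (⟨x, hx'⟩ : F)).symm
        exact Complex.ofReal_injective ((h₁ x).symm.trans (h3.trans (h₂ x)))
      exact AlgHom.ext fun x => (h₁ x).trans ((congrArg (fun σ => ((σ x : ℝ) : ℂ)) hσ).trans
        (h₂ x).symm)
    rw [← IntermediateField.finrank_eq_one_iff_eq_top]
    refine le_antisymm ?_ Module.finrank_pos
    rw [← AlgHom.card F K ℂ]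
    exact Fintype.card_le_one_iff_subsingleton.2 hsub
  refine le_antisymm (Subfield.closure_le.2 ?_) fun x hx => ?_
  · rintro _ ⟨x, -, rfl⟩
    exact x.2
  · have hx' : (⟨x, hx⟩ : K) ∈ IntermediateField.adjoin ℚ T := htop ▸ IntermediateField.mem_top
    have : ∀ y ∈ IntermediateField.adjoin ℚ T, (y : ℝ) ∈ Subfield.closure ((↑) '' T : Set ℝ) := by
      intro y hy
      induction hy using IntermediateField.adjoin_induction with
      | mem y hy => exact Subfield.subset_closure ⟨y, hy, rfl⟩
      | algebraMap q => simp
      | add y z _ _ hy hz => exact add_mem hy hz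
      | inv y _ hy => exact inv_mem hy
      | mul y z _ _ hy hz => exact mul_mem hy hz
    exact this _ hx'

theorem Real.finite_conjugates_bounded (d : ℕ) (B : ℝ) :
    {x : ℝ | ∃ K : Subfield ℝ, FiniteDimensional ℚ K ∧ Module.finrank ℚ K = d ∧
      ∃ y : K, (y : ℝ) = x ∧ IsIntegral ℤ y ∧ ∀ φ : K →+* ℂ, ‖φ y‖ ≤ B}.Finite := by
  classical
  let C := Nat.ceil (max B 1 ^ d * d.choose (d / 2))
  refine (Polynomial.bUnion_roots_finite (algebraMap ℤ ℝ) d (Set.finite_Icc (-C : ℤ) C)).subset ?_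
  rintro _ ⟨K, hK, hd, y, rfl, hy, hB⟩
  have : NumberField K := ⟨⟩
  simp_rw [Set.mem_iUnion]
  have hmin := minpoly.isIntegrallyClosed_eq_field_fractions' ℚ hy
  refine ⟨minpoly ℤ y, ⟨?_, fun i => ?_⟩, ?_⟩
  · rw [← (minpoly.monic hy).natDegree_map (algebraMap ℤ ℚ), ← hmin, ← hd]
    exact minpoly.natDegree_le y
  · rw [Set.mem_Icc, ← abs_le, ← @Int.cast_le ℝ]
    refine (Eq.trans_le ?_ (Embeddings.coeff_bdd_of_norm_le hB i)).trans ?_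
    · rw [hmin, Polynomial.coeff_map, eq_intCast, Int.norm_cast_rat, Int.norm_eq_abs, Int.cast_abs]
    · rw [hd, Int.cast_natCast]
      exact Nat.le_ceil _
  · refine Polynomial.mem_rootSet.2 ⟨minpoly.ne_zero hy, ?_⟩
    have := congrArg (algebraMap K ℝ) (minpoly.aeval ℤ y)
    rw [← Polynomial.aeval_algebraMap_apply, map_zero] at this
    exact this

theorem Subfield.finite_separates (D : ℕ) (B : ℝ) :
    {K : Subfield ℝ | FiniteDimensional ℚ K ∧ TotallyReal K ∧ Module.finrank ℚ K ≤ D ∧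
      Separates K B}.Finite := by
  have hfin := (Set.finite_Iic D).biUnion fun d _ => Real.finite_conjugates_bounded d B
  refine (hfin.finite_subsets.image Subfield.closure).subset ?_
  rintro K ⟨hK, hreal, hD, hsep⟩
  refine ⟨_, ?_, Subfield.eq_closure_of_separates hK hreal hsep⟩
  rintro _ ⟨x, ⟨hx, hB⟩, rfl⟩
  exact Set.mem_biUnion (Set.mem_Iic.2 hD) ⟨K, hK, rfl, x, rfl, hx, hreal.norm_le hB⟩

end Finiteness

theorem stmt3 (C : ℝ) (hC : 0 < C) (n : ℕ) (hn : 3 ≤ n) :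
    {K : Subfield ℝ |
      FiniteDimensional ℚ K ∧ TotallyReal K ∧ (minUnivRank K n : ℝ) < C}.Finite := by
  obtain ⟨D, hD⟩ := OKLattice.exists_degree_bound ⌈C⌉₊
  obtain ⟨B, hB⟩ := OKLattice.exists_separates_bound ⌈C⌉₊ D
  refine (Subfield.finite_separates D B).subset ?_
  rintro K ⟨hK, hreal, hlt⟩
  have : NumberField K := ⟨⟩
  obtain ⟨U, hU⟩ := OKLattice.exists_isUniversal hreal n
  obtain ⟨L, hL, hrank⟩ := Nat.sInf_mem (s := {r | ∃ L : OKLattice K, L.IsUniversal n ∧ L.rank = r})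
    ⟨_, U, hU, rfl⟩
  obtain ⟨σ⟩ := hreal.nonempty_embedding
  have hR : L.rank ≤ ⌈C⌉₊ := by
    have h1 : (L.rank : ℝ) < C := hrank ▸ hlt
    exact_mod_cast h1.le.trans (Nat.le_ceil C)
  have hrep : ∀ M : OKLattice K, M.rank = 3 → L.Represents M := fun M hM =>
    hL.represents_of_rank_le σ (hM.trans_le hn)
  have hd := hD K hreal L hR hrep
  exact ⟨hK, hreal, hd, hB K hreal hd L hR hrep⟩
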